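/- (Well-posedness of the conformal Dirichlet problem.) Let n ≥ 2, 0 ≤ p ≤ n/2 and 2 − n + 2p < a < 1. Then for every f ∈ Ḣ^{(1−a)/2,p}(ℝ^{n−1}) there exists a unique u ∈ Ḣ^{(2−a)/2,p}(ℝ^n) such that Δ_{a,p} u = 0 in the sense of tempered distributions and u|_{ℝ^{n−1}} = f, where u|_{ℝ^{n−1}} denotes the Sobolev trace of u. -/

import Mathlib

open MeasureTheory Complex Finset

noncomputable section

/-- Euclidean space ℝ^n -/
abbrev Rn (n : ℕ) := EuclideanSpace ℝ (Fin n)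

/-- The full exterior algebra Λ^•ℂ^n, realized as the Euclidean space with orthonormal
basis indexed by subsets of {1,…,n} (the basis e_S = e_{i_1}∧…∧e_{i_p}). -/
abbrev Lam (n : ℕ) := EuclideanSpace ℂ (Finset (Fin n))

variable {n : ℕ}

/-- the sign (-1)^{#{i ∈ S : i < j}} -/
def wsign (j : Fin n) (S : Finset (Fin n)) : ℂ := (-1) ^ (S.filter (· < j)).card

/-- exterior multiplication ε_x by x ∈ ℂ^n -/
def eps (x : Fin n → ℂ) (v : Lam n) : Lam n :=
  WithLp.toLp 2 fun S => ∑ j ∈ S, wsign j S * x j * v (S.erase j)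

/-- interior multiplication i_x by x ∈ ℂ^n (adjoint of ε_x for real x) -/
def iot (x : Fin n → ℂ) (v : Lam n) : Lam n :=
  WithLp.toLp 2 fun S => ∑ j ∈ Sᶜ, wsign j S * x j * v (insert j S)

/-- v lies in the degree-p part Λ^p ℂ^n ⊆ Λ^• ℂ^n -/
def IsForm (p : ℕ) (v : Lam n) : Prop := ∀ S, S.card ≠ p → v S = 0

/-- complexification of a real vector -/
def rc (x : Fin n → ℝ) : Fin n → ℂ := fun j => (x j : ℂ)

/-- the j-th standard basis vector of ℂ^n -/
def ee (j : Fin n) : Fin n → ℂ := fun i => if i = j then 1 else 0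

/-- extend x' ∈ ℝ^{n-1} by last coordinate t to the vector (x',t) ∈ ℝ^n -/
def app (x' : Rn (n-1)) (t : ℝ) : Rn n :=
  WithLp.toLp 2 fun j => if h : (j : ℕ) < n - 1 then x' ⟨j, h⟩ else t

/-- restriction ℝ^n → ℝ^{n-1}, x ↦ x' -/
def restr (ξ : Rn n) : Rn (n-1) := WithLp.toLp 2 fun i => ξ (Fin.castLE (Nat.sub_le n 1) i)

/-- the embedding Fin (n-1) ↪ Fin n -/
def embF : Fin (n-1) ↪ Fin n := ⟨Fin.castLE (Nat.sub_le n 1), (Fin.castLE_injective _)⟩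

/-- pullback Λ^• ℂ^n → Λ^• ℂ^{n-1}; on p-forms this is the projection i_{e_n} ε_{e_n}
followed by restriction of indices. -/
def projL (v : Lam n) : Lam (n-1) := WithLp.toLp 2 fun T => v (T.map embF)

/-- the inclusion Λ^• ℂ^{n-1} ⊆ Λ^• ℂ^n -/
def incL (v : Lam (n-1)) : Lam n :=
  WithLp.toLp 2 fun S => ∑ T : Finset (Fin (n-1)), if T.map embF = S then v T else 0

/-- the operator i_z ε_z - ε_z i_z -/
def cmm (z : Fin n → ℂ) (v : Lam n) : Lam n := iot z (eps z v) - eps z (iot z v)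

/-- partial derivative ∂/∂x_j -/
def pd (j : Fin n) (u : Rn n → Lam n) : Rn n → Lam n :=
  fun x => fderiv ℝ u x (EuclideanSpace.single j 1)

/-- the differential operator Δ_{a,p} = x_n²Δ + a x_n ∂_n + 2x_n(i_{e_n}d' - ε_{e_n}δ')
- (n-2p) ε_{e_n} i_{e_n}; here ℓ is the index of the last coordinate. -/
def Dap (a : ℝ) (p : ℕ) (ℓ : Fin n) (u : Rn n → Lam n) (x : Rn n) : Lam n :=
  ((x ℓ)^2 : ℝ) • (∑ j, pd j (pd j u) x)
  + (a * x ℓ) • pd ℓ u x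
  + (2 * x ℓ) • (iot (ee ℓ) (∑ j ∈ univ.erase ℓ, eps (ee j) (pd j u x))
      - eps (ee ℓ) (-(∑ j ∈ univ.erase ℓ, iot (ee j) (pd j u x))))
  - ((n : ℝ) - 2*p) • eps (ee ℓ) (iot (ee ℓ) (u x))

/-- the formal transpose of Δ_{a,p} with respect to the bilinear pairing
∫ ⟨u(x), φ(x)⟩ dx (⟨·,·⟩ the bilinear form with ⟨e_S, e_T⟩ = δ_{ST}):
Δ_{a,p}ᵗφ = Δ(x_n²φ) - a ∂_n(x_n φ) - 2x_n Σ_j (i_{e_j}ε_{e_n} + ε_{e_j}i_{e_n}) ∂_j φ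
- (n-2p) ε_{e_n} i_{e_n} φ. -/
def DapT (a : ℝ) (p : ℕ) (ℓ : Fin n) (φ : Rn n → Lam n) (x : Rn n) : Lam n :=
  (∑ j, pd j (pd j (fun y => ((y ℓ)^2 : ℝ) • φ y)) x)
  - a • pd ℓ (fun y => (y ℓ) • φ y) x
  - (2 * x ℓ) • (∑ j ∈ univ.erase ℓ,
      (iot (ee j) (eps (ee ℓ) (pd j φ x)) + eps (ee j) (iot (ee ℓ) (pd j φ x))))
  - ((n : ℝ) - 2*p) • eps (ee ℓ) (iot (ee ℓ) (φ x))

/-- the Fourier transform with the convention û(ξ) = (2π)^{-n/2} ∫ e^{-i x·ξ} u(x) dx -/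
def ft (u : Rn n → Lam n) : Rn n → Lam n := fun ξ =>
  ((2 * Real.pi) ^ (-(n:ℝ)/2) : ℝ) •
    ∫ x, Complex.exp (-(((∑ j, x j * ξ j : ℝ) : ℂ) * Complex.I)) • u x

/-- the inverse Fourier transform -/
def ftInv (u : Rn n → Lam n) : Rn n → Lam n := fun ξ =>
  ((2 * Real.pi) ^ (-(n:ℝ)/2) : ℝ) •
    ∫ x, Complex.exp ((((∑ j, x j * ξ j : ℝ) : ℂ) * Complex.I)) • u x

/-- The homogeneous Sobolev space Ḣ^{s,p}(ℝ^n) of Λ^pℂ^n-valued tempered distributions,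
modeled on the Fourier transform side: an element of the set is the function g = û. -/
def Hdot (n : ℕ) (s : ℝ) (p : ℕ) : Set (Rn n → Lam n) :=
  {g | AEStronglyMeasurable g volume ∧ (∀ ξ, IsForm p (g ξ)) ∧
    Integrable (fun ξ => ‖ξ‖ ^ (2*s) * ‖g ξ‖^2)}

/-- squared weighted L² norm ∫ ‖ξ‖^t ‖g(ξ)‖² dξ on the Fourier side;
wInt (2s) g is the squared homogeneous Sobolev norm of degree s of u with û = g. -/
def wInt (t : ℝ) (g : Rn n → Lam n) : ℝ := ∫ ξ, ‖ξ‖ ^ t * ‖g ξ‖^2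

/-- the operator (c - λ) i_x ε_x + (c + λ) ε_x i_x on Λ^•ℂ^n -/
def opC (c lam : ℝ) (x : Fin n → ℝ) (v : Lam n) : Lam n :=
  ((c - lam : ℝ) : ℂ) • iot (rc x) (eps (rc x) v)
    + ((c + lam : ℝ) : ℂ) • eps (rc x) (iot (rc x) v)

/-- the conformally invariant squared norm ‖u‖_λ² on the Fourier side (for û = g);
c is dim/2 - p, i.e. n/2 - p on ℝ^n and (n-1)/2 - p on ℝ^{n-1}. -/
def cSq (c lam : ℝ) (g : Rn n → Lam n) : ℝ :=
  ∫ ξ, ‖ξ‖ ^ (-(2*lam)) * (inner ℂ (g ξ) (opC c lam (‖ξ‖⁻¹ • ξ) (g ξ)) : ℂ).re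

/-- the conformally invariant inner product on the Fourier side -/
def cIp (c lam : ℝ) (g h : Rn n → Lam n) : ℂ :=
  ∫ ξ, (‖ξ‖ ^ (-(2*lam)) : ℝ) • (inner ℂ (g ξ) (opC c lam (‖ξ‖⁻¹ • ξ) (h ξ)) : ℂ)

/-- the bilinear pairing on Λ^•ℂ^n with ⟨e_S, e_T⟩ = δ_{ST} -/
def blin (v w : Lam n) : ℂ := ∑ S, v S * w S

/-- the pairing ⟨u, ψ⟩ of the tempered distribution u whose Fourier transform is g
with a Schwartz function ψ: ⟨u, ψ⟩ = ⟨û, 𝓕⁻¹ψ⟩ = ∫ ⟨g(ξ), (𝓕⁻¹ψ)(ξ)⟩ dξ. -/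
def dpair (g : Rn n → Lam n) (ψ : Rn n → Lam n) : ℂ :=
  ∫ ξ, blin (g ξ) (ftInv ψ ξ)

/-- "Δ_{a,p} u = μ u in the sense of tempered distributions", expressed for the
distribution u whose Fourier transform is g: testing against all Λ^•ℂ^n-valued
Schwartz functions φ via the formal transpose of Δ_{a,p}. -/
def WeakEig (a : ℝ) (p : ℕ) (ℓ : Fin n) (g : Rn n → Lam n) (μ : ℂ) : Prop :=
  ∀ φ : SchwartzMap (Rn n) (Lam n),
    dpair g (fun x => DapT a p ℓ (fun y => φ y) x - μ • φ x) = 0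

/-- the Fourier side of the trace map u ↦ u|_{ℝ^{n-1}}:
(Ru)^(ξ') = (2π)^{-1/2} ∫_ℝ û(ξ', ξ_n) dξ_n, composed with the pullback
Λ^pℂ^n → Λ^pℂ^{n-1}. -/
def ftrace (g : Rn n → Lam n) : Rn (n-1) → Lam (n-1) := fun ξ' =>
  ((2 * Real.pi) ^ (-(1:ℝ)/2) : ℝ) • ∫ t : ℝ, projL (g (app ξ' t))

/-- the constant c_{a,p} -/
def cP (n p : ℕ) (a : ℝ) : ℝ :=
  2 * Real.Gamma (((n:ℝ) - a + 2)/2) /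
    (Real.pi ^ (((n:ℝ)-1)/2) * ((n:ℝ) - 2*p - a) * Real.Gamma ((1-a)/2))

/-- the Poisson transform P_{a,p}f(x) = c_{a,p} ∫_{ℝ^{n-1}} |x_n|^{1-a}
(|x'-y|²+x_n²)^{-(n-a+2)/2} (i_{x-y}ε_{x-y} - ε_{x-y}i_{x-y}) f(y) dy,
where ℓ is the index of the last coordinate. -/
def Pois (a : ℝ) (p : ℕ) (ℓ : Fin n) (f : Rn (n-1) → Lam (n-1)) (x : Rn n) : Lam n :=
  cP n p a • ∫ y : Rn (n-1),
    (|x ℓ| ^ (1-a) * ‖x - app y 0‖ ^ (-((n:ℝ) - a + 2))) •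
      cmm (rc (x - app y 0)) (incL (f y))

/-- "G is the Fourier transform of the (polynomially bounded, locally integrable)
function u in the sense of tempered distributions":
∫ ⟨G(ξ), ψ(ξ)⟩ dξ = ∫ ⟨u(x), ψ̂(x)⟩ dx for every Schwartz function ψ. -/
def IsFTof (G : Rn n → Lam n) (u : Rn n → Lam n) : Prop :=
  ∀ ψ : SchwartzMap (Rn n) (Lam n),
    ∫ ξ, blin (G ξ) (ψ ξ) = ∫ x, blin (u x) (ft (fun y => ψ y) x)

section Helpers
set_option linter.unusedSimpArgs false
set_option linter.unusedVariables false
set_option linter.unusedTactic false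
set_option linter.unreachableTactic false
open scoped ContDiff SchwartzMap FourierTransform LineDeriv


lemma half_convex (h k : ℝ → ℂ) (Q V Wt : ℝ → ℝ) (m c : ℝ) (hm : 0 < m) (hc : 0 < c)
    (hh : ∀ t, HasDerivAt h (Q t • k t) t) (hk : ∀ t, HasDerivAt k (V t • h t) t)
    (hV : ∀ t, 0 < V t) (hQ0 : ∀ t, 0 < Q t)
    (hQ : ∀ t, 1 ≤ t → c * t ^ (m-1) ≤ Q t) (hW : ∀ t, 1 ≤ t → c * t ^ (-m-1) ≤ Wt t)
    (hInt : Integrable (fun t => ‖h t‖^2 * Wt t)) (t₀ : ℝ) :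
    inner ℝ (h t₀) (k t₀) ≤ 0 := by
  by_contra hcon
  push Not at hcon
  set q : ℝ → ℝ := fun t => inner ℝ (h t) (k t) with hq
  have hqd : ∀ t, HasDerivAt q (V t * ‖h t‖^2 + Q t * ‖k t‖^2) t := by
    intro t
    have := (hh t).inner ℝ (hk t)
    refine this.congr_deriv ?_
    rw [real_inner_smul_right, real_inner_smul_left, real_inner_self_eq_norm_sq,
      real_inner_self_eq_norm_sq]
  have hqm : Monotone q := by
    apply monotone_of_deriv_nonneg (fun t => (hqd t).differentiableAt)
    intro t
    rw [(hqd t).deriv]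
    have := (hV t).le; have := (hQ0 t).le
    positivity
  set q0 := q t₀ with hq0
  have hq0p : 0 < q0 := hcon
  set T := max t₀ 1 with hT
  have hT1 : 1 ≤ T := le_max_right _ _
  set u : ℝ → ℝ := fun t => ‖h t‖^2 with hu
  have hud : ∀ t, HasDerivAt u (2 * (Q t * q t)) t := by
    intro t
    have := (hh t).norm_sq
    refine this.congr_deriv ?_
    rw [real_inner_smul_right]
  set F : ℝ → ℝ := fun t => u t - (2 * q0 * c / m) * t ^ m with hF
  have hFd : ∀ t, 1 ≤ t → HasDerivAt F (2 * (Q t * q t) - 2 * q0 * c * t ^ (m-1)) t := by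
    intro t ht
    have h1 := (Real.hasDerivAt_rpow_const (x := t) (p := m) (Or.inl (by linarith))).const_mul
      (2 * q0 * c / m)
    have := (hud t).sub h1
    refine this.congr_deriv ?_
    field_simp
  have hFm : MonotoneOn F (Set.Ici T) := by
    apply monotoneOn_of_deriv_nonneg (convex_Ici T)
    · intro t ht
      exact (hFd t (hT1.trans ht)).continuousAt.continuousWithinAt
    · intro t ht
      rw [interior_Ici] at ht
      exact (hFd t (hT1.trans (le_of_lt ht))).differentiableAt.differentiableWithinAt
    · intro t ht
      rw [interior_Ici] at ht
      have ht' : T ≤ t := le_of_lt ht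
      rw [(hFd t (hT1.trans ht')).deriv]
      have h1 : q0 ≤ q t := hqm ((le_max_left _ _).trans ht')
      have h2 := hQ t (hT1.trans ht')
      have h3 : c * t ^ (m-1) * q0 ≤ Q t * q t :=
        mul_le_mul h2 h1 hq0p.le (hQ0 t).le
      linarith
  -- lower bound
  have hlow : ∀ t, T ≤ t → (2*q0*c/m) * (t^m - T^m) ≤ u t := by
    intro t ht
    have := hFm (Set.mem_Ici.2 le_rfl) (Set.mem_Ici.2 ht) ht
    simp only [hF] at this
    have hu0 : 0 ≤ u T := by positivity
    linarith
  have hTm : Filter.Tendsto (fun t : ℝ => t ^ m) Filter.atTop Filter.atTop := tendsto_rpow_atTop hm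
  obtain ⟨T2, hT2⟩ := Filter.eventually_atTop.1
    (hTm.eventually_ge_atTop (2 * T^m))
  set T3 := max T T2
  have hni := not_integrableOn_Ioi_inv (a := T3)
  apply hni
  have hInt2 : IntegrableOn (fun t => ‖h t‖^2 * Wt t) (Set.Ioi T3) := hInt.integrableOn
  set C := (2*q0*c/m) / 2 * c with hC
  have hCp : 0 < C := by positivity
  have := hInt2.const_mul C⁻¹
  refine Integrable.mono' this ?_ ?_
  · exact (measurable_inv.aestronglyMeasurable)
  · rw [ae_restrict_iff' measurableSet_Ioi]
    refine Filter.Eventually.of_forall fun t ht => ?_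
    have ht1 : T ≤ t := (le_max_left _ _).trans (le_of_lt ht)
    have ht2 : T2 ≤ t := (le_max_right _ _).trans (le_of_lt ht)
    have htp : 0 < t := by linarith
    have hge := hT2 t ht2
    have hl := hlow t ht1
    have hw := hW t (hT1.trans ht1)
    have h1 : (2*q0*c/m)/2 * t^m ≤ u t := by
      have hpos : 0 < 2*q0*c/m := by positivity
      nlinarith
    have h2 : ((2*q0*c/m)/2 * t^m) * (c * t^(-m-1)) ≤ u t * Wt t :=
      mul_le_mul h1 hw (by positivity) (by positivity)
    have h3 : t^m * t^(-m-1) = t⁻¹ := by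
      rw [← Real.rpow_add htp, ← Real.rpow_neg_one]; congr 1; ring
    have h4 : C * t⁻¹ ≤ u t * Wt t := by
      rw [← h3, hC]; linarith
    rw [Real.norm_of_nonneg (by positivity)]
    rw [le_inv_mul_iff₀ hCp]
    exact h4

lemma ode_convex_zero (h k : ℝ → ℂ) (Q V Wt : ℝ → ℝ) (m c : ℝ) (hm : 0 < m) (hc : 0 < c)
    (hh : ∀ t, HasDerivAt h (Q t • k t) t) (hk : ∀ t, HasDerivAt k (V t • h t) t)
    (hV : ∀ t, 0 < V t) (hQ0 : ∀ t, 0 < Q t)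
    (hQ : ∀ t, 1 ≤ |t| → c * |t| ^ (m-1) ≤ Q t) (hW : ∀ t, 1 ≤ |t| → c * |t| ^ (-m-1) ≤ Wt t)
    (hInt : Integrable (fun t => ‖h t‖^2 * Wt t)) (t : ℝ) : h t = 0 := by
  have h1 : ∀ t, inner ℝ (h t) (k t) ≤ 0 := fun t =>
    half_convex h k Q V Wt m c hm hc hh hk hV hQ0
      (fun t ht => by simpa [abs_of_nonneg (by linarith : (0:ℝ) ≤ t)] using hQ t (by rwa [abs_of_nonneg (by linarith)]))
      (fun t ht => by simpa [abs_of_nonneg (by linarith : (0:ℝ) ≤ t)] using hW t (by rwa [abs_of_nonneg (by linarith)])) hInt t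
  have h2 : ∀ t, inner ℝ (h t) (k t) ≥ 0 := by
    intro t
    have := half_convex (fun t => h (-t)) (fun t => - k (-t)) (fun t => Q (-t)) (fun t => V (-t))
      (fun t => Wt (-t)) m c hm hc ?_ ?_ (fun t => hV _) (fun t => hQ0 _) ?_ ?_ ?_ (-t)
    · simp only [neg_neg, inner_neg_right] at this
      linarith
    · intro t
      have := (hh (-t)).scomp t (hasDerivAt_neg t)
      refine this.congr_deriv ?_
      simp
    · intro t
      have := ((hk (-t)).scomp t (hasDerivAt_neg t)).neg
      refine this.congr_deriv ?_
      simp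
    · intro t ht
      have := hQ (-t) (by rw [abs_neg]; exact ht.trans (le_abs_self t))
      rwa [abs_neg, abs_of_nonneg (by linarith)] at this
    · intro t ht
      have := hW (-t) (by rw [abs_neg]; exact ht.trans (le_abs_self t))
      rwa [abs_neg, abs_of_nonneg (by linarith)] at this
    · exact hInt.comp_neg
  have h3 : (fun t => inner ℝ (h t) (k t)) = fun _ => (0:ℝ) := by
    funext t; exact le_antisymm (h1 t) (h2 t)
  have hqd := (hh t).inner ℝ (hk t)
  rw [h3] at hqd
  have := hqd.unique (hasDerivAt_const t (0:ℝ))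
  rw [real_inner_smul_right, real_inner_smul_left, real_inner_self_eq_norm_sq,
      real_inner_self_eq_norm_sq] at this
  have ha := hV t; have hb := hQ0 t
  by_contra hne
  have h5 : 0 < ‖h t‖^2 := by positivity
  have h6 : 0 ≤ Q t * ‖k t‖^2 := by positivity
  have h7 := mul_pos ha h5
  linarith

/-- first integral constant vanishes -/
lemma first_int (r c2 : ℝ) (hr : 0 < r) (c : ℂ) (x y : ℝ → ℂ)
    (hx : ∀ t, HasDerivAt x (((r^2+t^2)⁻¹ : ℝ) • (c - (c2 * t : ℝ) • x t - y t)) t)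
    (hxi : Integrable x) (hyi : Integrable y) : c = 0 := by
  by_contra hc
  set R : ℝ → ℝ := fun t => r^2 + t^2 with hR
  have hRp : ∀ t, 0 < R t := fun t => by positivity
  set F : ℝ → ℂ := fun t => t • x t - ((1/2) * Real.log (R t) : ℝ) • c with hF
  set f' : ℝ → ℂ := fun t => (1 - c2 * (t^2 / R t)) • x t - (t / R t) • y t with hf'
  have hFd : ∀ t, HasDerivAt F (f' t) t := by
    intro t
    have hRd : HasDerivAt R (2*t) t := by
      have := ((hasDerivAt_id t).pow 2).const_add (r^2)
      simpa [hR] using this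
    have h1 := (hasDerivAt_id t).smul (hx t)
    have h2 := ((hRd.log (hRp t).ne').const_mul (1/2)).smul_const c
    have h3 := h1.sub h2
    have hne : ((R t : ℝ) : ℂ) ≠ 0 := by exact_mod_cast (hRp t).ne'
    refine h3.congr_deriv ?_
    change t • ((R t)⁻¹ • (c - (c2 * t : ℝ) • x t - y t)) + (1:ℝ) • x t - (1/2 * (2*t / R t)) • c = _
    simp only [hf', Complex.real_smul]
    push_cast
    field_simp
    ring
  have hf'i : Integrable f' := by
    have b1 : ∀ t, |t^2 / R t| ≤ 1 := by
      intro t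
      rw [abs_of_nonneg (by positivity), div_le_one (hRp t)]
      simp only [hR]; nlinarith
    have b2 : ∀ t, |t / R t| ≤ 1/r := by
      intro t
      rw [abs_div, abs_of_pos (hRp t), div_le_div_iff₀ (hRp t) hr]
      simp only [hR]
      rcases abs_cases t with ⟨e, _⟩ | ⟨e, _⟩ <;> rw [e] <;> nlinarith [sq_nonneg (t - r), sq_nonneg (t+r)]
    have hRc : Continuous R := by simp only [hR]; fun_prop
    have i1 : Integrable (fun t => (1 - c2 * (t^2 / R t)) • x t) := by
      refine Integrable.bdd_smul (φ := fun t => 1 - c2 * (t^2 / R t)) hxi (1 + |c2|) ?_ ?_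
      · apply Continuous.aestronglyMeasurable
        exact continuous_const.sub (continuous_const.mul ((continuous_id.pow 2).div hRc (fun t => (hRp t).ne')))
      · refine Filter.Eventually.of_forall fun t => ?_
        calc ‖1 - c2 * (t^2 / R t)‖ ≤ ‖(1:ℝ)‖ + ‖c2 * (t^2 / R t)‖ := norm_sub_le _ _
          _ ≤ 1 + |c2| := by
            rw [norm_mul, norm_one, Real.norm_eq_abs, Real.norm_eq_abs]
            have := mul_le_mul_of_nonneg_left (b1 t) (abs_nonneg c2)
            linarith
    have i2 : Integrable (fun t => (t / R t) • y t) := by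
      refine Integrable.bdd_smul (φ := fun t => t / R t) hyi (1/r) ?_ ?_
      · apply Continuous.aestronglyMeasurable
        exact continuous_id.div hRc (fun t => (hRp t).ne')
      · exact Filter.Eventually.of_forall fun t => b2 t
    exact i1.sub i2
  set M := ∫ t, ‖f' t‖ with hM
  have hbd : ∀ t, 0 ≤ t → ‖F t‖ ≤ ‖F 0‖ + M := by
    intro t ht
    have := intervalIntegral.integral_eq_sub_of_hasDerivAt (a := 0) (b := t) (f := F) (f' := f')
      (fun s _ => hFd s) (hf'i.intervalIntegrable)
    have h2 : F t = F 0 + ∫ s in (0:ℝ)..t, f' s := by rw [this]; ring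
    rw [h2]
    refine (norm_add_le _ _).trans ?_
    gcongr
    refine (intervalIntegral.norm_integral_le_integral_norm ht).trans ?_
    rw [intervalIntegral.integral_of_le ht]
    exact setIntegral_le_integral hf'i.norm (Filter.Eventually.of_forall fun s => norm_nonneg _)
  have hlog : Filter.Tendsto (fun t => Real.log (R t)) Filter.atTop Filter.atTop := by
    apply Real.tendsto_log_atTop.comp
    apply Filter.tendsto_atTop_add_const_left
    exact Filter.tendsto_pow_atTop (by norm_num)
  have hcn : 0 < ‖c‖ := norm_pos_iff.2 hc
  obtain ⟨T, hT⟩ := Filter.eventually_atTop.1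
    (hlog.eventually_ge_atTop (2 * (‖F 0‖ + M + 1) / ‖c‖))
  apply not_integrableOn_Ioi_inv (a := max T 1)
  refine Integrable.mono' hxi.norm.integrableOn measurable_inv.aestronglyMeasurable ?_
  rw [ae_restrict_iff' measurableSet_Ioi]
  refine Filter.Eventually.of_forall fun t ht => ?_
  have ht1 : T ≤ t := (le_max_left _ _).trans (le_of_lt ht)
  have ht2 : 1 ≤ t := (le_max_right _ _).trans (le_of_lt ht)
  have h1 := hT t ht1
  have h2 := hbd t (by linarith)
  rw [div_le_iff₀ hcn] at h1
  have h3 : t • x t = F t + ((1/2) * Real.log (R t) : ℝ) • c := by simp [hF]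
  have hl0 : 0 ≤ Real.log (R t) := by
    by_contra hneg
    push Not at hneg
    have : 0 ≤ M := integral_nonneg fun s => norm_nonneg _
    have := norm_nonneg (F 0)
    nlinarith
  have h4 : ‖((1/2) * Real.log (R t) : ℝ) • c‖ ≤ ‖t • x t‖ + ‖F t‖ := by
    rw [h3]
    have := norm_sub_le (F t + ((1/2) * Real.log (R t) : ℝ) • c) (F t)
    simpa using this
  rw [norm_smul, norm_smul, Real.norm_of_nonneg (by positivity), Real.norm_of_nonneg (by linarith)] at h4
  rw [Real.norm_of_nonneg (by positivity), inv_le_iff_one_le_mul₀' (by linarith)]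
  linarith


lemma Rpow_lower (r e : ℝ) : ∃ c : ℝ, 0 < c ∧ ∀ t : ℝ, 1 ≤ |t| →
    c * |t| ^ (2*e) ≤ (r^2+t^2) ^ e := by
  have h1r : 0 < 1 + r^2 := by positivity
  refine ⟨min 1 ((1+r^2)^e), lt_min one_pos (by positivity), fun t ht => ?_⟩
  have htp : 0 < |t| := by linarith
  have ht2 : |t| ^ (2*e) = (t^2)^e := by
    rw [← sq_abs t, ← Real.rpow_natCast, ← Real.rpow_mul htp.le]; norm_num
  have ht1 : 1 ≤ t^2 := by rw [← sq_abs]; nlinarith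
  rw [ht2]
  have hp : 0 ≤ (t^2)^e := by positivity
  rcases le_total 0 e with he | he
  · calc _ ≤ 1 * (t^2)^e := by gcongr; exact min_le_left _ _
      _ ≤ (r^2+t^2)^e := by
        rw [one_mul]; exact Real.rpow_le_rpow (by positivity) (by nlinarith) he
  · calc _ ≤ (1+r^2)^e * (t^2)^e := by gcongr; exact min_le_right _ _
      _ = ((1+r^2) * t^2)^e := by rw [Real.mul_rpow (by positivity) (by positivity)]
      _ ≤ (r^2+t^2)^e := by
        apply Real.rpow_le_rpow_of_nonpos (by positivity) _ he
        nlinarith [sq_nonneg r]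

lemma hasDerivAt_Rpow (r e t : ℝ) (hr : 0 < r) :
    HasDerivAt (fun t : ℝ => (r^2+t^2)^e) (2 * e * t * (r^2+t^2)^e * (r^2+t^2)⁻¹) t := by
  have hR : 0 < r^2+t^2 := by positivity
  have hRd : HasDerivAt (fun t : ℝ => r^2+t^2) (2*t) t := by
    have := ((hasDerivAt_id t).pow 2).const_add (r^2)
    simpa using this
  refine (hRd.rpow_const (p := e) (Or.inl hR.ne')).congr_deriv ?_
  rw [Real.rpow_sub_one hR.ne']
  field_simp

lemma delta_zero (r s κ : ℝ) (hr : 0 < r) (hs : 1/2 < s) (hκ : 0 < κ) (y W : ℝ → ℂ)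
    (hy : ∀ t, HasDerivAt y (((r^2+t^2)⁻¹ : ℝ) • (W t - (2 * s * t) • y t)) t)
    (hW : ∀ t, HasDerivAt W (κ • y t) t)
    (hInt : Integrable (fun t => (r^2+t^2)^s * ‖y t‖^2)) (t : ℝ) : y t = 0 := by
  obtain ⟨c1, hc1, h1⟩ := Rpow_lower r (s-1)
  obtain ⟨c2, hc2, h2⟩ := Rpow_lower r (-s)
  have hR : ∀ t, 0 < r^2+t^2 := fun t => by positivity
  have key := ode_convex_zero (fun t => (r^2+t^2)^s • y t) W (fun t => (r^2+t^2)^(s-1))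
    (fun t => κ * (r^2+t^2)^(-s)) (fun t => (r^2+t^2)^(-s)) (2*s-1) (min c1 c2) (by linarith)
    (lt_min hc1 hc2) ?_ ?_ ?_ ?_ ?_ ?_ ?_ t
  · have := hR t
    have h3 : (r^2+t^2)^s ≠ 0 := by positivity
    exact (smul_eq_zero.1 key).resolve_left h3
  · intro t
    refine ((hasDerivAt_Rpow r s t hr).smul (hy t)).congr_deriv ?_
    have hne : (((r^2+t^2 : ℝ)) : ℂ) ≠ 0 := by exact_mod_cast (hR t).ne'
    rw [Real.rpow_sub_one (hR t).ne']
    simp only [Complex.real_smul]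
    push_cast at hne ⊢
    field_simp
    ring
  · intro t
    refine (hW t).congr_deriv ?_
    rw [smul_smul, mul_assoc, ← Real.rpow_add (hR t)]
    simp
  · intro t; have := hR t; positivity
  · intro t; have := hR t; positivity
  · intro t ht
    refine le_trans ?_ (h1 t ht)
    rw [show 2*s-1-1 = 2*(s-1) by ring]
    gcongr; exact min_le_left _ _
  · intro t ht
    refine le_trans ?_ (h2 t ht)
    rw [show -(2*s-1)-1 = 2*(-s) by ring]
    gcongr; exact min_le_right _ _
  · refine hInt.congr (Filter.Eventually.of_forall fun t => ?_)
    have := hR t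
    simp only
    rw [norm_smul, Real.norm_of_nonneg (by positivity), mul_pow, Real.rpow_neg (hR t).le]
    field_simp

lemma const_zero (ww : ℝ → ℝ) (C : ℂ) (hww : ∀ t, 0 < ww t)
    (hi : Integrable (fun t => ww t • C)) (h0 : ∫ t, ww t • C = 0) : C = 0 := by
  by_contra hC
  have hin : Integrable ww := by
    have := hi.norm.mul_const (‖C‖⁻¹)
    refine this.congr (Filter.Eventually.of_forall fun t => ?_)
    have : ‖C‖ ≠ 0 := norm_ne_zero_iff.2 hC
    simp only [norm_smul, Real.norm_of_nonneg (hww t).le]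
    field_simp
  rw [integral_smul_const] at h0
  have hpos : 0 < ∫ t, ww t := by
    rw [integral_pos_iff_support_of_nonneg (fun t => (hww t).le) hin]
    have : Function.support ww = Set.univ := by ext t; simp [(hww t).ne']
    rw [this]; simp
  rcases smul_eq_zero.1 h0 with h | h
  · exact hpos.ne' h
  · exact hC h

lemma lin_ode_zero (θ ww : ℝ → ℝ) (x : ℝ → ℂ) (hww : ∀ t, 0 < ww t)
    (hx : ∀ t, HasDerivAt x (θ t • x t) t) (hwwd : ∀ t, HasDerivAt ww (θ t * ww t) t)
    (hi : Integrable x) (h0 : ∫ t, x t = 0) (t : ℝ) : x t = 0 := by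
  have hd : ∀ t, HasDerivAt (fun t => (ww t)⁻¹ • x t) 0 t := by
    intro t
    refine (((hwwd t).inv (hww t).ne').smul (hx t)).congr_deriv ?_
    have hne : ((ww t : ℝ) : ℂ) ≠ 0 := by exact_mod_cast (hww t).ne'
    simp only [Complex.real_smul, Pi.inv_apply]
    push_cast
    field_simp
    ring
  have hc := is_const_of_deriv_eq_zero (fun t => (hd t).differentiableAt) (fun t => (hd t).deriv)
  set C := (ww 0)⁻¹ • x 0 with hC
  have hx2 : x = fun t => ww t • C := by
    funext t
    rw [hC, ← hc t 0, smul_smul, mul_inv_cancel₀ (hww t).ne', one_smul]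
  have : C = 0 := const_zero ww C hww (by rw [← hx2]; exact hi) (by rw [← hx2]; exact h0)
  rw [hx2, this]; simp

lemma alpha_zero (r s : ℝ) (hr : 0 < r) (c : ℂ) (x : ℝ → ℂ)
    (hx : ∀ t, HasDerivAt x (((r^2+t^2)⁻¹ : ℝ) • (c - (2 * s * t) • x t)) t)
    (hi : Integrable x) (h0 : ∫ t, x t = 0) (t : ℝ) : x t = 0 := by
  have hR : ∀ t, 0 < r^2+t^2 := fun t => by positivity
  have hc : c = 0 := first_int r (2*s) hr c x (fun _ => 0)
    (by intro t; simpa using hx t) hi (integrable_zero _ _ _)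
  subst hc
  refine lin_ode_zero (fun t => -(2*s*t) * (r^2+t^2)⁻¹) (fun t => (r^2+t^2)^(-s)) x
    (fun t => by have := hR t; positivity) ?_ ?_ hi h0 t
  · intro t
    refine (hx t).congr_deriv ?_
    simp only [Complex.real_smul]; push_cast; ring
  · intro t
    refine (hasDerivAt_Rpow r (-s) t hr).congr_deriv ?_
    ring

set_option maxHeartbeats 1600000 in
lemma pair_zero (r s κ : ℝ) (hr : 0 < r) (hs : 1/2 < s) (hκ : 2*s < κ) (c : ℂ) (x y W : ℝ → ℂ)
    (hx : ∀ t, HasDerivAt x (((r^2+t^2)⁻¹ : ℝ) • (c - (2 * s * t) • x t - (2:ℝ) • y t)) t)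
    (hy : ∀ t, HasDerivAt y (((r^2+t^2)⁻¹ : ℝ) • (W t + (2*r^2) • x t - (2 * s * t) • y t)) t)
    (hW : ∀ t, HasDerivAt W (κ • y t) t)
    (hxi : Integrable x) (hyi : Integrable y)
    (hxs : Integrable (fun t => (r^2+t^2)^s * ‖x t‖^2))
    (hys : Integrable (fun t => (r^2+t^2)^s * ‖y t‖^2)) (h0 : ∫ t, x t = 0) (t : ℝ) :
    x t = 0 ∧ y t = 0 := by
  have hR : ∀ t, 0 < r^2+t^2 := fun t => by positivity
  have hc : c = 0 := first_int r (2*s) hr c x (fun t => (2:ℝ) • y t) hx hxi (hyi.smul (2:ℝ))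
  subst hc
  set A := (κ/2 + s) with hA
  set B := (κ/2 - s) with hB
  have hBp : 0 < B := by simp only [hB]; linarith
  have hA1 : 1 < A := by simp only [hA]; linarith
  set D : ℝ → ℝ := fun t => A * r^2 + B * t^2 with hD
  have hDp : ∀ t, 0 < D t := fun t => by simp only [hD]; positivity
  have hDd : ∀ t, HasDerivAt D (2*B*t) t := by
    intro t
    have := (((hasDerivAt_id t).pow 2).const_mul B).const_add (A*r^2)
    refine this.congr_deriv ?_
    simp; ring
  obtain ⟨c1, hc1, h1⟩ := Rpow_lower r (s-1)
  obtain ⟨c2, hc2, h2⟩ := Rpow_lower r (-s-1)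
  set h : ℝ → ℂ := fun t => (r^2+t^2)^(s-1/2) • ((-2*s*r^2*t) • x t + D t • y t) with hh
  set k : ℝ → ℂ := fun t => (r^2+t^2)^(-1/2:ℝ) •
    ((2*r^2*(1 - s * r^2 * (D t)⁻¹)) • x t + t • y t + W t) with hk
  have key : ∀ t, h t = 0 := by
    have hBc1 : 0 < B * c1 := by positivity
    refine ode_convex_zero h k (fun t => D t * (r^2+t^2)^(s-1))
      (fun t => (r^2+t^2)^(-s) * (D t)⁻¹ *
        (2*B - 2*B*r^2 * (D t)⁻¹ + (2*s-1)*r^2*(r^2+t^2)⁻¹)) (fun t => (r^2+t^2)^(-s-1)) (2*s+1)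
        (min (B*c1) c2) (by linarith) (lt_min hBc1 hc2) ?_ ?_ ?_ ?_ ?_ ?_ ?_
    · intro t
      have hne : (((r:ℂ)^2+(t:ℂ)^2 )) ≠ 0 := by exact_mod_cast (hR t).ne'
      have hDne : ((D t : ℝ) : ℂ) ≠ 0 := by exact_mod_cast (hDp t).ne'
      have e1 : (r^2+t^2)^(s-1/2) = (r^2+t^2)^(s-1) * (r^2+t^2)^(-1/2:ℝ) * (r^2+t^2) := by
        rw [← Real.rpow_add (hR t), ← Real.rpow_add_one (hR t).ne']; congr 1; ring
      have d1 : HasDerivAt (fun t : ℝ => -2*s*r^2*t) (-2*s*r^2) t := by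
        exact ((hasDerivAt_id t).const_mul (-2*s*r^2)).congr_deriv (mul_one _)
      refine ((hasDerivAt_Rpow r (s-1/2) t hr).smul
        ((d1.smul (hx t)).add ((hDd t).smul (hy t)))).congr_deriv ?_
      simp only [hk, Complex.real_smul, e1, Pi.add_apply, Pi.smul_apply']
      push_cast
      generalize (((r^2+t^2)^(s-1) : ℝ) : ℂ) = P1
      generalize (((r^2+t^2)^(-1/2:ℝ) : ℝ) : ℂ) = P2
      have hDe : ((D t : ℝ) : ℂ) = (κ/2+s) * r^2 + (κ/2-s) * t^2 := by
        simp only [hD, hA, hB]; push_cast; ring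
      have hBe : ((B : ℝ) : ℂ) = κ/2 - s := by simp only [hB]; push_cast; ring
      field_simp
      simp only [hDe, hBe]
      ring
    · intro t
      have hne : (((r:ℂ)^2+(t:ℂ)^2 )) ≠ 0 := by exact_mod_cast (hR t).ne'
      have hDne : ((D t : ℝ) : ℂ) ≠ 0 := by exact_mod_cast (hDp t).ne'
      have d1 : HasDerivAt (fun t : ℝ => 2*r^2*(1 - s * r^2 * (D t)⁻¹))
          (2*r^2*(s * r^2 * (2*B*t) * ((D t)⁻¹)^2)) t := by
        refine (((((hDd t).inv (hDp t).ne').const_mul (s*r^2)).const_sub 1).const_mul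
          (2*r^2)).congr_deriv ?_
        have := (hDp t).ne'
        field_simp
      refine ((hasDerivAt_Rpow r (-1/2) t hr).smul
        (((d1.smul (hx t)).add ((hasDerivAt_id t).smul (hy t))).add (hW t))).congr_deriv ?_
      have e2 : (r^2+t^2)^(-s) * (r^2+t^2)^(s-1/2) = (r^2+t^2)^(-1/2:ℝ) := by
        rw [← Real.rpow_add (hR t)]; congr 1; ring
      simp only [hh]
      have e3 : ∀ (u v : ℝ) (z : ℂ), ((r^2+t^2)^(-s) * u * v) • ((r^2+t^2)^(s-1/2) • z)
          = (r^2+t^2)^(-1/2:ℝ) • ((u*v) • z) := by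
        intro u v z
        rw [← e2]; simp only [Complex.real_smul]; push_cast; ring
      rw [e3]
      simp only [Complex.real_smul, Pi.add_apply, Pi.smul_apply']
      push_cast
      generalize (((r^2+t^2)^(-1/2:ℝ) : ℝ) : ℂ) = P2
      have hDe : ((D t : ℝ) : ℂ) = (κ/2+s) * r^2 + (κ/2-s) * t^2 := by
        simp only [hD, hA, hB]; push_cast; ring
      have hBe : ((B : ℝ) : ℂ) = κ/2 - s := by simp only [hB]; push_cast; ring
      simp only [id]
      field_simp
      simp only [hDe, hBe]
      ring
    · intro t
      have hRt := hR t
      have hDt := hDp t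
      have hle : r^2 * (D t)⁻¹ ≤ A⁻¹ := by
        rw [← div_eq_mul_inv, div_le_iff₀ hDt, hD]
        have : A⁻¹ * (A*r^2 + B*t^2) = r^2 + A⁻¹ * (B * t^2) := by field_simp
        simp only
        rw [this]
        have : 0 ≤ A⁻¹ * (B*t^2) := by positivity
        linarith
      have hAi : A⁻¹ < 1 := inv_lt_one_of_one_lt₀ hA1
      have p1 : 0 < 2*B - 2*B*r^2 * (D t)⁻¹ := by
        have : 2*B*r^2*(D t)⁻¹ = 2*B*(r^2*(D t)⁻¹) := by ring
        rw [this]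
        nlinarith
      have p2 : 0 ≤ (2*s-1)*r^2*(r^2+t^2)⁻¹ := by
        have : 0 ≤ 2*s-1 := by linarith
        positivity
      have p3 : 0 < (r^2+t^2)^(-s) * (D t)⁻¹ := by positivity
      exact mul_pos p3 (by linarith)
    · intro t; have := hR t; have := hDp t; positivity
    · intro t ht
      have htp : 0 < |t| := by linarith
      have hl := h1 t ht
      have e : |t| ^ (2*s+1-1) = t^2 * |t|^(2*(s-1)) := by
        rw [← sq_abs t, ← Real.rpow_natCast, ← Real.rpow_add htp]; congr 1; push_cast; ring
      have hDl : B * t^2 ≤ D t := by simp only [hD]; nlinarith [sq_nonneg r, hA1]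
      rw [e]
      calc min (B*c1) c2 * (t^2 * |t|^(2*(s-1))) ≤ (B*c1) * (t^2 * |t|^(2*(s-1))) := by
            gcongr; exact min_le_left _ _
        _ = (B*t^2) * (c1 * |t|^(2*(s-1))) := by ring
        _ ≤ _ := by have := hDp t; gcongr
    · intro t ht
      refine le_trans ?_ (h2 t ht)
      rw [show -(2*s+1)-1 = 2*(-s-1) by ring]
      gcongr; exact min_le_right _ _
    · set K := 2 * (2*s*r)^2*r^2 + 2*(A+B)^2 with hK
      have hxc : Continuous x := continuous_iff_continuousAt.2 fun t => (hx t).continuousAt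
      have hyc : Continuous y := continuous_iff_continuousAt.2 fun t => (hy t).continuousAt
      have hDc : Continuous D := continuous_iff_continuousAt.2 fun t => (hDd t).continuousAt
      have hRc : ∀ e : ℝ, Continuous (fun t : ℝ => (r^2+t^2)^e) := fun e =>
        continuous_iff_continuousAt.2 fun t => (hasDerivAt_Rpow r e t hr).continuousAt
      refine Integrable.mono' ((hxs.const_mul (2 * (2*s*r)^2)).add (hys.const_mul (2*(A+B)^2))) ?_ ?_
      · apply Continuous.aestronglyMeasurable
        have := hRc (s-1/2); have := hRc (-s-1)
        simp only [hh]
        fun_prop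
      · refine Filter.Eventually.of_forall fun t => ?_
        have hRt := hR t
        have hDt := hDp t
        rw [Real.norm_of_nonneg (by positivity)]
        simp only [hh, Pi.add_apply]
        rw [norm_smul, mul_pow, Real.norm_of_nonneg (by positivity)]
        have e1 : ((r^2+t^2)^(s-1/2))^2 * (r^2+t^2)^(-s-1) * (r^2+t^2)^2 = (r^2+t^2)^s := by
          generalize r^2+t^2 = R at hRt
          rw [← Real.rpow_natCast, ← Real.rpow_natCast, ← Real.rpow_mul hRt.le,
            ← Real.rpow_add hRt, ← Real.rpow_add hRt]
          congr 1; push_cast; ring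
        have n1 : ‖(-2*s*r^2*t) • x t + D t • y t‖ ≤ |2*s*r^2*t| * ‖x t‖ + D t * ‖y t‖ := by
          refine (norm_add_le _ _).trans ?_
          rw [norm_smul, norm_smul, Real.norm_eq_abs, Real.norm_eq_abs, abs_of_pos hDt,
            show -2*s*r^2*t = -(2*s*r^2*t) by ring, abs_neg]
        have n2 : ‖(-2*s*r^2*t) • x t + D t • y t‖^2 ≤
            2*(2*s*r^2*t)^2 * ‖x t‖^2 + 2*(D t)^2*‖y t‖^2 := by
          have := pow_le_pow_left₀ (norm_nonneg _) n1 2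
          refine this.trans ?_
          rw [← sq_abs (2*s*r^2*t)]
          nlinarith [sq_nonneg (|2*s*r^2*t| * ‖x t‖ - D t * ‖y t‖)]
        have n3 : (2*s*r^2*t)^2 ≤ (2*s*r)^2 * (r^2+t^2)^2 := by
          have : r^2*t^2 ≤ (r^2+t^2)^2 := by nlinarith [sq_nonneg r, sq_nonneg t, mul_nonneg (sq_nonneg r) (sq_nonneg t), sq_nonneg (r^2), sq_nonneg (t^2)]
          calc (2*s*r^2*t)^2 = (2*s*r)^2*(r^2*t^2) := by ring
            _ ≤ _ := by gcongr
        have n4 : (D t)^2 ≤ (A+B)^2*(r^2+t^2)^2 := by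
          rw [← mul_pow]
          apply pow_le_pow_left₀ hDt.le
          simp only [hD]; nlinarith [sq_nonneg r, sq_nonneg t, mul_nonneg hBp.le (sq_nonneg r), mul_nonneg (by linarith : 0 ≤ A) (sq_nonneg t)]
        have n5 : ‖(-2*s*r^2*t) • x t + D t • y t‖^2 ≤
            (r^2+t^2)^2 * (2*(2*s*r)^2 * ‖x t‖^2 + 2*(A+B)^2*‖y t‖^2) := by
          refine n2.trans ?_
          have a1 := mul_le_mul_of_nonneg_right n3 (sq_nonneg ‖x t‖)
          have a2 := mul_le_mul_of_nonneg_right n4 (sq_nonneg ‖y t‖)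
          linarith
        calc _ ≤ ((r^2+t^2)^(s-1/2))^2 * ((r^2+t^2)^2 * (2*(2*s*r)^2 * ‖x t‖^2 + 2*(A+B)^2*‖y t‖^2)) * (r^2+t^2)^(-s-1) := by gcongr
          _ = (((r^2+t^2)^(s-1/2))^2 * (r^2+t^2)^(-s-1) * (r^2+t^2)^2) * (2*(2*s*r)^2 * ‖x t‖^2 + 2*(A+B)^2*‖y t‖^2) := by ring
          _ = _ := by rw [e1]; ring
  have hyx : ∀ t, y t = ((2*s*r^2*t) * (D t)⁻¹) • x t := by
    intro t
    have h3 := key t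
    have hRt := hR t
    have hDne : ((D t : ℝ) : ℂ) ≠ 0 := by exact_mod_cast (hDp t).ne'
    have h4 : (r^2+t^2)^(s-1/2) ≠ 0 := by positivity
    have h5 := (smul_eq_zero.1 h3).resolve_left h4
    simp only [Complex.real_smul] at h5 ⊢
    push_cast at h5 ⊢
    field_simp
    linear_combination h5
  have hx0 : ∀ t, x t = 0 := by
    refine lin_ode_zero (fun t => -(2*s*t)*(r^2+t^2)⁻¹*(1+2*r^2*(D t)⁻¹))
      (fun t => D t * (r^2+t^2)^(-s-1)) x
      (fun t => by have := hR t; have := hDp t; positivity) ?_ ?_ hxi h0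
    · intro t
      refine (hx t).congr_deriv ?_
      rw [hyx t]
      simp only [Complex.real_smul]; push_cast; ring
    · intro t
      refine ((hDd t).mul (hasDerivAt_Rpow r (-s-1) t hr)).congr_deriv ?_
      have h1 := (hR t).ne'
      have h2 := (hDp t).ne'
      generalize (r^2+t^2)^(-s-1) = P
      have hDe : D t = (κ/2+s) * r^2 + (κ/2-s) * t^2 := by simp only [hD, hA, hB]
      field_simp
      rw [hDe, hB]
      ring
  exact ⟨hx0 t, by rw [hyx t, hx0 t]; simp⟩


lemma eps_apply (x : Fin n → ℂ) (v : Lam n) (S : Finset (Fin n)) :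
    eps x v S = ∑ j ∈ S, wsign j S * x j * v (S.erase j) := rfl

lemma iot_apply (x : Fin n → ℂ) (v : Lam n) (S : Finset (Fin n)) :
    iot x v S = ∑ j ∈ Sᶜ, wsign j S * x j * v (insert j S) := rfl

lemma epsee_apply (k : Fin n) (v : Lam n) (S : Finset (Fin n)) :
    eps (ee k) v S = if k ∈ S then wsign k S * v (S.erase k) else 0 := by
  rw [eps_apply]
  simp [ee]

lemma iotee_apply (k : Fin n) (v : Lam n) (S : Finset (Fin n)) :
    iot (ee k) v S = if k ∈ S then 0 else wsign k S * v (insert k S) := by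
  rw [iot_apply]
  simp [ee]

/-- exterior multiplication as a linear map -/
def epsL (x : Fin n → ℂ) : Lam n →ₗ[ℂ] Lam n where
  toFun := eps x
  map_add' v w := by
    ext S; simp only [eps_apply, PiLp.add_apply, ← Finset.sum_add_distrib]
    exact Finset.sum_congr rfl fun j _ => by ring
  map_smul' c v := by
    ext S; simp only [eps_apply, PiLp.smul_apply, smul_eq_mul, Finset.mul_sum, RingHom.id_apply]
    exact Finset.sum_congr rfl fun j _ => by ring

/-- interior multiplication as a linear map -/
def iotL (x : Fin n → ℂ) : Lam n →ₗ[ℂ] Lam n where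
  toFun := iot x
  map_add' v w := by
    ext S; simp only [iot_apply, PiLp.add_apply, ← Finset.sum_add_distrib]
    exact Finset.sum_congr rfl fun j _ => by ring
  map_smul' c v := by
    ext S; simp only [iot_apply, PiLp.smul_apply, smul_eq_mul, Finset.mul_sum, RingHom.id_apply]
    exact Finset.sum_congr rfl fun j _ => by ring

/-- continuous version -/
def epsC (x : Fin n → ℂ) : Lam n →L[ℂ] Lam n := LinearMap.toContinuousLinearMap (epsL x)
/-- continuous version -/
def iotC (x : Fin n → ℂ) : Lam n →L[ℂ] Lam n := LinearMap.toContinuousLinearMap (iotL x)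

lemma epsC_apply (x : Fin n → ℂ) (v : Lam n) : epsC x v = eps x v := rfl
lemma iotC_apply (x : Fin n → ℂ) (v : Lam n) : iotC x v = iot x v := rfl

lemma epsC_expand (x : Fin n → ℂ) (v : Lam n) : epsC x v = ∑ j, x j • epsC (ee j) v := by
  ext S
  simp only [epsC_apply, WithLp.ofLp_sum, Finset.sum_apply, PiLp.smul_apply, epsee_apply, smul_eq_mul]
  rw [eps_apply]
  simp only [mul_ite, mul_zero]
  rw [← Finset.sum_filter]
  simp only [Finset.filter_mem_eq_inter, Finset.univ_inter]
  exact Finset.sum_congr rfl fun j _ => by ring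

lemma iotC_expand (x : Fin n → ℂ) (v : Lam n) : iotC x v = ∑ j, x j • iotC (ee j) v := by
  ext S
  simp only [iotC_apply, WithLp.ofLp_sum, Finset.sum_apply, PiLp.smul_apply, iotee_apply, smul_eq_mul]
  rw [iot_apply]
  have : ∀ j, x j * (if j ∈ S then 0 else wsign j S * v (insert j S))
    = if j ∈ Sᶜ then wsign j S * x j * v (insert j S) else 0 := by
    intro j; by_cases h : j ∈ S <;> simp [h]; ring
  simp only [this]
  rw [← Finset.sum_filter]
  simp only [Finset.filter_mem_eq_inter, Finset.univ_inter]

lemma wsign_sq (j : Fin n) (S : Finset (Fin n)) : wsign j S * wsign j S = 1 := by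
  unfold wsign; rw [← pow_add, ← two_mul]; simp

lemma wsign_erase_lt {j k : Fin n} {S : Finset (Fin n)} (h : k < j) (hk : k ∈ S) :
    wsign j (S.erase k) = - wsign j S := by
  unfold wsign
  rw [Finset.filter_erase]
  have hm : k ∈ S.filter (· < j) := by simp [hk, h]
  have : (S.filter (· < j)).card = ((S.filter (· < j)).erase k).card + 1 := by
    rw [Finset.card_erase_add_one hm]
  rw [this, pow_succ]; ring

lemma wsign_erase_ge {j k : Fin n} {S : Finset (Fin n)} (h : ¬ k < j) :
    wsign j (S.erase k) = wsign j S := by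
  unfold wsign
  rw [Finset.filter_erase, Finset.erase_eq_of_notMem]
  simp; intro _; exact not_lt.1 h

lemma wsign_insert_lt {j k : Fin n} {S : Finset (Fin n)} (h : k < j) (hk : k ∉ S) :
    wsign j (insert k S) = - wsign j S := by
  have := wsign_erase_lt (S := insert k S) h (Finset.mem_insert_self _ _)
  rw [Finset.erase_insert hk] at this
  rw [this]; ring

lemma wsign_insert_ge {j k : Fin n} {S : Finset (Fin n)} (h : ¬ k < j) :
    wsign j (insert k S) = wsign j S := by
  by_cases hk : k ∈ S
  · rw [Finset.insert_eq_of_mem hk]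
  have := wsign_erase_ge (S := insert k S) h
  rw [Finset.erase_insert hk] at this
  rw [this]

lemma epsee_anti (j k : Fin n) (v : Lam n) :
    epsC (ee j) (epsC (ee k) v) = - epsC (ee k) (epsC (ee j) v) := by
  ext S
  simp only [epsC_apply, epsee_apply, PiLp.neg_apply]
  by_cases hjk : j = k
  · subst hjk; simp
  have hkj : k ≠ j := fun h => hjk h.symm
  by_cases hj : j ∈ S <;> by_cases hk : k ∈ S <;> simp [hj, hk, hjk, hkj]
  rw [Finset.erase_right_comm]
  rcases lt_or_gt_of_ne hjk with h | h
  · rw [wsign_erase_lt h hj, wsign_erase_ge (not_lt.2 h.le)]; ring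
  · rw [wsign_erase_lt h hk, wsign_erase_ge (not_lt.2 h.le)]; ring

lemma iotee_anti (j k : Fin n) (v : Lam n) :
    iotC (ee j) (iotC (ee k) v) = - iotC (ee k) (iotC (ee j) v) := by
  ext S
  simp only [iotC_apply, iotee_apply, PiLp.neg_apply]
  by_cases hjk : j = k
  · subst hjk; simp
  have hkj : k ≠ j := fun h => hjk h.symm
  by_cases hj : j ∈ S <;> by_cases hk : k ∈ S <;> simp [hj, hk, hjk, hkj]
  rw [Finset.insert_comm]
  rcases lt_or_gt_of_ne hjk with h | h
  · rw [wsign_insert_lt h hj, wsign_insert_ge (not_lt.2 h.le)]; ring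
  · rw [wsign_insert_lt h hk, wsign_insert_ge (not_lt.2 h.le)]; ring

lemma epsiotee_anti (j k : Fin n) (v : Lam n) :
    epsC (ee j) (iotC (ee k) v) + iotC (ee k) (epsC (ee j) v) = if j = k then v else 0 := by
  ext S
  simp only [iotC_apply, epsC_apply, epsee_apply, iotee_apply, PiLp.add_apply]
  by_cases hjk : j = k
  · subst hjk
    by_cases hj : j ∈ S
    · simp [hj, Finset.insert_erase hj]
      rw [wsign_erase_ge (lt_irrefl _), ← mul_assoc, wsign_sq, one_mul]
    · simp [hj, Finset.erase_insert hj]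
      rw [wsign_insert_ge (lt_irrefl _), ← mul_assoc, wsign_sq, one_mul]
  have hkj : k ≠ j := fun h => hjk h.symm
  by_cases hj : j ∈ S <;> by_cases hk : k ∈ S <;> simp [hj, hk, hjk, hkj]
  rw [Finset.erase_insert_of_ne hkj]
  rcases lt_or_gt_of_ne hjk with h | h
  · rw [wsign_erase_lt h hj, wsign_insert_ge (not_lt.2 h.le)]; ring
  · rw [wsign_insert_lt h hk, wsign_erase_ge (not_lt.2 h.le)]; ring

lemma eps_anti (x y : Fin n → ℂ) (v : Lam n) :
    epsC x (epsC y v) = - epsC y (epsC x v) := by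
  rw [epsC_expand x, epsC_expand y (epsC x v), ← Finset.sum_neg_distrib]
  have h1 : ∀ j, x j • epsC (ee j) (epsC y v) = ∑ k, (x j * y k) • epsC (ee j) (epsC (ee k) v) := by
    intro j; rw [epsC_expand y, map_sum, Finset.smul_sum]
    simp [smul_smul]
  have h2 : ∀ k, -(y k • epsC (ee k) (epsC x v)) = ∑ j, (x j * y k) • epsC (ee j) (epsC (ee k) v) := by
    intro k; rw [epsC_expand x, map_sum, Finset.smul_sum, ← Finset.sum_neg_distrib]
    refine Finset.sum_congr rfl fun j _ => ?_
    rw [epsee_anti j k, map_smul, smul_smul, smul_neg, mul_comm]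
  simp only [h1, h2]
  exact Finset.sum_comm

lemma iot_anti (x y : Fin n → ℂ) (v : Lam n) :
    iotC x (iotC y v) = - iotC y (iotC x v) := by
  rw [iotC_expand x, iotC_expand y (iotC x v), ← Finset.sum_neg_distrib]
  have h1 : ∀ j, x j • iotC (ee j) (iotC y v) = ∑ k, (x j * y k) • iotC (ee j) (iotC (ee k) v) := by
    intro j; rw [iotC_expand y, map_sum, Finset.smul_sum]
    simp [smul_smul]
  have h2 : ∀ k, -(y k • iotC (ee k) (iotC x v)) = ∑ j, (x j * y k) • iotC (ee j) (iotC (ee k) v) := by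
    intro k; rw [iotC_expand x, map_sum, Finset.smul_sum, ← Finset.sum_neg_distrib]
    refine Finset.sum_congr rfl fun j _ => ?_
    rw [iotee_anti j k, map_smul, smul_smul, smul_neg, mul_comm]
  simp only [h1, h2]
  exact Finset.sum_comm

lemma iot_eps (x y : Fin n → ℂ) (v : Lam n) :
    iotC y (epsC x v) = (∑ j, x j * y j) • v - epsC x (iotC y v) := by
  rw [eq_sub_iff_add_eq, add_comm, epsC_expand x, iotC_expand y (epsC x v)]
  have h1 : ∀ j, x j • epsC (ee j) (iotC y v) = ∑ k, (x j * y k) • epsC (ee j) (iotC (ee k) v) := by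
    intro j; rw [iotC_expand y, map_sum, Finset.smul_sum]
    simp [smul_smul]
  have h2 : ∀ k, (y k • iotC (ee k) (epsC x v)) = ∑ j, (x j * y k) • iotC (ee k) (epsC (ee j) v) := by
    intro k; rw [epsC_expand x, map_sum, Finset.smul_sum]
    refine Finset.sum_congr rfl fun j _ => ?_
    rw [map_smul, smul_smul, mul_comm]
  simp only [h1, h2]
  rw [Finset.sum_comm (f := fun k j => (x j * y k) • iotC (ee k) (epsC (ee j) v)),
    ← Finset.sum_add_distrib, Finset.sum_smul]
  refine Finset.sum_congr rfl fun j _ => ?_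
  rw [← Finset.sum_add_distrib]
  simp only [← smul_add, epsiotee_anti, smul_ite, smul_zero, Finset.sum_ite_eq, Finset.mem_univ,
    if_true]

lemma eq_zero_of_eq_neg (w : Lam n) (h : w = -w) : w = 0 := by
  have h2 : (2:ℂ) • w = 0 := by rw [two_smul]; nth_rewrite 1 [h]; simp
  exact (smul_eq_zero.1 h2).resolve_left two_ne_zero

lemma eps_self (x : Fin n → ℂ) (v : Lam n) : epsC x (epsC x v) = 0 :=
  eq_zero_of_eq_neg _ (eps_anti x x v)
lemma iot_self (x : Fin n → ℂ) (v : Lam n) : iotC x (iotC x v) = 0 :=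
  eq_zero_of_eq_neg _ (iot_anti x x v)

lemma eps_form {p : ℕ} (x : Fin n → ℂ) {v : Lam n} (h : IsForm p v) : IsForm (p+1) (epsC x v) := by
  intro S hS
  rw [epsC_apply, eps_apply]
  refine Finset.sum_eq_zero fun j hj => ?_
  rw [h, mul_zero]
  have := Finset.card_erase_add_one hj
  omega

lemma iot_form {p : ℕ} (x : Fin n → ℂ) {v : Lam n} (h : IsForm (p+1) v) : IsForm p (iotC x v) := by
  intro S hS
  rw [iotC_apply, iot_apply]
  refine Finset.sum_eq_zero fun j hj => ?_
  rw [h, mul_zero]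
  rw [Finset.card_insert_of_notMem (by simpa using hj)]
  omega

lemma iot_form_zero (x : Fin n → ℂ) {v : Lam n} (h : IsForm 0 v) : iotC x v = 0 := by
  ext S
  rw [iotC_apply, iot_apply]
  refine Finset.sum_eq_zero fun j hj => ?_
  rw [h, mul_zero]
  simp

lemma isForm_zero (p : ℕ) : IsForm p (0 : Lam n) := fun _ _ => rfl
lemma IsForm.add {p : ℕ} {v w : Lam n} (hv : IsForm p v) (hw : IsForm p w) : IsForm p (v+w) :=
  fun S hS => by simp [hv S hS, hw S hS]
lemma IsForm.sub {p : ℕ} {v w : Lam n} (hv : IsForm p v) (hw : IsForm p w) : IsForm p (v-w) :=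
  fun S hS => by simp [hv S hS, hw S hS]
lemma IsForm.smul {p : ℕ} {v : Lam n} (c : ℂ) (hv : IsForm p v) : IsForm p (c • v) :=
  fun S hS => by simp [hv S hS]
lemma IsForm.rsmul {p : ℕ} {v : Lam n} (c : ℝ) (hv : IsForm p v) : IsForm p (c • v) :=
  fun S hS => by simp [hv S hS]

lemma eps_iot_form {p : ℕ} (x y : Fin n → ℂ) {v : Lam n} (h : IsForm p v) :
    IsForm p (epsC x (iotC y v)) := by
  cases p with
  | zero => rw [iot_form_zero y h, map_zero]; exact isForm_zero 0
  | succ p => exact eps_form x (iot_form y h)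

lemma iot_eps_form {p : ℕ} (x y : Fin n → ℂ) {v : Lam n} (h : IsForm p v) :
    IsForm p (iotC x (epsC y v)) := iot_form x (eps_form y h)

/-- blin as bilinear -/
lemma blin_transpose (x : Fin n → ℂ) (v w : Lam n) : blin (epsC x v) w = blin v (iotC x w) := by
  unfold blin
  have key : ∀ j, ∑ S, (epsC (ee j) v) S * w S = ∑ S, v S * (iotC (ee j) w) S := by
    intro j
    simp only [epsC_apply, iotC_apply, epsee_apply, iotee_apply, ite_mul, mul_ite, zero_mul, mul_zero]
    rw [← Finset.sum_filter]
    have : ∀ S : Finset (Fin n), (if j ∈ S then 0 else v S * (wsign j S * w (insert j S))) =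
      if j ∉ S then v S * (wsign j S * w (insert j S)) else 0 := by
      intro S; by_cases h : j ∈ S <;> simp [h]
    simp only [this]
    rw [← Finset.sum_filter]
    refine Finset.sum_bij' (fun S _ => S.erase j) (fun S _ => insert j S) ?_ ?_ ?_ ?_ ?_
    · intro S hS; simp
    · intro S hS; simp
    · intro S hS; simp at hS; simp [Finset.insert_erase hS]
    · intro S hS; simp at hS; simp [Finset.erase_insert hS]
    · intro S hS
      simp at hS
      simp only [wsign_erase_ge (lt_irrefl j), Finset.insert_erase hS]
      ring
  rw [epsC_expand, iotC_expand]
  simp only [WithLp.ofLp_sum, Finset.sum_apply, PiLp.smul_apply, smul_eq_mul, Finset.sum_mul,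
    Finset.mul_sum]
  refine Finset.sum_comm.trans (Eq.trans ?_ Finset.sum_comm)
  refine Finset.sum_congr rfl fun j _ => ?_
  have h1 : ∀ S, x j * (epsC (ee j) v) S * w S = x j * ((epsC (ee j) v) S * w S) := fun S => by ring
  have h2 : ∀ S, v S * (x j * (iotC (ee j) w) S) = x j * (v S * (iotC (ee j) w) S) := fun S => by ring
  simp only [h1, h2, ← Finset.mul_sum]
  rw [key]

lemma blin_comm (v w : Lam n) : blin v w = blin w v := by
  unfold blin; exact Finset.sum_congr rfl fun S _ => mul_comm _ _

lemma blin_transpose' (x : Fin n → ℂ) (v w : Lam n) : blin (iotC x v) w = blin v (epsC x w) := by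
  rw [blin_comm, ← blin_transpose, blin_comm]

/-- blin as continuous bilinear map over ℝ -/
def blinC : Lam n →L[ℂ] Lam n →L[ℂ] ℂ :=
  LinearMap.toContinuousLinearMap
    { toFun := fun v => LinearMap.toContinuousLinearMap
        { toFun := fun w => blin v w
          map_add' := by intro a b; simp [blin, mul_add, Finset.sum_add_distrib]
          map_smul' := by
            intro a b; simp only [blin, PiLp.smul_apply, smul_eq_mul, Finset.mul_sum, RingHom.id_apply]
            exact Finset.sum_congr rfl fun S _ => by ring }
      map_add' := by
        intro a b; ext w; simp [blin, add_mul, Finset.sum_add_distrib]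
      map_smul' := by
        intro a b; ext w
        simp only [blin, PiLp.smul_apply, smul_eq_mul, Finset.mul_sum, RingHom.id_apply,
          LinearMap.coe_toContinuousLinearMap', LinearMap.coe_mk, AddHom.coe_mk,
          FunLike.coe_smul, Pi.smul_apply]
        exact Finset.sum_congr rfl fun S _ => by ring }

lemma blinC_apply (v w : Lam n) : blinC v w = blin v w := rfl


lemma projL_incL (v : Lam (n-1)) : projL (incL v) = v := by
  ext T
  show (∑ T' : Finset (Fin (n-1)), if T'.map embF = T.map embF then v T' else 0) = v T
  simp

lemma incL_projL (ℓ : Fin n) (hℓ : (ℓ : ℕ) = n - 1) (v : Lam n) :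
    incL (projL v) = iotC (ee ℓ) (epsC (ee ℓ) v) := by
  ext S
  rw [iotC_apply, iotee_apply, epsC_apply, epsee_apply]
  show (∑ T' : Finset (Fin (n-1)), if T'.map embF = S then v (T'.map embF) else 0) = _
  by_cases h : ℓ ∈ S
  · simp only [h, if_true]
    refine Finset.sum_eq_zero fun T _ => ?_
    rw [if_neg]
    rintro rfl
    rw [Finset.mem_map] at h
    obtain ⟨j, _, hj⟩ := h
    have := congrArg Fin.val hj
    simp [embF] at this
    omega
  · simp only [h, if_false, Finset.mem_insert_self, if_true, Finset.erase_insert h]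
    rw [wsign_insert_ge (lt_irrefl _), ← mul_assoc, wsign_sq, one_mul]
    have hex : ∃ T : Finset (Fin (n-1)), T.map embF = S := by
      refine ⟨Finset.univ.filter (fun j => embF j ∈ S), ?_⟩
      ext k
      simp only [Finset.mem_map, Finset.mem_filter, Finset.mem_univ, true_and]
      constructor
      · rintro ⟨j, hj, rfl⟩; exact hj
      · intro hk
        have hkl : (k:ℕ) ≠ n - 1 := fun h' => h (by rwa [show ℓ = k from Fin.ext (by omega)])
        have hke : embF (⟨k, by omega⟩ : Fin (n-1)) = k := by ext; simp [embF]
        exact ⟨⟨k, by omega⟩, by rwa [hke], hke⟩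
    obtain ⟨T, rfl⟩ := hex
    simp

/-- projL as a continuous linear map -/
def projC : Lam n →L[ℂ] Lam (n-1) := LinearMap.toContinuousLinearMap
  { toFun := projL
    map_add' := fun v w => by ext T; rfl
    map_smul' := fun c v => by ext T; rfl }

/-- incL as a continuous linear map -/
def incC : Lam (n-1) →L[ℂ] Lam n := LinearMap.toContinuousLinearMap
  { toFun := incL
    map_add' := fun v w => by
      ext S
      show (∑ T : Finset (Fin (n-1)), if T.map embF = S then v T + w T else 0) =
        (∑ T : Finset (Fin (n-1)), if T.map embF = S then v T else 0) +
        (∑ T : Finset (Fin (n-1)), if T.map embF = S then w T else 0)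
      rw [← Finset.sum_add_distrib]
      refine Finset.sum_congr rfl fun T _ => ?_
      split_ifs <;> simp
    map_smul' := fun c v => by
      ext S
      show (∑ T : Finset (Fin (n-1)), if T.map embF = S then c * v T else 0) =
        c * (∑ T : Finset (Fin (n-1)), if T.map embF = S then v T else 0)
      rw [Finset.mul_sum]
      refine Finset.sum_congr rfl fun T _ => ?_
      split_ifs <;> simp }

lemma projC_apply (v : Lam n) : projC v = projL v := rfl
lemma incC_apply (v : Lam (n-1)) : incC v = incL v := rfl

lemma inc_form {p : ℕ} {v : Lam (n-1)} (h : IsForm p v) : IsForm p (incC v) := by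
  intro S hS
  show (∑ T : Finset (Fin (n-1)), if T.map embF = S then v T else 0) = 0
  refine Finset.sum_eq_zero fun T _ => ?_
  split_ifs with hT
  · rw [h]; rw [← hT, Finset.card_map] at hS; exact hS
  · rfl

lemma iot_inc (ℓ : Fin n) (hℓ : (ℓ : ℕ) = n - 1) (v : Lam (n-1)) : iotC (ee ℓ) (incC v) = 0 := by
  have h := incL_projL ℓ hℓ (incL v)
  rw [projL_incL] at h
  rw [incC_apply, h, iot_self]

lemma proj_ie (ℓ : Fin n) (hℓ : (ℓ : ℕ) = n - 1) (v : Lam n) :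
    projC (iotC (ee ℓ) (epsC (ee ℓ) v)) = projC v := by
  rw [← incL_projL ℓ hℓ, projC_apply, projC_apply, projL_incL]

lemma proj_eps (ℓ : Fin n) (hℓ : (ℓ : ℕ) = n - 1) (v : Lam n) :
    projC (epsC (ee ℓ) v) = 0 := by
  rw [← proj_ie ℓ hℓ, eps_self, map_zero, map_zero]

lemma eps_bound : ∃ C : ℝ, 0 ≤ C ∧ ∀ (x : Rn n) (v : Lam n),
    ‖epsC (rc x) v‖ ≤ C * ‖x‖ * ‖v‖ := by
  refine ⟨∑ j : Fin n, ‖(epsC (ee j) : Lam n →L[ℂ] Lam n)‖, by positivity, fun x v => ?_⟩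
  rw [epsC_expand, Finset.sum_mul, Finset.sum_mul]
  refine (norm_sum_le _ _).trans (Finset.sum_le_sum fun j _ => ?_)
  rw [norm_smul]
  have h1 : ‖rc x j‖ ≤ ‖x‖ := by
    simp only [rc, Complex.norm_real]; exact PiLp.norm_apply_le x j
  have h2 := (epsC (ee j) : Lam n →L[ℂ] Lam n).le_opNorm v
  calc _ ≤ ‖x‖ * (‖(epsC (ee j) : Lam n →L[ℂ] Lam n)‖ * ‖v‖) := by gcongr
    _ = _ := by ring

lemma iot_bound : ∃ C : ℝ, 0 ≤ C ∧ ∀ (x : Rn n) (v : Lam n),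
    ‖iotC (rc x) v‖ ≤ C * ‖x‖ * ‖v‖ := by
  refine ⟨∑ j : Fin n, ‖(iotC (ee j) : Lam n →L[ℂ] Lam n)‖, by positivity, fun x v => ?_⟩
  rw [iotC_expand, Finset.sum_mul, Finset.sum_mul]
  refine (norm_sum_le _ _).trans (Finset.sum_le_sum fun j _ => ?_)
  rw [norm_smul]
  have h1 : ‖rc x j‖ ≤ ‖x‖ := by
    simp only [rc, Complex.norm_real]; exact PiLp.norm_apply_le x j
  have h2 := (iotC (ee j) : Lam n →L[ℂ] Lam n).le_opNorm v
  calc _ ≤ ‖x‖ * (‖(iotC (ee j) : Lam n →L[ℂ] Lam n)‖ * ‖v‖) := by gcongr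
    _ = _ := by ring

lemma eps_cont : Continuous (fun q : Rn n × Lam n => epsC (rc q.1) q.2) := by
  simp_rw [epsC_expand (rc _)]
  unfold rc
  fun_prop

lemma iot_cont : Continuous (fun q : Rn n × Lam n => iotC (rc q.1) q.2) := by
  simp_rw [iotC_expand (rc _)]
  unfold rc
  fun_prop

/-- the four operators at a frequency satisfy the Clifford relations -/
structure Cliff {V : Type*} [NormedAddCommGroup V] [NormedSpace ℂ V]
    (e i E I : V →L[ℂ] V) (r : ℝ) : Prop where
  ee : ∀ v, e (e v) = 0
  ii : ∀ v, i (i v) = 0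
  ie : ∀ v, i (e v) = v - e (i v)
  Ee : ∀ v, E (e v) = - e (E v)
  Ie : ∀ v, I (e v) = - e (I v)
  Ei : ∀ v, E (i v) = - i (E v)
  Ii : ∀ v, I (i v) = - i (I v)
  EE : ∀ v, E (E v) = 0
  II : ∀ v, I (I v) = 0
  IE : ∀ v, I (E v) = ((r^2 : ℝ) : ℂ) • v - E (I v)

lemma app_apply_last (ℓ : Fin n) (hℓ : (ℓ : ℕ) = n - 1) (x : Rn (n-1)) (t : ℝ) :
    app x t ℓ = t := by
  show (if h : (ℓ : ℕ) < n - 1 then _ else t) = t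
  rw [dif_neg (by omega)]

lemma app_apply_ne (ℓ : Fin n) (hℓ : (ℓ : ℕ) = n - 1) (x : Rn (n-1)) (t : ℝ) (j : Fin n)
    (hj : j ≠ ℓ) : app x t j = app x 0 j := by
  have : (j:ℕ) < n - 1 := by
    have : (j:ℕ) ≠ ℓ := fun h => hj (Fin.ext h)
    omega
  show (if h : (j : ℕ) < n - 1 then _ else t) = (if h : (j : ℕ) < n - 1 then _ else 0)
  rw [dif_pos this, dif_pos this]

lemma app_sq (ℓ : Fin n) (hℓ : (ℓ : ℕ) = n - 1) (x : Rn (n-1)) (t : ℝ) :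
    ‖app x t‖^2 = ‖x‖^2 + t^2 := by
  obtain ⟨m, rfl⟩ : ∃ m, n = m + 1 := ⟨n-1, by have := ℓ.2; omega⟩
  rw [EuclideanSpace.norm_sq_eq, EuclideanSpace.norm_sq_eq, Fin.sum_univ_castSucc]
  have h1 : (Fin.last m) = ℓ := Fin.ext (by simp [hℓ])
  rw [h1, app_apply_last ℓ hℓ]
  congr 1
  · refine Finset.sum_congr rfl fun j _ => ?_
    show ‖(if h : (j.castSucc : ℕ) < m + 1 - 1 then x ⟨_, h⟩ else t)‖^2 = _
    rw [dif_pos (by simp)]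
    rfl
  · simp

lemma cliff (ℓ : Fin n) (hℓ : (ℓ : ℕ) = n - 1) (x : Rn (n-1)) :
    Cliff (epsC (ee ℓ)) (iotC (ee ℓ)) (epsC (rc (app x 0))) (iotC (rc (app x 0))) ‖x‖ := by
  have h0 : rc (app x 0) ℓ = 0 := by simp [rc, app_apply_last ℓ hℓ]
  have hs : ∑ j, rc (app x 0) j * ee ℓ j = 0 := by
    simp [ee, h0]
  have hs2 : ∑ j, ee ℓ j * rc (app x 0) j = 0 := by
    simp [ee, h0]
  have hs3 : ∑ j, ee ℓ j * ee ℓ j = 1 := by simp [ee]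
  have hs4 : ∑ j, rc (app x 0) j * rc (app x 0) j = ((‖x‖^2 : ℝ) : ℂ) := by
    have := app_sq ℓ hℓ x 0
    rw [EuclideanSpace.norm_sq_eq] at this
    have h2 : ‖x‖^2 = ∑ j, app x 0 j * app x 0 j := by
      rw [show ‖x‖^2 = ‖x‖^2 + 0^2 by ring, ← this]
      refine Finset.sum_congr rfl fun j _ => ?_
      rw [Real.norm_eq_abs, sq_abs, sq]
    rw [h2]; simp [rc]
  refine ⟨eps_self _, iot_self _, fun v => ?_, fun v => ?_, fun v => ?_, fun v => ?_, fun v => ?_,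
    eps_self _, iot_self _, fun v => ?_⟩
  · rw [iot_eps, hs3, one_smul]
  · exact eps_anti _ _ _
  · rw [iot_eps, hs2, zero_smul, zero_sub]
  · rw [iot_eps, hs, zero_smul, zero_sub, neg_neg]
  · exact iot_anti _ _ _
  · rw [iot_eps, hs4]


lemma clm_hasDeriv {n k : ℕ} (L : Lam n →L[ℂ] Lam k) {G : ℝ → Lam n} {d : Lam n} {t : ℝ}
    (h : HasDerivAt G d t) : HasDerivAt (fun t => L (G t)) (L d) t :=
  ((L.restrictScalars ℝ).hasFDerivAt.comp_hasDerivAt t h)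

lemma coord_hasDeriv {n : ℕ} (S : Finset (Fin n)) {G : ℝ → Lam n} {d : Lam n} {t : ℝ}
    (h : HasDerivAt G d t) : HasDerivAt (fun t => G t S) (d S) t :=
  (((EuclideanSpace.proj S : Lam n →L[ℂ] ℂ).restrictScalars ℝ).hasFDerivAt.comp_hasDerivAt t h)

lemma rsm {n k : ℕ} (L : Lam n →L[ℂ] Lam k) (c : ℝ) (v : Lam n) : L (c • v) = c • L v :=
  (L.restrictScalars ℝ).map_smul c v

lemma weighted_comp {n k : ℕ} (L : Lam n →L[ℂ] Lam k) (S : Finset (Fin k)) (ww : ℝ → ℝ)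
    (hww : ∀ t, 0 ≤ ww t) (hwwc : Continuous ww) {G : ℝ → Lam n} (hG : Continuous G)
    (h : Integrable (fun t => ww t * ‖G t‖^2)) : Integrable (fun t => ww t * ‖L (G t) S‖^2) := by
  refine (h.const_mul (‖L‖^2)).mono' ?_ (Filter.Eventually.of_forall fun t => ?_)
  · apply Continuous.aestronglyMeasurable
    fun_prop
  · have h1 : ‖L (G t) S‖ ≤ ‖L‖ * ‖G t‖ := (PiLp.norm_apply_le _ S).trans (L.le_opNorm _)
    have := hww t
    rw [Real.norm_of_nonneg (by positivity)]
    have h2 := pow_le_pow_left₀ (norm_nonneg _) h1 2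
    calc _ ≤ ww t * (‖L‖ * ‖G t‖)^2 := by gcongr
      _ = _ := by ring

lemma int_comp {n k : ℕ} (L : Lam n →L[ℂ] Lam k) (S : Finset (Fin k)) {G : ℝ → Lam n}
    (h : Integrable G) : Integrable (fun t => L (G t) S) :=
  ((EuclideanSpace.proj S : Lam k →L[ℂ] ℂ).comp L).integrable_comp h

lemma integral_comp_zero {n k : ℕ} (L : Lam n →L[ℂ] Lam k) (S : Finset (Fin k)) {G : ℝ → Lam n}
    (h : Integrable G) (h0 : ∫ t, G t = 0) : ∫ t, L (G t) S = 0 := by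
  have := ((EuclideanSpace.proj S : Lam k →L[ℂ] ℂ).comp L).integral_comp_comm h
  rw [h0, map_zero] at this
  exact this

lemma fiber_zero {e i E I : Lam n →L[ℂ] Lam n} {r : ℝ} (hC : Cliff e i E I r) (hr : 0 < r)
    (s κ : ℝ) (hs : 1/2 < s) (hκ : 2*s < κ) (G W : ℝ → Lam n)
    (hG : ∀ t, HasDerivAt G (((r^2+t^2)⁻¹ : ℝ) •
      (W t - (2*s*t) • G t + (2:ℝ) • (i (E (G t)) + e (I (G t))))) t)
    (hW : ∀ t, HasDerivAt W (κ • e (i (G t))) t)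
    (hi : Integrable G) (h2 : Integrable (fun t => (r^2+t^2)^s * ‖G t‖^2))
    (h0 : ∫ t, i (e (G t)) = 0) (t : ℝ) : G t = 0 := by
  have hGc : Continuous G := continuous_iff_continuousAt.2 fun t => (hG t).continuousAt
  have hwwc : Continuous (fun t : ℝ => (r^2+t^2)^s) :=
    continuous_iff_continuousAt.2 fun t => (hasDerivAt_Rpow r s t hr).continuousAt
  have hww0 : ∀ t : ℝ, 0 ≤ (r^2+t^2)^s := fun t => by positivity
  obtain ⟨ee', ii', ie', Ee', Ie', Ei', Ii', EE', II', IE'⟩ := hC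
  set L1 : Lam n →L[ℂ] Lam n := I.comp (E.comp (i.comp e)) with hL1
  set L2 : Lam n →L[ℂ] Lam n := I.comp (i.comp e) with hL2
  set L3 : Lam n →L[ℂ] Lam n := I.comp (E.comp i) with hL3
  set L4 : Lam n →L[ℂ] Lam n := E.comp (I.comp (e.comp i)) with hL4
  have a1 : ∀ v, L1 (i (E v) + e (I v)) = 0 := by
    intro v
    simp only [hL1, ContinuousLinearMap.comp_apply, map_add, map_sub, map_neg, map_smul, ee', ii', ie', Ee', Ie', Ei', Ii',
      EE', II', IE', map_zero, sub_zero, neg_zero, smul_zero, add_zero, zero_add]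
    try module
  have a1' : ∀ v, L1 (e (i v)) = 0 := by
    intro v
    simp only [hL1, ContinuousLinearMap.comp_apply, map_add, map_sub, map_neg, map_smul, ee', ii', ie', Ee', Ie', Ei', Ii',
      EE', II', IE', map_zero, sub_zero, neg_zero, smul_zero, add_zero, zero_add]
  have a2 : ∀ v, L2 (i (E v) + e (I v)) = - L3 v := by
    intro v
    simp only [hL2, hL3, ContinuousLinearMap.comp_apply, map_add, map_sub, map_neg, map_smul, ee', ii', ie', Ee', Ie', Ei', Ii',
      EE', II', IE', map_zero, sub_zero, neg_zero, smul_zero, add_zero, zero_add]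
    try module
  have a2' : ∀ v, L2 (e (i v)) = 0 := by
    intro v
    simp only [hL2, ContinuousLinearMap.comp_apply, map_add, map_sub, map_neg, map_smul, ee', ii', ie', Ee', Ie', Ei', Ii',
      EE', II', IE', map_zero, sub_zero, neg_zero, smul_zero, add_zero, zero_add]
  have a3 : ∀ v, L3 (i (E v) + e (I v)) = ((r^2 : ℝ) : ℂ) • L2 v := by
    intro v
    simp only [hL2, hL3, ContinuousLinearMap.comp_apply, map_add, map_sub, map_neg, map_smul, ee', ii', ie', Ee', Ie', Ei', Ii',
      EE', II', IE', map_zero, sub_zero, neg_zero, smul_zero, add_zero, zero_add]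
    try module
  have a3' : ∀ v, L3 (e (i v)) = L3 v := by
    intro v
    simp only [hL3, ContinuousLinearMap.comp_apply, map_add, map_sub, map_neg, map_smul, ee', ii', ie', Ee', Ie', Ei', Ii',
      EE', II', IE', map_zero, sub_zero, neg_zero, smul_zero, add_zero, zero_add]
  have a4 : ∀ v, L4 (i (E v) + e (I v)) = 0 := by
    intro v
    simp only [hL4, ContinuousLinearMap.comp_apply, map_add, map_sub, map_neg, map_smul, ee', ii', ie', Ee', Ie', Ei', Ii',
      EE', II', IE', map_zero, sub_zero, neg_zero, smul_zero, add_zero, zero_add]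
    try module
  have a4' : ∀ v, L4 (e (i v)) = L4 v := by
    intro v
    simp only [hL4, ContinuousLinearMap.comp_apply, map_add, map_sub, map_neg, map_smul, ee', ii', ie', Ee', Ie', Ei', Ii',
      EE', II', IE', map_zero, sub_zero, neg_zero, smul_zero, add_zero, zero_add]
  -- derivative of components
  have dG : ∀ (L : Lam n →L[ℂ] Lam n) (S : Finset (Fin n)) (t : ℝ),
      HasDerivAt (fun t => L (G t) S) (((r^2+t^2)⁻¹ : ℝ) •
      (L (W t) S - (2*s*t) • L (G t) S + (2:ℝ) • L (i (E (G t)) + e (I (G t))) S)) t := by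
    intro L S t
    refine (coord_hasDeriv S (clm_hasDeriv L (hG t))).congr_deriv ?_
    simp only [rsm, map_add, map_sub, PiLp.smul_apply, PiLp.add_apply, PiLp.sub_apply]
  have dW : ∀ (L : Lam n →L[ℂ] Lam n) (S : Finset (Fin n)) (t : ℝ),
      HasDerivAt (fun t => L (W t) S) (κ • L (e (i (G t))) S) t := by
    intro L S t
    refine (coord_hasDeriv S (clm_hasDeriv L (hW t))).congr_deriv ?_
    simp only [rsm, PiLp.smul_apply]
  have cst : ∀ (L : Lam n →L[ℂ] Lam n) (S : Finset (Fin n)), (∀ v, L (e (i v)) = 0) →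
      ∀ t, L (W t) S = L (W 0) S := by
    intro L S hL t
    have hd : ∀ t, HasDerivAt (fun t => L (W t) S) 0 t := fun t =>
      (dW L S t).congr_deriv (by rw [hL]; simp)
    exact is_const_of_deriv_eq_zero (fun t => (hd t).differentiableAt) (fun t => (hd t).deriv) t 0
  have iez : ∀ (L : Lam n →L[ℂ] Lam n) (S : Finset (Fin n)), ∫ t, L (i (e (G t))) S = 0 := by
    intro L S
    exact integral_comp_zero L S ((i.comp e).integrable_comp hi) h0
  have X1 : L1 (G t) = 0 := by
    ext S
    refine alpha_zero r s hr (L1 (W 0) S) (fun t => L1 (G t) S) (fun t => ?_) (int_comp L1 S hi)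
      (iez (I.comp E) S) t
    refine (dG L1 S t).congr_deriv ?_
    rw [a1, cst L1 S a1' t]; simp
  have X23 : ∀ S, L2 (G t) S = 0 ∧ L3 (G t) S = 0 := by
    intro S
    refine pair_zero r s κ hr hs hκ (L2 (W 0) S) (fun t => L2 (G t) S) (fun t => L3 (G t) S)
      (fun t => L3 (W t) S) (fun t => ?_) (fun t => ?_) (fun t => ?_) (int_comp L2 S hi)
      (int_comp L3 S hi) (weighted_comp L2 S _ hww0 hwwc hGc h2)
      (weighted_comp L3 S _ hww0 hwwc hGc h2) (iez I S) t
    · refine (dG L2 S t).congr_deriv ?_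
      rw [a2, cst L2 S a2' t]; simp [sub_eq_add_neg]
    · refine (dG L3 S t).congr_deriv ?_
      rw [a3]
      simp only [PiLp.smul_apply, Complex.real_smul, smul_eq_mul]
      push_cast; ring
    · refine (dW L3 S t).congr_deriv ?_
      rw [a3']
  have X4 : L4 (G t) = 0 := by
    ext S
    refine delta_zero r s κ hr hs (by linarith) (fun t => L4 (G t) S) (fun t => L4 (W t) S)
      (fun t => ?_) (fun t => ?_) (weighted_comp L4 S _ hww0 hwwc hGc h2) t
    · refine (dG L4 S t).congr_deriv ?_
      rw [a4]; simp
    · refine (dW L4 S t).congr_deriv ?_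
      rw [a4']
  have X2 : L2 (G t) = 0 := by ext S; exact (X23 S).1
  have X3 : L3 (G t) = 0 := by ext S; exact (X23 S).2
  have fin : ∀ v, ((r^2 : ℝ) : ℂ) • v = L1 v + E (L2 v) + e (L3 v) + L4 v := by
    intro v
    simp only [hL1, hL2, hL3, hL4, ContinuousLinearMap.comp_apply, map_add, map_sub, map_neg, map_smul, ee', ii', ie', Ee', Ie', Ei', Ii',
      EE', II', IE', map_zero, sub_zero, neg_zero, smul_zero, add_zero, zero_add]
    module
  have := fin (G t)
  rw [X1, X2, X3, X4] at this
  simp only [map_zero, add_zero] at this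
  refine (smul_eq_zero.1 this).resolve_left ?_
  exact_mod_cast (by positivity : (r^2:ℝ) ≠ 0)


/-- real test functions on the line -/
def Tst (χ : ℝ → ℝ) : Prop := ContDiff ℝ ∞ χ ∧ HasCompactSupport χ

lemma Tst.der {χ : ℝ → ℝ} (h : Tst χ) : Tst (deriv χ) :=
  ⟨(contDiff_infty_iff_deriv.1 h.1).2, h.2.deriv⟩

lemma Tst.hasDerivAt {χ : ℝ → ℝ} (h : Tst χ) (t : ℝ) : HasDerivAt χ (deriv χ t) t :=
  ((contDiff_infty_iff_deriv.1 h.1).1 t).hasDerivAt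

lemma Tst.bound {χ : ℝ → ℝ} (h : HasCompactSupport χ) : ∃ N : ℝ, 0 < N ∧ ∀ t, N ≤ |t| → χ t = 0 := by
  obtain ⟨N, hN⟩ := h.isCompact.isBounded.subset_ball 0
  refine ⟨max N 1, by positivity, fun t ht => ?_⟩
  by_contra hne
  have := hN (subset_tsupport _ hne)
  simp at this
  exact absurd (le_trans (le_max_left _ _) ht) (not_le.2 this)

lemma Tst.of_bound {χ : ℝ → ℝ} (h : ContDiff ℝ ∞ χ) (N : ℝ) (hN : ∀ t, N ≤ |t| → χ t = 0) : Tst χ := by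
  refine ⟨h, HasCompactSupport.intro (K := Set.Icc (-N) N) isCompact_Icc fun t ht => hN t ?_⟩
  by_contra hlt
  exact ht (abs_le.1 (not_le.1 hlt).le)

lemma Tst.sub_smul {χ ψ : ℝ → ℝ} (h : Tst χ) (h2 : Tst ψ) (c : ℝ) :
    Tst (fun t => χ t - c * ψ t) := by
  obtain ⟨N, hN0, hN⟩ := Tst.bound h.2
  obtain ⟨M, hM0, hM⟩ := Tst.bound h2.2
  refine Tst.of_bound (h.1.sub (contDiff_const.mul h2.1)) (max N M) fun t ht => ?_
  rw [hN t ((le_max_left _ _).trans ht), hM t ((le_max_right _ _).trans ht)]; simp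

lemma Tst.mul_int {χ F : ℝ → ℝ} (h : Tst χ) (hF : LocallyIntegrable F) :
    Integrable (fun t => χ t * F t) := by
  have := hF.integrable_smul_left_of_hasCompactSupport h.1.continuous h.2
  simpa using this

lemma ibp {χ F : ℝ → ℝ} (h : Tst χ) (hF : LocallyIntegrable F) :
    ∫ t, deriv χ t * (∫ τ in (0:ℝ)..t, F τ) = - ∫ t, χ t * F t := by
  obtain ⟨N, hN0, hN⟩ := Tst.bound h.2
  have hNd : ∀ t, N < |t| → deriv χ t = 0 := by
    intro t ht
    have : χ =ᶠ[nhds t] fun _ => 0 := by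
      filter_upwards [(isOpen_lt continuous_const continuous_abs).mem_nhds ht] with y hy
      exact hN y (le_of_lt hy)
    rw [this.deriv_eq]; simp
  have supp : ∀ f : ℝ → ℝ, (∀ t, N < |t| → f t = 0) → ∫ t, f t = ∫ t in (-(N+1))..(N+1), f t := by
    intro f hf
    rw [intervalIntegral.integral_eq_integral_of_support_subset]
    intro t ht
    have : |t| ≤ N := by by_contra hc; exact ht (hf t (not_le.1 hc))
    have := abs_le.1 this
    constructor <;> linarith
  have hii : ∀ a b, IntervalIntegrable F volume a b := fun a b =>
    intervalIntegrable_iff.mpr <|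
      (hF.integrableOn_isCompact isCompact_uIcc).mono_set Set.uIoc_subset_uIcc
  rw [supp _ (fun t ht => by rw [hNd t ht, zero_mul]), supp _ (fun t ht => by rw [hN t ht.le, zero_mul])]
  have ac1 : AbsolutelyContinuousOnInterval (fun x => ∫ v in (0:ℝ)..x, F v) (-(N+1)) (N+1) :=
    (hii _ _).absolutelyContinuousOnInterval_intervalIntegral (by
      rw [Set.uIcc_of_le (by linarith)]; constructor <;> linarith)
  have ac2 : AbsolutelyContinuousOnInterval χ (-(N+1)) (N+1) :=
    ContDiffOn.absolutelyContinuousOnInterval (h.1.of_le (by simp)).contDiffOn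
  have key := ac2.integral_mul_deriv_eq_deriv_mul ac1
  rw [hN (N+1) (by rw [abs_of_pos] <;> linarith), hN (-(N+1)) (by rw [abs_neg, abs_of_pos] <;> linarith)] at key
  simp only [zero_mul, sub_zero, zero_sub] at key
  rw [← neg_eq_iff_eq_neg, ← key]
  refine intervalIntegral.integral_congr_ae ?_
  filter_upwards [_root_.LocallyIntegrable.ae_hasDerivAt_integral hF] with t ht _
  rw [(ht 0).deriv]

lemma test_prim {φ : ℝ → ℝ} (h : Tst φ) (h0 : ∫ t, φ t = 0) : ∃ χ, Tst χ ∧ deriv χ = φ := by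
  obtain ⟨N, hN0, hN⟩ := Tst.bound h.2
  have hc := h.1.continuous
  have hd : ∀ t, HasDerivAt (fun t => ∫ τ in (-N)..t, φ τ) (φ t) t := fun t =>
    intervalIntegral.integral_hasDerivAt_right (hc.intervalIntegrable _ _)
      hc.stronglyMeasurable.stronglyMeasurableAtFilter hc.continuousAt
  have hde : deriv (fun t => ∫ τ in (-N)..t, φ τ) = φ := funext fun t => (hd t).deriv
  refine ⟨_, Tst.of_bound (contDiff_infty_iff_deriv.2 ⟨fun t => (hd t).differentiableAt, by
    rw [hde]; exact h.1⟩) N fun t ht => ?_, hde⟩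
  rcases le_abs.1 ht with h1 | h1
  · rw [intervalIntegral.integral_eq_integral_of_support_subset, h0]
    intro τ hτ
    have : |τ| < N := by by_contra hc'; exact hτ (hN τ (not_lt.1 hc'))
    have := abs_lt.1 this
    constructor <;> linarith
  · rw [intervalIntegral.integral_symm, intervalIntegral.integral_of_le (by linarith)]
    rw [setIntegral_eq_zero_of_forall_eq_zero, neg_zero]
    intro τ hτ
    exact hN τ (by rw [le_abs]; right; linarith [hτ.2])

lemma exists_bump1 : ∃ χ : ℝ → ℝ, Tst χ ∧ ∫ t, χ t = 1 := by
  let f : ContDiffBump (0:ℝ) := ⟨1, 2, one_pos, one_lt_two⟩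
  exact ⟨f.normed volume, ⟨f.contDiff_normed, f.hasCompactSupport_normed⟩, f.integral_normed⟩

lemma weak_const {Z : ℝ → ℝ} (hZ : LocallyIntegrable Z)
    (h : ∀ χ, Tst χ → ∫ t, deriv χ t * Z t = 0) : ∃ c, ∀ᵐ t, Z t = c := by
  obtain ⟨χ0, hχ0, hχ1⟩ := exists_bump1
  refine ⟨∫ t, χ0 t * Z t, ?_⟩
  refine ae_eq_of_integral_contDiff_smul_eq hZ (locallyIntegrable_const _) fun φ hφ hφc => ?_
  have hφt : Tst φ := ⟨hφ, hφc⟩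
  have hi0 : Integrable χ0 := hχ0.1.continuous.integrable_of_hasCompactSupport hχ0.2
  have hiφ : Integrable φ := hφ.continuous.integrable_of_hasCompactSupport hφc
  have ht := hφt.sub_smul hχ0 (∫ t, φ t)
  obtain ⟨χ, hχ, hχd⟩ := test_prim ht (by
    rw [integral_sub hiφ (hi0.const_mul _), integral_const_mul, hχ1]; ring)
  have := h χ hχ
  rw [hχd] at this
  have e : ∀ t, (φ t - (∫ t, φ t) * χ0 t) * Z t = φ t * Z t - (∫ t, φ t) * (χ0 t * Z t) := fun t => by ring
  simp only [e] at this
  rw [integral_sub (hφt.mul_int hZ) ((hχ0.mul_int hZ).const_mul _), integral_const_mul] at this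
  simp only [smul_eq_mul]
  rw [integral_mul_const]
  linarith

lemma weak_affine {Z : ℝ → ℝ} (hZ : LocallyIntegrable Z)
    (h : ∀ χ, Tst χ → ∫ t, deriv (deriv χ) t * Z t = 0) : ∃ c0 c1, ∀ᵐ t, Z t = c0 + c1 * t := by
  obtain ⟨χ0, hχ0, hχ1⟩ := exists_bump1
  set c := ∫ t, deriv χ0 t * Z t with hc
  have hi0 : Integrable χ0 := hχ0.1.continuous.integrable_of_hasCompactSupport hχ0.2
  have hlin : LocallyIntegrable (fun t : ℝ => c * t) :=
    (by fun_prop : Continuous (fun t : ℝ => c * t)).locallyIntegrable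
  obtain ⟨c0, hc0⟩ := weak_const (hZ.add hlin) (by
    intro φ hφ
    have hiφ : Integrable φ := hφ.1.continuous.integrable_of_hasCompactSupport hφ.2
    obtain ⟨χ, hχ, hχd⟩ := test_prim (hφ.sub_smul hχ0 (∫ t, φ t)) (by
      rw [integral_sub hiφ (hi0.const_mul _), integral_const_mul, hχ1]; ring)
    have h1 := h χ hχ
    have hdd : deriv (deriv χ) = fun t => deriv φ t - (∫ t, φ t) * deriv χ0 t := by
      rw [hχd]; funext t
      exact ((hφ.hasDerivAt t).sub ((hχ0.hasDerivAt t).const_mul _)).deriv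
    rw [hdd] at h1
    have e : ∀ t, (deriv φ t - (∫ t, φ t) * deriv χ0 t) * Z t =
      deriv φ t * Z t - (∫ t, φ t) * (deriv χ0 t * Z t) := fun t => by ring
    simp only [e] at h1
    rw [integral_sub (hφ.der.mul_int hZ) ((hχ0.der.mul_int hZ).const_mul _), integral_const_mul, ← hc] at h1
    have h2 := ibp hφ (locallyIntegrable_const (1:ℝ))
    simp only [intervalIntegral.integral_const, sub_zero, smul_eq_mul, mul_one] at h2
    have e2 : ∀ t, deriv φ t * (Z + fun t => c * t) t = deriv φ t * Z t + c * (deriv φ t * t) := fun t => by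
      simp only [Pi.add_apply]; ring
    simp only [e2]
    rw [integral_add (hφ.der.mul_int hZ), integral_const_mul, h2]
    · linarith
    · exact (hφ.der.mul_int (continuous_id.locallyIntegrable)).const_mul c)
  refine ⟨c0, -c, ?_⟩
  filter_upwards [hc0] with t ht
  simp only [Pi.add_apply] at ht
  linarith

lemma weak_real {F0 F1 F2 : ℝ → ℝ} (h0 : LocallyIntegrable F0) (h1 : LocallyIntegrable F1)
    (h2 : LocallyIntegrable F2)
    (h : ∀ χ, Tst χ → ∫ t, (deriv (deriv χ) t * F0 t + deriv χ t * F1 t + χ t * F2 t) = 0) :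
    ∃ c0 c1, ∀ᵐ t, F0 t = c0 + c1 * t + (∫ τ in (0:ℝ)..t, F1 τ)
      - ∫ σ in (0:ℝ)..t, ∫ τ in (0:ℝ)..σ, F2 τ := by
  have prc : ∀ {F : ℝ → ℝ}, LocallyIntegrable F → Continuous (fun t => ∫ τ in (0:ℝ)..t, F τ) := by
    intro F hF
    refine intervalIntegral.continuous_primitive (fun a b => ?_) 0
    exact intervalIntegrable_iff.mpr <|
      (hF.integrableOn_isCompact isCompact_uIcc).mono_set Set.uIoc_subset_uIcc
  have l1 := (prc h1).locallyIntegrable (μ := volume)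
  have l2 := (prc h2).locallyIntegrable (μ := volume)
  have l3 := (prc l2).locallyIntegrable (μ := volume)
  obtain ⟨c0, c1, hc⟩ := weak_affine ((h0.sub l1).add l3) (by
    intro χ hχ
    have b1 := ibp hχ.der h1
    have b2 := ibp hχ h2
    have b3 := ibp hχ.der l2
    have i0 := hχ.der.der.mul_int h0
    have i1 := hχ.der.mul_int h1
    have i2 := hχ.mul_int h2
    have := h χ hχ
    rw [integral_add (f := fun t => deriv (deriv χ) t * F0 t + deriv χ t * F1 t) (i0.add i1) i2, integral_add i0 i1] at this
    have j1 := hχ.der.der.mul_int l1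
    have j3 := hχ.der.der.mul_int l3
    simp only [Pi.add_apply, Pi.sub_apply, mul_add, mul_sub]
    rw [integral_add (f := fun t => deriv (deriv χ) t * F0 t - deriv (deriv χ) t * ∫ τ in (0:ℝ)..t, F1 τ) (i0.sub j1) j3, integral_sub i0 j1, b1, b3, b2]
    linarith)
  refine ⟨c0, c1, ?_⟩
  filter_upwards [hc] with t ht
  simp only [Pi.add_apply, Pi.sub_apply] at ht
  linarith


lemma loc_ii {V : Type*} [NormedAddCommGroup V] {F : ℝ → V} (hF : LocallyIntegrable F) (a b : ℝ) :
    IntervalIntegrable F volume a b :=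
  intervalIntegrable_iff.mpr <|
    (hF.integrableOn_isCompact isCompact_uIcc).mono_set Set.uIoc_subset_uIcc

lemma weak_vec {V : Type*} [NormedAddCommGroup V] [NormedSpace ℝ V] [FiniteDimensional ℝ V]
    {F0 F1 F2 : ℝ → V} (h0 : LocallyIntegrable F0) (h1 : LocallyIntegrable F1)
    (h2 : LocallyIntegrable F2)
    (h : ∀ χ, Tst χ → ∫ t, (deriv (deriv χ) t • F0 t + deriv χ t • F1 t + χ t • F2 t) = 0) :
    ∃ c0 c1 : V, ∀ᵐ t, F0 t = c0 + t • c1 + (∫ τ in (0:ℝ)..t, F1 τ)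
      - ∫ σ in (0:ℝ)..t, ∫ τ in (0:ℝ)..σ, F2 τ := by
  have : CompleteSpace V := FiniteDimensional.complete ℝ V
  let b := Module.finBasis ℝ V
  let L : Fin (Module.finrank ℝ V) → V →L[ℝ] ℝ := fun k => (b.coord k).toContinuousLinearMap
  have lc : ∀ {F : ℝ → V}, LocallyIntegrable F → ∀ k, LocallyIntegrable (fun t => L k (F t)) := by
    intro F hF k x
    obtain ⟨u, hu, hi⟩ := hF x
    exact ⟨u, hu, (L k).integrable_comp hi⟩
  have sm : ∀ {F : ℝ → V} {χ : ℝ → ℝ}, LocallyIntegrable F → Tst χ → Integrable (fun t => χ t • F t) :=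
    fun hF hχ => hF.integrable_smul_left_of_hasCompactSupport hχ.1.continuous hχ.2
  have key : ∀ k, ∃ c0 c1, ∀ᵐ t, L k (F0 t) = c0 + c1 * t + (∫ τ in (0:ℝ)..t, L k (F1 τ))
      - ∫ σ in (0:ℝ)..t, ∫ τ in (0:ℝ)..σ, L k (F2 τ) := by
    intro k
    refine weak_real (lc h0 k) (lc h1 k) (lc h2 k) fun χ hχ => ?_
    have := congrArg (L k) (h χ hχ)
    rw [map_zero, ← (L k).integral_comp_comm] at this
    · simpa using this
    · exact ((sm h0 hχ.der.der).add (sm h1 hχ.der)).add (sm h2 hχ)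
  choose c0 c1 hc using key
  refine ⟨∑ k, c0 k • b k, ∑ k, c1 k • b k, ?_⟩
  filter_upwards [ae_all_iff.2 hc] with t ht
  have prc : Continuous (fun t => ∫ τ in (0:ℝ)..t, F2 τ) :=
    intervalIntegral.continuous_primitive (fun a b => loc_ii h2 a b) 0
  refine b.ext_elem fun k => ?_
  have e := ht k
  have e1 : ∀ v : V, b.repr v k = L k v := fun v => rfl
  have e2 : ∀ d : Fin (Module.finrank ℝ V) → ℝ, L k (∑ j, d j • b j) = d k := by
    intro d
    rw [← e1]; simp [Finsupp.single_apply]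
  rw [e1, e1, map_sub, map_add, map_add, map_smul, e2, e2, e,
    ← (L k).intervalIntegral_comp_comm (loc_ii h1 _ _),
    ← (L k).intervalIntegral_comp_comm (prc.intervalIntegrable _ _)]
  simp only [smul_eq_mul, mul_comm]
  congr 1
  refine intervalIntegral.integral_congr fun σ _ => ?_
  exact (L k).intervalIntegral_comp_comm (loc_ii h2 _ _)

lemma fiber_reg {V : Type*} [NormedAddCommGroup V] [NormedSpace ℝ V] [FiniteDimensional ℝ V]
    (M N : V →L[ℝ] V) (r s κ : ℝ) (hr : 0 < r) {G : ℝ → V} (hG : LocallyIntegrable G)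
    (h : ∀ χ, Tst χ → ∫ t, (deriv (deriv χ) t • (r^2+t^2) • G t +
      deriv χ t • (((2-2*s)*t) • G t + (2:ℝ) • M (G t)) + χ t • (-κ) • N (G t)) = 0) :
    ∃ G' W : ℝ → V, (∀ᵐ t, G t = G' t) ∧
      (∀ t, HasDerivAt G' ((r^2+t^2)⁻¹ • (W t - (2*s*t) • G' t + (2:ℝ) • M (G' t))) t) ∧
      (∀ t, HasDerivAt W (κ • N (G' t)) t) := by
  have : CompleteSpace V := FiniteDimensional.complete ℝ V
  have lc : ∀ L : V →L[ℝ] V, LocallyIntegrable (fun t => L (G t)) := by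
    intro L x
    obtain ⟨u, hu, hi⟩ := hG x
    exact ⟨u, hu, L.integrable_comp hi⟩
  have sm : ∀ {F : ℝ → V} {c : ℝ → ℝ}, LocallyIntegrable F → Continuous c →
      LocallyIntegrable (fun t => c t • F t) := fun hF hc => hF.continuous_smul hc
  have h0 : LocallyIntegrable (fun t => (r^2+t^2) • G t) := sm hG (by fun_prop)
  have h1 : LocallyIntegrable (fun t => ((2-2*s)*t) • G t + (2:ℝ) • M (G t)) :=
    (sm hG (by fun_prop)).add (sm (lc M) continuous_const)
  have h2 : LocallyIntegrable (fun t => (-κ) • N (G t)) := sm (lc N) continuous_const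
  obtain ⟨c0, c1, hc⟩ := weak_vec h0 h1 h2 h
  have hρ : ∀ t : ℝ, r^2+t^2 ≠ 0 := fun t => by positivity
  have prc2 : Continuous (fun t => ∫ τ in (0:ℝ)..t, (-κ) • N (G τ)) :=
    intervalIntegral.continuous_primitive (fun a b => loc_ii h2 a b) 0
  have prc1 : Continuous (fun t => ∫ τ in (0:ℝ)..t, (((2-2*s)*τ) • G τ + (2:ℝ) • M (G τ))) :=
    intervalIntegral.continuous_primitive (fun a b => loc_ii h1 a b) 0
  have prc3 : Continuous (fun t => ∫ σ in (0:ℝ)..t, ∫ τ in (0:ℝ)..σ, (-κ) • N (G τ)) :=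
    intervalIntegral.continuous_primitive (fun a b => prc2.intervalIntegrable _ _) 0
  set H : ℝ → V := fun t => c0 + t • c1 + (∫ τ in (0:ℝ)..t, (((2-2*s)*τ) • G τ + (2:ℝ) • M (G τ)))
      - ∫ σ in (0:ℝ)..t, ∫ τ in (0:ℝ)..σ, (-κ) • N (G τ) with hH
  have Hc : Continuous H := by
    have : Continuous fun t : ℝ => c0 + t • c1 := by fun_prop
    exact (this.add prc1).sub prc3
  set G' : ℝ → V := fun t => (r^2+t^2)⁻¹ • H t with hG'
  have G'c : Continuous G' := (Continuous.inv₀ (by fun_prop) hρ).smul Hc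
  have hae : ∀ᵐ t, G t = G' t := by
    filter_upwards [hc] with t ht
    simp only [hG', hH]
    rw [← ht, smul_smul, inv_mul_cancel₀ (hρ t), one_smul]
  have f1c : Continuous (fun τ => ((2-2*s)*τ) • G' τ + (2:ℝ) • M (G' τ)) := by fun_prop
  have f2c : Continuous (fun τ => (-κ) • N (G' τ)) := by fun_prop
  have e1 : ∀ t, ∫ τ in (0:ℝ)..t, (((2-2*s)*τ) • G τ + (2:ℝ) • M (G τ))
      = ∫ τ in (0:ℝ)..t, (((2-2*s)*τ) • G' τ + (2:ℝ) • M (G' τ)) := fun t =>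
    intervalIntegral.integral_congr_ae (by filter_upwards [hae] with τ hτ _; rw [hτ])
  have e2 : ∀ t, ∫ τ in (0:ℝ)..t, (-κ) • N (G τ) = ∫ τ in (0:ℝ)..t, (-κ) • N (G' τ) := fun t =>
    intervalIntegral.integral_congr_ae (by filter_upwards [hae] with τ hτ _; rw [hτ])
  have ftc : ∀ {F : ℝ → V}, Continuous F → ∀ t, HasDerivAt (fun t => ∫ τ in (0:ℝ)..t, F τ) (F t) t :=
    fun hF t => intervalIntegral.integral_hasDerivAt_right (hF.intervalIntegrable _ _)
      hF.stronglyMeasurable.stronglyMeasurableAtFilter hF.continuousAt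
  refine ⟨G', fun t => c1 - ∫ τ in (0:ℝ)..t, (-κ) • N (G' τ), hae, fun t => ?_, fun t => ?_⟩
  · have dH : HasDerivAt H (c1 + (((2-2*s)*t) • G' t + (2:ℝ) • M (G' t))
        - ∫ τ in (0:ℝ)..t, (-κ) • N (G' τ)) t := by
      have := (((hasDerivAt_id t).smul_const c1).const_add c0 |>.add (ftc f1c t)).sub (ftc prc2 t)
      simp only [e2] at this
      refine (this.congr_deriv (by simp)).congr_of_eventuallyEq (Filter.Eventually.of_forall fun t => ?_)
      simp only [hH, e1, e2, Pi.sub_apply, Pi.add_apply, id]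
    have dρ : HasDerivAt (fun t : ℝ => (r^2+t^2)⁻¹) (-(2*t)/(r^2+t^2)^2) t := by
      have : HasDerivAt (fun t : ℝ => r^2+t^2) (2*t) t := by
        simpa using ((hasDerivAt_id t).pow 2).const_add (r^2)
      exact this.inv (hρ t)
    have := dρ.smul dH
    refine this.congr_deriv ?_
    have hHG : H t = (r^2+t^2) • G' t := by simp only [hG']; rw [smul_smul, mul_inv_cancel₀ (hρ t), one_smul]
    rw [hHG, smul_smul (-(2*t)/(r^2+t^2)^2)]
    have : -(2*t)/(r^2+t^2)^2 * (r^2+t^2) = (r^2+t^2)⁻¹ * (-(2*t)) := by field_simp [hρ t]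
    rw [this, ← smul_smul (r^2+t^2)⁻¹, ← smul_add]
    congr 1
    module
  · exact ((ftc f2c t).const_sub c1).congr_deriv (by simp)


lemma deriv_out {χ : ℝ → ℝ} {N : ℝ} (hN : ∀ t, N < |t| → χ t = 0) : ∀ t, N < |t| → deriv χ t = 0 := by
  intro t ht
  have : χ =ᶠ[nhds t] fun _ => 0 := by
    filter_upwards [(isOpen_lt continuous_const continuous_abs).mem_nhds ht] with y hy
    exact hN y hy
  rw [this.deriv_eq]; simp

lemma tests_approx (N : ℕ) : ∃ D : Set (ℝ → ℝ), D.Countable ∧ (∀ χ ∈ D, Tst χ ∧ ∀ t, (N:ℝ) < |t| → χ t = 0) ∧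
    ∀ χ, Tst χ → (∀ t, (N:ℝ) < |t| → χ t = 0) → ∀ ε > 0, ∃ χ' ∈ D, ∀ t,
      |χ t - χ' t| ≤ ε ∧ |deriv χ t - deriv χ' t| ≤ ε ∧ |deriv (deriv χ) t - deriv (deriv χ') t| ≤ ε := by
  let K := Set.Icc (-(N:ℝ)) N
  let P := {χ : ℝ → ℝ // Tst χ ∧ ∀ t, (N:ℝ) < |t| → χ t = 0}
  let Θ : P → C(K, ℝ) × C(K, ℝ) × C(K, ℝ) := fun χ =>
    (⟨fun t => χ.1 t, χ.2.1.1.continuous.comp continuous_subtype_val⟩,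
     ⟨fun t => deriv χ.1 t, χ.2.1.der.1.continuous.comp continuous_subtype_val⟩,
     ⟨fun t => deriv (deriv χ.1) t, χ.2.1.der.der.1.continuous.comp continuous_subtype_val⟩)
  obtain ⟨D0, hD0c, hD0⟩ := TopologicalSpace.exists_countable_dense (Set.range Θ)
  choose pre hpre using fun x : Set.range Θ => x.2
  refine ⟨(fun x => (pre x).1) '' D0, hD0c.image _, ?_, ?_⟩
  · rintro _ ⟨x, _, rfl⟩
    exact (pre x).2
  · intro χ hχ hN ε hε
    obtain ⟨y, hy, hd⟩ := hD0.exists_dist_lt (⟨Θ ⟨χ, hχ, hN⟩, ⟨_, rfl⟩⟩ : Set.range Θ) hε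
    refine ⟨_, ⟨y, hy, rfl⟩, fun t => ?_⟩
    rw [Subtype.dist_eq, ← hpre y] at hd
    simp only [Prod.dist_eq, max_lt_iff] at hd
    obtain ⟨d0, d1, d2⟩ := hd
    by_cases ht : |t| ≤ N
    · have htK : t ∈ K := abs_le.1 ht
      refine ⟨?_, ?_, ?_⟩
      · exact (ContinuousMap.dist_apply_le_dist (⟨t, htK⟩ : K)).trans d0.le
      · exact (ContinuousMap.dist_apply_le_dist (⟨t, htK⟩ : K)).trans d1.le
      · exact (ContinuousMap.dist_apply_le_dist (⟨t, htK⟩ : K)).trans d2.le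
    · have ht := not_le.1 ht
      have h1 := (pre y).2.2
      beta_reduce
      rw [hN t ht, h1 t ht, deriv_out hN t ht, deriv_out h1 t ht, deriv_out (deriv_out hN) t ht,
        deriv_out (deriv_out h1) t ht]
      simp [hε.le]

lemma tests_countable : ∃ D : Set (ℝ → ℝ), D.Countable ∧ (∀ χ ∈ D, Tst χ) ∧
    ∀ {V : Type} [NormedAddCommGroup V] [NormedSpace ℝ V] (A B C : ℝ → V),
      LocallyIntegrable A → LocallyIntegrable B → LocallyIntegrable C →
      (∀ χ ∈ D, ∫ t, (deriv (deriv χ) t • A t + deriv χ t • B t + χ t • C t) = 0) →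
      ∀ χ, Tst χ → ∫ t, (deriv (deriv χ) t • A t + deriv χ t • B t + χ t • C t) = 0 := by
  choose D hDc hD hDa using tests_approx
  refine ⟨⋃ N, D N, Set.countable_iUnion hDc, ?_, ?_⟩
  · rintro χ hχ
    obtain ⟨N, hN⟩ := Set.mem_iUnion.1 hχ
    exact (hD N χ hN).1
  · intro V _ _ A B C hA hB hC h χ hχ
    obtain ⟨N0, hN0, hN0'⟩ := Tst.bound hχ.2
    obtain ⟨N, hN⟩ := exists_nat_ge N0
    have hχN : ∀ t, (N:ℝ) < |t| → χ t = 0 := fun t ht => hN0' t (hN.trans ht.le)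
    have sm : ∀ {F : ℝ → V} {χ : ℝ → ℝ}, LocallyIntegrable F → Tst χ → Integrable (fun t => χ t • F t) :=
      fun hF hχ => hF.integrable_smul_left_of_hasCompactSupport hχ.1.continuous hχ.2
    set S := Set.Icc (-(N:ℝ)) N
    have hInt : Integrable (S.indicator (fun t => ‖A t‖ + ‖B t‖ + ‖C t‖)) := by
      rw [integrable_indicator_iff measurableSet_Icc]
      exact ((hA.integrableOn_isCompact isCompact_Icc).norm.add
        (hB.integrableOn_isCompact isCompact_Icc).norm).add (hC.integrableOn_isCompact isCompact_Icc).norm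
    set Kc := ∫ t, S.indicator (fun t => ‖A t‖ + ‖B t‖ + ‖C t‖) t
    have hK : 0 ≤ Kc := integral_nonneg fun t => Set.indicator_nonneg (fun t _ => by positivity) t
    have main : ∀ ε > 0, ‖∫ t, (deriv (deriv χ) t • A t + deriv χ t • B t + χ t • C t)‖ ≤ ε * Kc := by
      intro ε hε
      obtain ⟨χ', hχ'D, hc⟩ := hDa N χ hχ hχN ε hε
      obtain ⟨hχ', hχ'N⟩ := hD N χ' hχ'D
      have h0 := h χ' (Set.mem_iUnion.2 ⟨N, hχ'D⟩)
      have ii : ∀ χ, Tst χ → Integrable (fun t => deriv (deriv χ) t • A t + deriv χ t • B t + χ t • C t) :=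
        fun χ hχ => ((sm hA hχ.der.der).add (sm hB hχ.der)).add (sm hC hχ)
      rw [← sub_zero (∫ t, _), ← h0, ← integral_sub (ii χ hχ) (ii χ' hχ'), ← integral_const_mul]
      refine norm_integral_le_of_norm_le (hInt.const_mul ε) (Filter.Eventually.of_forall fun t => ?_)
      have e : (deriv (deriv χ) t • A t + deriv χ t • B t + χ t • C t) -
          (deriv (deriv χ') t • A t + deriv χ' t • B t + χ' t • C t) =
          (deriv (deriv χ) t - deriv (deriv χ') t) • A t + (deriv χ t - deriv χ' t) • B t
            + (χ t - χ' t) • C t := by module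
      by_cases ht : t ∈ S
      · rw [e, Set.indicator_of_mem ht]
        obtain ⟨c0, c1, c2⟩ := hc t
        refine (norm_add₃_le).trans ?_
        rw [norm_smul, norm_smul, norm_smul, mul_add, mul_add]
        gcongr <;> assumption
      · have ht' : (N:ℝ) < |t| := by
          by_contra hcon; exact ht (abs_le.1 (not_lt.1 hcon))
        rw [Set.indicator_of_notMem ht, hχN t ht', hχ'N t ht', deriv_out hχN t ht', deriv_out hχ'N t ht',
          deriv_out (deriv_out hχN) t ht', deriv_out (deriv_out hχ'N) t ht']
        simp
    rw [← norm_le_zero_iff]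
    refine le_of_forall_pos_le_add fun δ hδ => ?_
    refine (main (δ / (Kc + 1)) (by positivity)).trans ?_
    rw [zero_add, div_mul_eq_mul_div, div_le_iff₀ (by positivity)]
    nlinarith

/-- uniqueness on a single fiber -/
lemma fiber_unique {e i E I : Lam n →L[ℂ] Lam n} {r : ℝ} (hC : Cliff e i E I r) (hr : 0 < r)
    (s κ : ℝ) (hs : 1/2 < s) (hκ : 2*s < κ) (G : ℝ → Lam n)
    (hi : Integrable G) (h2 : Integrable (fun t => (r^2+t^2)^s * ‖G t‖^2))
    (h : ∀ χ, Tst χ → ∫ t, (deriv (deriv χ) t • (r^2+t^2) • G t +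
      deriv χ t • (((2-2*s)*t) • G t + (2:ℝ) • (i (E (G t)) + e (I (G t)))) + χ t • (-κ) • e (i (G t))) = 0)
    (h0 : ∫ t, i (e (G t)) = 0) : ∀ᵐ t, G t = 0 := by
  have : FiniteDimensional ℝ (Lam n) := FiniteDimensional.trans ℝ ℂ (Lam n)
  obtain ⟨G', W, hae, hG', hW⟩ := fiber_reg
    ((i.comp E + e.comp I).restrictScalars ℝ) ((e.comp i).restrictScalars ℝ) r s κ hr
    hi.locallyIntegrable h
  have hz := fiber_zero hC hr s κ hs hκ G' W hG' hW (hi.congr hae)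
    (h2.congr (by filter_upwards [hae] with t ht; rw [ht]))
    (by rw [← h0]; refine integral_congr_ae ?_; filter_upwards [hae] with t ht; rw [ht])
  filter_upwards [hae] with t ht
  rw [ht, hz t]


lemma app_cont : Continuous (fun p : Rn (n-1) × ℝ => app (n := n) p.1 p.2) := by
  refine (PiLp.continuous_toLp 2 _).comp (continuous_pi fun j => ?_)
  by_cases h : (j:ℕ) < n - 1
  · simp only [h, dif_pos]; fun_prop
  · simp only [h, dif_neg, not_false_iff]; fun_prop

lemma restr_cont : Continuous (restr : Rn n → Rn (n-1)) := by
  refine (PiLp.continuous_toLp 2 _).comp (continuous_pi fun j => ?_)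
  fun_prop

/-- splitting off the last coordinate -/
def appE (ℓ : Fin n) (hℓ : (ℓ : ℕ) = n - 1) : Rn (n-1) × ℝ ≃ᵐ Rn n where
  toFun p := app p.1 p.2
  invFun ξ := (restr ξ, ξ ℓ)
  left_inv := by
    rintro ⟨x, t⟩
    refine Prod.ext ?_ (app_apply_last ℓ hℓ x t)
    refine PiLp.ext fun i => ?_
    show (if h : (i : ℕ) < n - 1 then _ else t) = _
    rw [dif_pos i.2]
    rfl
  right_inv := by
    intro ξ
    refine PiLp.ext fun j => ?_
    show (if h : (j : ℕ) < n - 1 then _ else ξ ℓ) = _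
    split_ifs with h
    · rfl
    · have : j = ℓ := by ext; omega
      rw [this]
  measurable_toFun := app_cont.measurable
  measurable_invFun := (restr_cont.prodMk (by fun_prop)).measurable

lemma appE_apply (ℓ : Fin n) (hℓ : (ℓ : ℕ) = n - 1) (p) : appE ℓ hℓ p = app p.1 p.2 := rfl

lemma appE_mp (ℓ : Fin n) (hℓ : (ℓ : ℕ) = n - 1) :
    MeasurePreserving (appE ℓ hℓ) (volume.prod volume) volume := by
  obtain ⟨m, rfl⟩ : ∃ m, n = m + 1 := ⟨n - 1, by have := ℓ.2; omega⟩
  have h1 := (EuclideanSpace.volume_preserving_symm_measurableEquiv_toLp (Fin m)).prod (MeasurePreserving.id (volume : Measure ℝ))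
  have h2 : MeasurePreserving (Prod.swap : (Fin m → ℝ) × ℝ → ℝ × (Fin m → ℝ)) (volume.prod volume) (volume.prod volume) :=
    Measure.measurePreserving_swap
  have h3 := (volume_preserving_piFinSuccAbove (fun _ : Fin (m+1) => ℝ) (Fin.last m)).symm
  have h4 := (EuclideanSpace.volume_preserving_symm_measurableEquiv_toLp (Fin (m+1))).symm
  have := h4.comp (h3.comp (h2.comp h1))
  have he : (appE ℓ hℓ : Rn (m+1-1) × ℝ → Rn (m+1)) = ((MeasurableEquiv.toLp 2 (Fin (m + 1) → ℝ)).symm.symm ∘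
      (MeasurableEquiv.piFinSuccAbove (fun x => ℝ) (Fin.last m)).symm ∘
        Prod.swap ∘ Prod.map ((MeasurableEquiv.toLp 2 (Fin m → ℝ)).symm) id) := ?_
  · rw [he]; exact this
  funext p
  refine PiLp.ext fun j => ?_
  show (if h : (j : ℕ) < m + 1 - 1 then p.1 ⟨j, h⟩ else p.2) = (Fin.last m).insertNth (α := fun _ => ℝ) p.2 p.1.ofLp j
  refine Fin.lastCases ?_ (fun i => ?_) j
  · simp
  · rw [dif_pos (by simp)]
    simp [Fin.insertNth_last']


abbrev sg (j : Fin n) : Rn n := EuclideanSpace.single j 1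

lemma inner_sg (x : Rn n) (j : Fin n) : inner ℝ x (sg j) = x j := by
  rw [EuclideanSpace.inner_single_right]; simp

/-- partial derivative on Schwartz functions -/
def sD (j : Fin n) (φ : 𝓢(Rn n, Lam n)) : 𝓢(Rn n, Lam n) := ∂_{sg j} φ
/-- coordinate multiplication on Schwartz functions -/
def sX (j : Fin n) (φ : 𝓢(Rn n, Lam n)) : 𝓢(Rn n, Lam n) :=
  SchwartzMap.smulLeftCLM (Lam n) (fun x : Rn n => inner ℝ x (sg j)) φ

lemma sD_apply (j : Fin n) (φ : 𝓢(Rn n, Lam n)) (x) : sD j φ x = pd j (fun y => φ y) x := rfl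
lemma sX_apply (j : Fin n) (φ : 𝓢(Rn n, Lam n)) (x) : sX j φ x = x j • φ x := by
  unfold sX
  rw [SchwartzMap.smulLeftCLM_apply_apply (by fun_prop)]
  rw [inner_sg]

/-- scaling equivalence -/
def scl : Rn n ≃L[ℝ] Rn n := ContinuousLinearEquiv.smulLeft (Units.mk0 ((2 * Real.pi)⁻¹ : ℝ) (by positivity))

lemma scl_apply (x : Rn n) : scl x = (2 * Real.pi)⁻¹ • x := rfl

/-- the inverse Fourier transform on Schwartz functions -/
def sF : 𝓢(Rn n, Lam n) →ₗ[ℂ] 𝓢(Rn n, Lam n) where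
  toFun φ := (((2 * Real.pi) ^ (-(n:ℝ)/2) : ℝ) : ℂ) • SchwartzMap.compCLMOfContinuousLinearEquiv ℂ scl (𝓕⁻ φ)
  map_add' := by intro a b; simp [FourierTransform.fourierInv_add]
  map_smul' := by intro c b; simp [FourierTransform.fourierInv_smul, smul_comm c]

lemma sF_apply (φ : 𝓢(Rn n, Lam n)) (ξ : Rn n) : sF φ ξ = ftInv (fun y => φ y) ξ := by
  show (((2 * Real.pi) ^ (-(n:ℝ)/2) : ℝ) : ℂ) • (𝓕⁻ φ) (scl ξ) = _
  unfold ftInv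
  rw [SchwartzMap.fourierInv_coe, Real.fourierInv_eq', Complex.coe_smul]
  congr 1
  refine integral_congr_ae (Filter.Eventually.of_forall fun x => ?_)
  beta_reduce
  congr 2
  have : inner ℝ x (scl ξ) = (2 * Real.pi)⁻¹ * ∑ j, x j * ξ j := by
    rw [scl_apply, inner_smul_right, PiLp.inner_apply]
    congr 1
    refine Finset.sum_congr rfl fun j _ => ?_
    simp [mul_comm]
  rw [this, ← mul_assoc, mul_inv_cancel₀ (by positivity), one_mul]

/-- Mathlib inverse Fourier transform -/
def sI (φ : 𝓢(Rn n, Lam n)) : 𝓢(Rn n, Lam n) := 𝓕⁻ φ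
/-- normalization -/
def cF (n : ℕ) : ℂ := (((2 * Real.pi) ^ (-(n:ℝ)/2) : ℝ) : ℂ)

lemma cF_ne : cF n ≠ 0 := by
  unfold cF
  rw [Complex.ofReal_ne_zero]; positivity

lemma sF_val (φ : 𝓢(Rn n, Lam n)) (ξ : Rn n) : sF φ ξ = cF n • sI φ (scl ξ) := rfl

lemma sI_D (j : Fin n) (φ : 𝓢(Rn n, Lam n)) : sI (sD j φ) = (-(2 * (Real.pi:ℂ) * Complex.I)) • sX j (sI φ) :=
  SchwartzMap.fourierInv_lineDerivOp_eq φ (sg j)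

lemma sI_X (j : Fin n) (φ : 𝓢(Rn n, Lam n)) : sD j (sI φ) = (2 * (Real.pi:ℂ) * Complex.I) • sI (sX j φ) := by
  have := SchwartzMap.lineDerivOp_fourierInv_eq φ (sg j)
  rw [FourierTransform.fourierInv_smul] at this
  exact this

lemma sF_surj (ψ : 𝓢(Rn n, Lam n)) : ∃ φ, sF φ = ψ := by
  let θ : 𝓢(Rn n, Lam n) := (cF n)⁻¹ • SchwartzMap.compCLMOfContinuousLinearEquiv ℂ scl.symm ψ
  refine ⟨𝓕 θ, ?_⟩
  ext1 ξ
  have h : sI (𝓕 θ) = θ := FourierTransform.fourierInv_fourier_eq θ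
  rw [sF_val, h]
  show cF n • (cF n)⁻¹ • ψ (scl.symm (scl ξ)) = _
  rw [smul_smul, mul_inv_cancel₀ cF_ne, one_smul, ContinuousLinearEquiv.symm_apply_apply]

lemma sF_D (j : Fin n) (φ : 𝓢(Rn n, Lam n)) : sF (sD j φ) = (-Complex.I) • sX j (sF φ) := by
  ext1 ξ
  rw [sF_val, sI_D, smul_apply, smul_apply, sX_apply, sX_apply, sF_val, scl_apply]
  simp only [PiLp.smul_apply, smul_eq_mul]
  rw [← Complex.coe_smul, ← Complex.coe_smul, smul_smul, smul_smul, smul_smul, smul_smul]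
  congr 1
  have : (Real.pi : ℂ) ≠ 0 := by exact_mod_cast Real.pi_ne_zero
  push_cast
  field_simp

lemma scl_deriv (u : Rn n → Lam n) (c : ℂ) (ξ v : Rn n) (hu : DifferentiableAt ℝ u (scl ξ)) :
    fderiv ℝ (fun y => c • u (scl y)) ξ v = c • ((2 * Real.pi)⁻¹ : ℝ) • fderiv ℝ u (scl ξ) v := by
  have h0 : HasFDerivAt (scl : Rn n → Rn n) (scl (n := n)).toContinuousLinearMap ξ := scl.hasFDerivAt
  have h1 : HasFDerivAt (fun y => u (scl y)) ((fderiv ℝ u (scl ξ)).comp (scl (n := n)).toContinuousLinearMap) ξ :=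
    hu.hasFDerivAt.comp ξ h0
  rw [fderiv_fun_const_smul h1.differentiableAt, h1.fderiv]
  have : (scl (n := n)).toContinuousLinearMap v = (2 * Real.pi)⁻¹ • v := rfl
  rw [smul_apply, ContinuousLinearMap.comp_apply, this, map_smul]

lemma sF_X (j : Fin n) (φ : 𝓢(Rn n, Lam n)) : sF (sX j φ) = (-Complex.I) • sD j (sF φ) := by
  ext1 ξ
  have hπ : (Real.pi : ℂ) ≠ 0 := by exact_mod_cast Real.pi_ne_zero
  have h1 : sD j (sF φ) ξ = cF n • ((2 * Real.pi)⁻¹ : ℝ) • sD j (sI φ) (scl ξ) := by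
    show fderiv ℝ (fun y => cF n • sI φ (scl y)) ξ (sg j) = _
    rw [scl_deriv (fun y => sI φ y) (cF n) ξ _ (sI φ).differentiableAt]
    rfl
  rw [smul_apply, h1, sI_X, sF_val, smul_apply]
  rw [← Complex.coe_smul, smul_smul, smul_smul, smul_smul]
  congr 1
  push_cast
  field_simp
  simp

lemma sF_L (L : Lam n →L[ℂ] Lam n) (φ : 𝓢(Rn n, Lam n)) :
    sF (φ.postcompCLM L) = (sF φ).postcompCLM L := by
  ext1 ξ
  rw [SchwartzMap.postcompCLM_apply, sF_apply, sF_apply]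
  unfold ftInv
  rw [← Complex.coe_smul, ← Complex.coe_smul, map_smul, ← L.integral_comp_comm]
  · simp
  · have := φ.integrable (μ := volume)
    refine this.mono ?_ (Filter.Eventually.of_forall fun x => ?_)
    · refine Continuous.aestronglyMeasurable ?_
      have := φ.continuous
      fun_prop
    · rw [norm_smul, Complex.norm_exp_ofReal_mul_I, one_mul]


/-- K_j -/
def Kj (ℓ j : Fin n) : Lam n →L[ℂ] Lam n :=
  (iotC (ee j)).comp (epsC (ee ℓ)) + (epsC (ee j)).comp (iotC (ee ℓ))
/-- N -/
def Nl (ℓ : Fin n) : Lam n →L[ℂ] Lam n := (epsC (ee ℓ)).comp (iotC (ee ℓ))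

/-- transpose operator on Schwartz functions -/
def sT (a : ℝ) (p : ℕ) (ℓ : Fin n) (φ : 𝓢(Rn n, Lam n)) : 𝓢(Rn n, Lam n) :=
  (∑ j, sD j (sD j (sX ℓ (sX ℓ φ)))) - (a:ℂ) • sD ℓ (sX ℓ φ)
  - (2:ℂ) • (∑ j ∈ univ.erase ℓ, (sX ℓ (sD j φ)).postcompCLM (Kj ℓ j))
  - (((n:ℝ) - 2*p : ℝ) : ℂ) • φ.postcompCLM (Nl ℓ)

lemma sT_apply (a : ℝ) (p : ℕ) (ℓ : Fin n) (φ : 𝓢(Rn n, Lam n)) (x : Rn n) :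
    sT a p ℓ φ x = DapT a p ℓ (fun y => φ y) x := by
  have e1 : (fun y => ((y ℓ)^2 : ℝ) • φ y) = fun y => sX ℓ (sX ℓ φ) y := by
    funext y; rw [sX_apply, sX_apply, smul_smul, sq]
  have e2 : (fun y => (y ℓ) • φ y) = fun y => sX ℓ φ y := by
    funext y; rw [sX_apply]
  have e3 : ∀ j x, pd j (fun y => φ y) x = sD j φ x := fun j x => rfl
  have e4 : ∀ j (ψ : 𝓢(Rn n, Lam n)), pd j (fun y => ψ y) = fun y => sD j ψ y := fun j ψ => rfl
  unfold DapT sT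
  rw [e1, e2]
  simp only [e4, sub_apply, smul_apply, _root_.sum_apply, SchwartzMap.postcompCLM_apply,
    Complex.coe_smul]
  congr 2
  rw [mul_smul, ← Complex.coe_smul (2:ℝ)]
  push_cast
  congr 1
  rw [Finset.smul_sum]
  refine Finset.sum_congr rfl fun j _ => ?_
  rw [sX_apply, rsm]
  rfl

/-- Fourier side of the transposed operator -/
def Lst (a : ℝ) (p : ℕ) (ℓ : Fin n) (ψ : Rn n → Lam n) (ξ : Rn n) : Lam n :=
  (‖ξ‖^2) • pd ℓ (pd ℓ ψ) ξ + (a * ξ ℓ) • pd ℓ ψ ξ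
  + (2:ℝ) • (∑ j ∈ univ.erase ℓ, ξ j • Kj ℓ j (pd ℓ ψ ξ)) - ((n:ℝ) - 2*p) • Nl ℓ (ψ ξ)

lemma sDX (ℓ j : Fin n) (hj : j ≠ ℓ) (ψ : 𝓢(Rn n, Lam n)) (ξ : Rn n) :
    sD ℓ (sX j ψ) ξ = ξ j • sD ℓ ψ ξ := by
  have h : (fun y => sX j ψ y) = fun y => y j • ψ y := by funext y; rw [sX_apply]
  rw [sD_apply, h]
  unfold pd
  have h1 : HasFDerivAt (fun y : Rn n => y j) (EuclideanSpace.proj j : Rn n →L[ℝ] ℝ) ξ :=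
    (EuclideanSpace.proj j : Rn n →L[ℝ] ℝ).hasFDerivAt
  rw [(h1.fun_smul ψ.differentiableAt.hasFDerivAt).fderiv]
  simp [hj]
  rfl

lemma sF_T (a : ℝ) (p : ℕ) (ℓ : Fin n) (φ : 𝓢(Rn n, Lam n)) (ξ : Rn n) :
    sF (sT a p ℓ φ) ξ = Lst a p ℓ (fun y => sF φ y) ξ := by
  have e3 : ∀ j (ψ : 𝓢(Rn n, Lam n)), pd j (fun y => ψ y) = fun y => sD j ψ y := fun j ψ => rfl
  have smX : ∀ j (c : ℂ) (ψ : 𝓢(Rn n, Lam n)), sX j (c • ψ) = c • sX j ψ := fun j c ψ => by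
    ext1 x; simp only [sX_apply, smul_apply]; rw [smul_comm]
  have smD : ∀ j (c : ℂ) (ψ : 𝓢(Rn n, Lam n)), sD j (c • ψ) = c • sD j ψ := fun j c ψ => by
    exact LineDeriv.lineDerivOp_smul _ c ψ
  have smP : ∀ (L : Lam n →L[ℂ] Lam n) (c : ℂ) (ψ : 𝓢(Rn n, Lam n)),
      (c • ψ).postcompCLM L = c • ψ.postcompCLM L := fun L c ψ => by
    ext1 x; simp [SchwartzMap.postcompCLM_apply]
  unfold sT Lst
  simp only [map_sub, map_sum, map_smul, sF_D, sF_X, sF_L, smX, smD, smP, e3]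
  have hI : ∀ ψ : 𝓢(Rn n, Lam n), (-Complex.I) • (-Complex.I) • ψ = -ψ := fun ψ => by
    rw [smul_smul]; simp
  simp only [hI, smul_neg, neg_neg, Finset.sum_neg_distrib]
  simp only [add_apply, sub_apply, neg_apply, smul_apply, _root_.sum_apply, SchwartzMap.postcompCLM_apply,
    Complex.coe_smul, sX_apply]
  rw [sub_neg_eq_add, sub_neg_eq_add, smul_smul a]
  congr 2
  · congr 1
    simp only [smul_smul]
    rw [← Finset.sum_smul, EuclideanSpace.real_norm_sq_eq]
    congr 1
    exact Finset.sum_congr rfl fun j _ => by ring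
  · rw [← Complex.coe_smul (2:ℝ)]
    push_cast
    congr 1
    refine Finset.sum_congr rfl fun j hj => ?_
    rw [sDX ℓ j (Finset.ne_of_mem_erase hj), rsm]

lemma weak_iff (a : ℝ) (p : ℕ) (ℓ : Fin n) (g : Rn n → Lam n) :
    WeakEig a p ℓ g 0 ↔ ∀ ψ : 𝓢(Rn n, Lam n), ∫ ξ, blin (g ξ) (Lst a p ℓ (fun y => ψ y) ξ) = 0 := by
  have key : ∀ φ : 𝓢(Rn n, Lam n), dpair g (fun x => DapT a p ℓ (fun y => φ y) x - (0:ℂ) • φ x)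
      = ∫ ξ, blin (g ξ) (Lst a p ℓ (fun y => sF φ y) ξ) := by
    intro φ
    have : (fun x => DapT a p ℓ (fun y => φ y) x - (0:ℂ) • φ x) = fun y => sT a p ℓ φ y := by
      funext x; rw [zero_smul, sub_zero, sT_apply]
    unfold dpair
    rw [this]
    simp only [← sF_apply, sF_T]
  constructor
  · intro h ψ
    obtain ⟨φ, rfl⟩ := sF_surj ψ
    rw [← key]; exact h φ
  · intro h φ
    rw [key]; exact h _



lemma app_add_sg (ℓ : Fin n) (hℓ : (ℓ : ℕ) = n - 1) (x : Rn (n-1)) (t u : ℝ) :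
    app x t + u • sg ℓ = app x (t + u) := by
  refine PiLp.ext fun j => ?_
  by_cases hj : j = ℓ
  · subst hj
    simp [app_apply_last j hℓ]
  · have h : (j : ℕ) < n - 1 := by
      have := j.2
      have : (j:ℕ) ≠ ℓ := fun h => hj (Fin.ext h)
      omega
    show app x t j + u * (sg ℓ : Rn n) j = app x (t+u) j
    simp [app, h, hj]

lemma app_zero (ℓ : Fin n) (hℓ : (ℓ : ℕ) = n - 1) (x : Rn (n-1)) (t : ℝ) :
    app x t = app x 0 + t • sg ℓ := by rw [app_add_sg ℓ hℓ]; simp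

lemma pd_line (ℓ : Fin n) (hℓ : (ℓ : ℕ) = n - 1) (ψ : Rn n → Lam n) (x : Rn (n-1)) (t : ℝ)
    (h : DifferentiableAt ℝ ψ (app x t)) : HasDerivAt (fun t => ψ (app x t)) (pd ℓ ψ (app x t)) t := by
  have h1 : HasDerivAt (fun t => app (n := n) x t) (sg ℓ) t := by
    have : (fun t => app (n := n) x t) = fun t => app x 0 + t • sg ℓ := funext fun t => app_zero ℓ hℓ x t
    rw [this]
    simpa using ((hasDerivAt_id t).smul_const (sg ℓ)).const_add (app x 0)
  exact h.hasFDerivAt.comp_hasDerivAt t h1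

lemma norm_app (x : Rn (n-1)) (hn : 1 ≤ n) (t s : ℝ) : ‖app (n := n) x t‖ ^ (2*s) = (‖x‖^2+t^2)^s := by
  rw [← app_sq (n := n) ⟨n-1, by omega⟩ rfl, Real.rpow_mul (norm_nonneg _)]
  norm_num

lemma blin_add_left (v w u : Lam n) : blin (v + w) u = blin v u + blin w u := by
  simp [blin, add_mul, Finset.sum_add_distrib]
lemma blin_add_right (v w u : Lam n) : blin v (w + u) = blin v w + blin v u := by
  simp [blin, mul_add, Finset.sum_add_distrib]
lemma blin_sub_right (v w u : Lam n) : blin v (w - u) = blin v w - blin v u := by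
  simp [blin, mul_sub, Finset.sum_sub_distrib]
lemma blin_rsmul_left (c : ℝ) (v w : Lam n) : blin (c • v) w = (c : ℂ) * blin v w := by
  simp [blin, Finset.mul_sum, mul_assoc]
lemma blin_rsmul_right (c : ℝ) (v w : Lam n) : blin v (c • w) = (c : ℂ) * blin v w := by
  simp only [blin, Finset.mul_sum]
  refine Finset.sum_congr rfl fun S _ => ?_
  simp; ring

lemma Lst_app (a : ℝ) (p : ℕ) (ℓ : Fin n) (hℓ : (ℓ : ℕ) = n - 1) (ψ : Rn n → Lam n) (x : Rn (n-1)) (t : ℝ) (v : Lam n) :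
    blin v (Lst a p ℓ ψ (app x t)) =
      blin ((‖x‖^2+t^2) • v) (pd ℓ (pd ℓ ψ) (app x t))
      + blin ((a*t) • v + (2:ℝ) • (iotC (ee ℓ) (epsC (rc (app x 0)) v) + epsC (ee ℓ) (iotC (rc (app x 0)) v)))
        (pd ℓ ψ (app x t))
      + blin ((-((n:ℝ) - 2*p)) • epsC (ee ℓ) (iotC (ee ℓ) v)) (ψ (app x t)) := by
  have hK : ∀ w : Lam n, ∑ j ∈ univ.erase ℓ, (app x t) j • Kj ℓ j w =
      iotC (rc (app x 0)) (epsC (ee ℓ) w) + epsC (rc (app x 0)) (iotC (ee ℓ) w) := by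
    intro w
    rw [iotC_expand, epsC_expand (rc (app x 0)), ← Finset.sum_add_distrib,
      ← Finset.add_sum_erase _ _ (Finset.mem_univ ℓ)]
    have : rc (app x 0) ℓ = 0 := by
      show ((app x 0 ℓ : ℝ) : ℂ) = 0
      rw [app_apply_last ℓ hℓ]; simp
    rw [this, zero_smul, zero_smul, zero_add, zero_add]
    refine Finset.sum_congr rfl fun j hj => ?_
    have hj' := Finset.ne_of_mem_erase hj
    have h : (j : ℕ) < n - 1 := by
      have := j.2
      have : (j:ℕ) ≠ ℓ := fun h => hj' (Fin.ext h)
      omega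
    have e : (app x t) j = (app x 0) j := by simp [app, h]
    rw [e, ← smul_add, ← Complex.coe_smul]
    rfl
  unfold Lst
  rw [hK, app_sq ℓ hℓ, app_apply_last ℓ hℓ]
  have e1 : ∀ w : Lam n, blin v (Nl ℓ w) = blin v (epsC (ee ℓ) (iotC (ee ℓ) w)) := fun w => rfl
  simp only [blin_sub_right, blin_add_right, blin_add_left, blin_rsmul_left, blin_rsmul_right, e1,
    blin_transpose, blin_transpose']
  push_cast
  ring

lemma int_rpow (s r : ℝ) (hs : 1/2 < s) (hr : 0 < r) : Integrable (fun t : ℝ => (r^2+t^2)^(-s)) := by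
  have h := integrable_rpow_neg_one_add_norm_sq (E := ℝ) (μ := volume) (r := 2*s) (by simp; linarith)
  have h2 := (h.comp_div hr.ne').const_mul ((r^2)^(-s))
  refine h2.congr (Filter.Eventually.of_forall fun t => ?_)
  beta_reduce
  rw [show -(2*s)/2 = -s by ring, ← Real.mul_rpow (by positivity) (by positivity)]
  congr 1
  simp only [Real.norm_eq_abs, sq_abs]; field_simp


/-- the fiber integrand -/
def Th (a : ℝ) (p : ℕ) (ℓ : Fin n) (χ : ℝ → ℝ) (q : Rn (n-1) × ℝ) (v : Lam n) : Lam n :=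
  deriv (deriv χ) q.2 • (‖q.1‖^2+q.2^2) • v +
    deriv χ q.2 • ((a*q.2) • v + (2:ℝ) • (iotC (ee ℓ) (epsC (rc (app q.1 0)) v) +
      epsC (ee ℓ) (iotC (rc (app q.1 0)) v))) + χ q.2 • (-((n:ℝ)-2*p)) • epsC (ee ℓ) (iotC (ee ℓ) v)

lemma Th_cont (a : ℝ) (p : ℕ) (ℓ : Fin n) {χ : ℝ → ℝ} (h : Tst χ) :
    Continuous (fun z : (Rn (n-1) × ℝ) × Lam n => Th a p ℓ χ z.1 z.2) := by
  have h0 := h.1.continuous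
  have h1 := h.der.1.continuous
  have h2 := h.der.der.1.continuous
  have ha : Continuous (fun z : (Rn (n-1) × ℝ) × Lam n => ((app z.1.1 0, z.2) : Rn n × Lam n)) :=
    Continuous.prodMk (app_cont.comp (by fun_prop : Continuous
      (fun z : (Rn (n-1) × ℝ) × Lam n => (z.1.1, (0:ℝ))))) (by fun_prop)
  have he := eps_cont.comp ha
  have hi := iot_cont.comp ha
  simp only [Function.comp_def] at he hi
  unfold Th
  fun_prop

lemma Th_smul (a : ℝ) (p : ℕ) (ℓ : Fin n) (χ : ℝ → ℝ) (q : Rn (n-1) × ℝ) (c : ℝ) (v : Lam n) :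
    Th a p ℓ χ q (c • v) = c • Th a p ℓ χ q v := by
  unfold Th
  simp only [rsm, smul_add, smul_comm c]

lemma lin_bound {X : Type*} [TopologicalSpace X] {K : Set X} (hK : IsCompact K) (Θ : X → Lam n → Lam n)
    (hc : Continuous (fun z : X × Lam n => Θ z.1 z.2)) (hs : ∀ q (c:ℝ) v, Θ q (c • v) = c • Θ q v) :
    ∃ C, ∀ q ∈ K, ∀ v, ‖Θ q v‖ ≤ C * ‖v‖ := by
  obtain ⟨C, hC⟩ := (hK.prod (isCompact_closedBall (0:Lam n) 1)).exists_bound_of_continuousOn hc.continuousOn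
  refine ⟨C, fun q hq v => ?_⟩
  rcases eq_or_ne v 0 with rfl | hv
  · have := hs q 0 0
    simp only [zero_smul] at this
    simp [this]
  · have h1 : v = ‖v‖ • (‖v‖⁻¹ • v) := by rw [smul_smul, mul_inv_cancel₀ (norm_ne_zero_iff.2 hv), one_smul]
    have h2 := hC (q, ‖v‖⁻¹ • v) ⟨hq, by simp [norm_smul, hv]⟩
    rw [h1, hs, norm_smul, ← h1, norm_norm, mul_comm]
    exact mul_le_mul_of_nonneg_right h2 (norm_nonneg _)

/-- weighted integrability transferred to the product -/
lemma prod_weight (ℓ : Fin n) (hℓ : (ℓ : ℕ) = n - 1) (s : ℝ) (p : ℕ) (g : Rn n → Lam n)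
    (hg : g ∈ Hdot n s p) : AEStronglyMeasurable (fun q : Rn (n-1) × ℝ => g (app q.1 q.2)) (volume.prod volume) ∧
    Integrable (fun q : Rn (n-1) × ℝ => (‖q.1‖^2+q.2^2)^s * ‖g (app q.1 q.2)‖^2) (volume.prod volume) := by
  have hn : 1 ≤ n := by have := ℓ.2; omega
  constructor
  · exact hg.1.comp_measurePreserving (appE_mp ℓ hℓ)
  · have := ((appE_mp ℓ hℓ).integrable_comp_emb (appE ℓ hℓ).measurableEmbedding).2 hg.2.2
    refine this.congr (Filter.Eventually.of_forall fun q => ?_)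
    simp only [Function.comp, appE_apply, norm_app q.1 hn]

lemma young (ρ s y : ℝ) (hρ : 0 < ρ) : y ≤ ρ^s * y^2 + ρ^(-s) := by
  rw [Real.rpow_neg hρ.le]
  have : 0 < ρ^s := Real.rpow_pos_of_pos hρ s
  set z := ρ^s
  rw [← sub_nonneg, show z*y^2+z⁻¹-y = z⁻¹ * ((z*y-1/2)^2+3/4) by field_simp; ring]
  positivity

lemma Hx_int (a : ℝ) (ℓ : Fin n) (hℓ : (ℓ : ℕ) = n - 1) (s : ℝ) (p : ℕ) (g : Rn n → Lam n)
    (hg : g ∈ Hdot n s p) {χ : ℝ → ℝ} (hχ : Tst χ) (K : Set (Rn (n-1))) (hK : IsCompact K)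
    (hK0 : ∀ x ∈ K, x ≠ 0) :
    IntegrableOn (fun q : Rn (n-1) × ℝ => Th a p ℓ χ q (g (app q.1 q.2))) (K ×ˢ Set.univ) (volume.prod volume) := by
  obtain ⟨hm, hw⟩ := prod_weight ℓ hℓ s p g hg
  obtain ⟨N, hN0, hN⟩ := Tst.bound hχ.2
  obtain ⟨N1, hN10, hN1⟩ := Tst.bound hχ.der.2
  obtain ⟨N2, hN20, hN2⟩ := Tst.bound hχ.der.der.2
  set B := max N (max N1 N2)
  have hKB : IsCompact (K ×ˢ Set.Icc (-B) B) := hK.prod isCompact_Icc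
  have hsub : IntegrableOn (fun q : Rn (n-1) × ℝ => Th a p ℓ χ q (g (app q.1 q.2))) (K ×ˢ Set.Icc (-B) B) (volume.prod volume) := by
    obtain ⟨C, hC⟩ := lin_bound hKB (fun q v => Th a p ℓ χ q v) (Th_cont a p ℓ hχ) (Th_smul a p ℓ χ)
    have hc : IntegrableOn (fun q : Rn (n-1) × ℝ => (‖q.1‖^2+q.2^2)^(-s)) (K ×ˢ Set.Icc (-B) B) (volume.prod volume) := by
      refine ContinuousOn.integrableOn_compact hKB (ContinuousOn.rpow_const (by fun_prop) fun q hq => Or.inl ?_)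
      have := norm_pos_iff.2 (hK0 _ hq.1)
      positivity
    refine Integrable.mono' ((hw.integrableOn.add hc).const_mul |C|) ?_ ?_
    · exact ((Th_cont a p ℓ hχ).comp_aestronglyMeasurable
        (aestronglyMeasurable_id.prodMk hm)).restrict
    · refine (ae_restrict_mem hKB.measurableSet).mono fun q hq => ?_
      refine (hC q hq _).trans ?_
      have := norm_pos_iff.2 (hK0 _ hq.1)
      have := young (‖q.1‖^2+q.2^2) s ‖g (app q.1 q.2)‖ (by positivity)
      exact mul_le_mul (le_abs_self C) this (norm_nonneg _) (abs_nonneg _)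
  refine hsub.of_forall_sdiff_eq_zero (hK.measurableSet.prod MeasurableSet.univ) ?_
  rintro q ⟨hq1, hq2⟩
  have : B ≤ |q.2| := by
    by_contra h
    exact hq2 ⟨hq1.1, abs_le.1 (not_le.1 h).le⟩
  have b0 := hN q.2 ((le_max_left _ _).trans this)
  have b1 := hN1 q.2 (((le_max_left _ _).trans (le_max_right _ _)).trans this)
  have b2 := hN2 q.2 (((le_max_right _ _).trans (le_max_right _ _)).trans this)
  simp only [Th, b0, b1, b2, zero_smul, add_zero]


lemma app_restr (ℓ : Fin n) (hℓ : (ℓ : ℕ) = n - 1) (ξ : Rn n) : app (restr ξ) (ξ ℓ) = ξ :=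
  (appE ℓ hℓ).right_inv ξ

lemma restr_app (ℓ : Fin n) (hℓ : (ℓ : ℕ) = n - 1) (x : Rn (n-1)) (t : ℝ) : restr (app x t) = x :=
  congrArg Prod.fst ((appE ℓ hℓ).left_inv (x, t))

/-- product test functions -/
def Ps (ℓ : Fin n) (η : Rn (n-1) → ℝ) (χ : ℝ → ℝ) (v : Lam n) (ξ : Rn n) : Lam n :=
  (η (restr ξ) * χ (ξ ℓ)) • v

lemma Ps_app (ℓ : Fin n) (hℓ : (ℓ : ℕ) = n - 1) (η : Rn (n-1) → ℝ) (χ : ℝ → ℝ) (v : Lam n) (x : Rn (n-1)) (t : ℝ) :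
    Ps ℓ η χ v (app x t) = (η x * χ t) • v := by
  unfold Ps; rw [restr_app ℓ hℓ, app_apply_last ℓ hℓ]

lemma Ps_smooth (ℓ : Fin n) (η : Rn (n-1) → ℝ) (χ : ℝ → ℝ) (v : Lam n) (hη : ContDiff ℝ ∞ η) (hχ : Tst χ) :
    ContDiff ℝ ∞ (Ps ℓ η χ v) := by
  have hr : ContDiff ℝ ∞ (restr : Rn n → Rn (n-1)) := by
    rw [contDiff_euclidean]
    intro i
    exact (EuclideanSpace.proj (Fin.castLE (Nat.sub_le n 1) i) : Rn n →L[ℝ] ℝ).contDiff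
  have h1 : ContDiff ℝ ∞ (fun ξ : Rn n => ξ ℓ) :=
    (EuclideanSpace.proj ℓ : Rn n →L[ℝ] ℝ).contDiff
  exact ((hη.comp hr).mul (hχ.1.comp h1)).smul contDiff_const

lemma Ps_cpt (ℓ : Fin n) (hℓ : (ℓ : ℕ) = n - 1) (η : Rn (n-1) → ℝ) (χ : ℝ → ℝ) (v : Lam n)
    (hη : HasCompactSupport η) (hχ : Tst χ) : HasCompactSupport (Ps ℓ η χ v) := by
  refine HasCompactSupport.intro ((hη.isCompact.prod hχ.2.isCompact).image app_cont) fun ξ hξ => ?_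
  by_contra hne
  refine hξ ⟨(restr ξ, ξ ℓ), ⟨subset_tsupport _ ?_, subset_tsupport _ ?_⟩, app_restr ℓ hℓ ξ⟩ <;>
  · intro h
    apply hne
    simp only at h
    simp [Ps, h]

lemma Ps_pd (ℓ : Fin n) (hℓ : (ℓ : ℕ) = n - 1) (η : Rn (n-1) → ℝ) (χ : ℝ → ℝ) (v : Lam n)
    (hη : ContDiff ℝ ∞ η) (hχ : Tst χ) : pd ℓ (Ps ℓ η χ v) = Ps ℓ η (deriv χ) v := by
  funext ξ
  rw [← app_restr ℓ hℓ ξ, Ps_app ℓ hℓ]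
  refine HasDerivAt.unique (pd_line ℓ hℓ _ _ _ ((Ps_smooth ℓ η χ v hη hχ).differentiable (by simp) _)) ?_
  simp only [Ps_app ℓ hℓ]
  exact ((hχ.hasDerivAt _).const_mul _).smul_const v

lemma fiber_test (a : ℝ) (ℓ : Fin n) (hℓ : (ℓ : ℕ) = n - 1) (s : ℝ) (p : ℕ) (g : Rn n → Lam n)
    (hg : g ∈ Hdot n s p) (hW : WeakEig a p ℓ g 0) {χ : ℝ → ℝ} (hχ : Tst χ) :
    ∀ᵐ x : Rn (n-1), x ≠ 0 → ∫ t, Th a p ℓ χ (x, t) (g (app x t)) = 0 := by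
  have hR : ∀ K : Set (Rn (n-1)), IsCompact K → (∀ x ∈ K, x ≠ 0) →
      Integrable (fun q : Rn (n-1) × ℝ => Th a p ℓ χ q (g (app q.1 q.2))) ((volume.restrict K).prod volume) := by
    intro K hK hK0
    have := Hx_int a ℓ hℓ s p g hg hχ K hK hK0
    rw [IntegrableOn, ← Measure.prod_restrict, Measure.restrict_univ] at this
    exact this
  refine (isOpen_compl_singleton (x := (0 : Rn (n-1)))).ae_eq_zero_of_integral_contDiff_smul_eq_zero
    (f := fun x => ∫ t, Th a p ℓ χ (x, t) (g (app x t))) ?_ ?_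
  · rw [locallyIntegrableOn_iff (isOpen_compl_singleton (x := (0 : Rn (n-1)))).isLocallyClosed]
    intro K hKs hK
    exact (hR K hK (fun x hx => hKs hx)).integral_prod_left
  · intro η hη hηc hηs
    have hi : Integrable (fun q : Rn (n-1) × ℝ => η q.1 • Th a p ℓ χ q (g (app q.1 q.2))) (volume.prod volume) := by
      have h1 := Hx_int a ℓ hℓ s p g hg hχ _ hηc.isCompact (fun x hx => hηs hx)
      obtain ⟨C, hC⟩ := hηc.exists_bound_of_continuous hη.continuous
      have h2 : IntegrableOn (fun q : Rn (n-1) × ℝ => η q.1 • Th a p ℓ χ q (g (app q.1 q.2))) (tsupport η ×ˢ Set.univ) (volume.prod volume) := by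
        refine Integrable.bdd_smul (φ := fun q : Rn (n-1) × ℝ => η q.1) h1 C ?_ (Filter.Eventually.of_forall fun q => hC q.1)
        exact (hη.continuous.comp continuous_fst).aestronglyMeasurable
      rw [← integrableOn_univ]
      refine h2.of_forall_sdiff_eq_zero MeasurableSet.univ ?_
      rintro q ⟨_, hq⟩
      have : η q.1 = 0 := by
        by_contra h
        exact hq ⟨subset_tsupport _ h, trivial⟩
      rw [this, zero_smul]
    have e1 : ∫ x, η x • ∫ t, Th a p ℓ χ (x, t) (g (app x t)) =
        ∫ q : Rn (n-1) × ℝ, η q.1 • Th a p ℓ χ q (g (app q.1 q.2)) ∂(volume.prod volume) := by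
      rw [integral_prod _ hi]
      refine integral_congr_ae (Filter.Eventually.of_forall fun x => ?_)
      simp only [integral_smul]
    rw [e1]
    refine PiLp.ext fun S => ?_
    have e2 : ∀ w : Lam n, w S = blinC.flip (EuclideanSpace.single S 1) w := by
      intro w
      simp [blinC_apply, blin]
    rw [e2, ← ContinuousLinearMap.integral_comp_comm _ hi]
    set v : Lam n := EuclideanSpace.single S 1
    have hps := (weak_iff a p ℓ g).1 hW ((Ps_cpt ℓ hℓ η χ v hηc hχ).toSchwartzMap (Ps_smooth ℓ η χ v hη hχ))
    rw [← (appE_mp ℓ hℓ).integral_comp' ] at hps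
    refine Eq.trans (integral_congr_ae (Filter.Eventually.of_forall fun q => ?_)) hps
    simp only [appE_apply]
    have e3 : (fun y => ((Ps_cpt ℓ hℓ η χ v hηc hχ).toSchwartzMap (Ps_smooth ℓ η χ v hη hχ)) y) = Ps ℓ η χ v := rfl
    rw [e3, Lst_app a p ℓ hℓ, Ps_pd ℓ hℓ η χ v hη hχ, Ps_pd ℓ hℓ η _ v hη hχ.der]
    simp only [Ps_app ℓ hℓ]
    show blin (η q.1 • Th a p ℓ χ q (g (app q.1 q.2))) v = _
    simp only [Th, blin_rsmul_left, blin_add_left, blin_rsmul_right]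
    push_cast
    ring

lemma fiber_weak (ℓ : Fin n) (hℓ : (ℓ : ℕ) = n - 1) (hn : 2 ≤ n) (s : ℝ) (hs : 1/2 < s) (p : ℕ) (g : Rn n → Lam n)
    (hg : g ∈ Hdot n s p) (hW : WeakEig (2-2*s) p ℓ g 0) :
    ∀ᵐ x : Rn (n-1), x ≠ 0 ∧ Integrable (fun t => g (app x t)) ∧
      Integrable (fun t => (‖x‖^2+t^2)^s * ‖g (app x t)‖^2) ∧
      ∀ χ, Tst χ → ∫ t, Th (2-2*s) p ℓ χ (x, t) (g (app x t)) = 0 := by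
  obtain ⟨D, hDc, hD, hDa⟩ := tests_countable
  obtain ⟨hm, hw⟩ := prod_weight ℓ hℓ s p g hg
  have : NeZero (n-1) := ⟨by omega⟩
  have h0 : ∀ᵐ x : Rn (n-1), x ≠ 0 := by
    have : Nontrivial (Rn (n-1)) := ⟨0, EuclideanSpace.single 0 1, fun h => by
      have := congrArg (fun v : Rn (n-1) => v 0) h
      simp at this⟩
    exact Measure.ae_ne volume 0
  have h1 : ∀ᵐ x : Rn (n-1), ∀ χ ∈ D, x ≠ 0 → ∫ t, Th (2-2*s) p ℓ χ (x, t) (g (app x t)) = 0 := by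
    rw [ae_ball_iff hDc]
    exact fun χ hχ => fiber_test (2-2*s) ℓ hℓ s p g hg hW (hD χ hχ)
  filter_upwards [h0, h1, hw.prod_right_ae, hm.prodMk_left] with x hx0 hx1 hx2 hx3
  have hr : 0 < ‖x‖ := norm_pos_iff.2 hx0
  have hG : Integrable (fun t => g (app x t)) := by
    refine Integrable.mono' (hx2.add (int_rpow s ‖x‖ hs hr)) hx3 (Filter.Eventually.of_forall fun t => ?_)
    exact young (‖x‖^2+t^2) s _ (by positivity)
  refine ⟨hx0, hG, hx2, ?_⟩
  have hcs : ∀ φ : ℝ → ℝ, Continuous φ → LocallyIntegrable (fun t => φ t • g (app x t)) := by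
    intro φ hφ
    have := hG.locallyIntegrable
    rw [locallyIntegrable_iff] at this ⊢
    intro K hK
    exact (this K hK).continuousOn_smul hφ.continuousOn hK
  refine hDa (fun t => (‖x‖^2+t^2) • g (app x t)) (fun t => ((2-2*s)*t) • g (app x t) +
    (2:ℝ) • (iotC (ee ℓ) (epsC (rc (app x 0)) (g (app x t))) +
      epsC (ee ℓ) (iotC (rc (app x 0)) (g (app x t)))))
    (fun t => (-((n:ℝ)-2*p)) • epsC (ee ℓ) (iotC (ee ℓ) (g (app x t)))) (hcs _ (by fun_prop)) ?_ ?_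
    fun χ hχ => hx1 χ hχ hx0
  · refine (hcs _ (by fun_prop)).add (Integrable.locallyIntegrable ?_)
    refine (Integrable.add ?_ ?_).smul (2:ℝ)
    · exact ((iotC (ee ℓ)).comp (epsC (rc (app x 0)))).integrable_comp hG
    · exact ((epsC (ee ℓ)).comp (iotC (rc (app x 0)))).integrable_comp hG
  · refine Integrable.locallyIntegrable (Integrable.fun_smul _ ?_)
    exact ((epsC (ee ℓ)).comp (iotC (ee ℓ))).integrable_comp hG


lemma Th_sub (a : ℝ) (p : ℕ) (ℓ : Fin n) (χ : ℝ → ℝ) (q : Rn (n-1) × ℝ) (v w : Lam n) :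
    Th a p ℓ χ q (v - w) = Th a p ℓ χ q v - Th a p ℓ χ q w := by
  unfold Th
  simp only [map_sub, smul_sub, smul_add]
  abel

lemma Th_int (a : ℝ) (p : ℕ) (ℓ : Fin n) {χ : ℝ → ℝ} (hχ : Tst χ) (x : Rn (n-1)) (G : ℝ → Lam n)
    (hG : Integrable G) : Integrable (fun t => Th a p ℓ χ (x, t) (G t)) := by
  obtain ⟨N, hN0, hN⟩ := Tst.bound hχ.2
  obtain ⟨N1, hN10, hN1⟩ := Tst.bound hχ.der.2
  obtain ⟨N2, hN20, hN2⟩ := Tst.bound hχ.der.der.2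
  set B := max N (max N1 N2)
  have hKB : IsCompact (({x} : Set (Rn (n-1))) ×ˢ Set.Icc (-B) B) := isCompact_singleton.prod isCompact_Icc
  obtain ⟨C, hC⟩ := lin_bound hKB (fun q v => Th a p ℓ χ q v) (Th_cont a p ℓ hχ) (Th_smul a p ℓ χ)
  refine Integrable.mono' (hG.norm.const_mul |C|) ?_ (Filter.Eventually.of_forall fun t => ?_)
  · have h1 : AEStronglyMeasurable (fun t : ℝ => (((x, t) : Rn (n-1) × ℝ), G t)) volume :=
      (by fun_prop : Continuous (fun t : ℝ => ((x, t) : Rn (n-1) × ℝ))).aestronglyMeasurable.prodMk hG.1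
    have h2 := Continuous.comp_aestronglyMeasurable
      (g := fun z : (Rn (n-1) × ℝ) × Lam n => Th a p ℓ χ z.1 z.2) (Th_cont a p ℓ hχ) h1
    exact h2
  · by_cases h : |t| ≤ B
    · exact (hC (x, t) ⟨rfl, abs_le.1 h⟩ _).trans (mul_le_mul_of_nonneg_right (le_abs_self C) (norm_nonneg _))
    · have : B ≤ |t| := (not_le.1 h).le
      have b0 := hN t ((le_max_left _ _).trans this)
      have b1 := hN1 t (((le_max_left _ _).trans (le_max_right _ _)).trans this)
      have b2 := hN2 t (((le_max_right _ _).trans (le_max_right _ _)).trans this)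
      simp only [Th, b0, b1, b2, zero_smul, add_zero, norm_zero]
      positivity

lemma ae_of_fibers (ℓ : Fin n) (hℓ : (ℓ : ℕ) = n - 1) (h : Rn n → Lam n) (hm : AEStronglyMeasurable h volume)
    (h0 : ∀ᵐ x : Rn (n-1), ∀ᵐ t : ℝ, h (app x t) = 0) : ∀ᵐ ξ, h ξ = 0 := by
  obtain ⟨m, hm0, h1⟩ := hm
  have hms : MeasurableSet {ξ | m ξ = 0} := hm0.measurable (measurableSet_singleton 0)
  have h2 : ∀ᵐ ξ, m ξ = 0 := by
    rw [← (appE_mp ℓ hℓ).map_eq, (appE ℓ hℓ).measurableEmbedding.ae_map_iff]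
    refine (Measure.ae_prod_iff_ae_ae (p := fun q => m (appE ℓ hℓ q) = 0) ((appE ℓ hℓ).measurable hms)).2 ?_
    have h3 := h1
    rw [Filter.EventuallyEq, ← (appE_mp ℓ hℓ).map_eq, (appE ℓ hℓ).measurableEmbedding.ae_map_iff] at h3
    filter_upwards [h0, Measure.ae_ae_of_ae_prod h3] with x hx hx2
    filter_upwards [hx, hx2] with t ht ht2
    exact ht2.symm.trans ht
  filter_upwards [h1, h2] with ξ a b
  exact a.trans b

lemma uniq (ℓ : Fin n) (hℓ : (ℓ : ℕ) = n - 1) (hn : 2 ≤ n) (s : ℝ) (hs : 1/2 < s) (p : ℕ)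
    (hκ : 2*s < (n:ℝ)-2*p) (g g' : Rn n → Lam n)
    (hg : g ∈ Hdot n s p) (hW : WeakEig (2-2*s) p ℓ g 0)
    (hg' : g' ∈ Hdot n s p) (hW' : WeakEig (2-2*s) p ℓ g' 0)
    (ht : ∀ᵐ x : Rn (n-1), ftrace g' x = ftrace g x) : ∀ᵐ ξ, g' ξ = g ξ := by
  have key : ∀ᵐ ξ, (g' - g) ξ = 0 := by
    refine ae_of_fibers ℓ hℓ _ (hg'.1.sub hg.1) ?_
    filter_upwards [ht, fiber_weak ℓ hℓ hn s hs p g hg hW, fiber_weak ℓ hℓ hn s hs p g' hg' hW'] with x hx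
      ⟨hx0, hi, hw, hT⟩ ⟨_, hi', hw', hT'⟩
    have hr : 0 < ‖x‖ := norm_pos_iff.2 hx0
    refine fiber_unique (cliff ℓ hℓ x) hr s _ hs hκ (fun t => g' (app x t) - g (app x t)) (hi'.sub hi) ?_ ?_ ?_
    · refine ((hw'.add hw).const_mul 2).mono' ?_ (Filter.Eventually.of_forall fun t => ?_)
      · refine AEStronglyMeasurable.mul (Continuous.aestronglyMeasurable ?_) ((hi'.sub hi).1.norm.pow 2)
        exact Continuous.rpow_const (by fun_prop) fun t => Or.inl (by positivity)
      · have hp : 0 ≤ (‖x‖^2+t^2)^s := by positivity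
        rw [Real.norm_of_nonneg (by positivity)]
        simp only [Pi.add_apply]
        have h1 := norm_sub_le (g' (app x t)) (g (app x t))
        have h2 : ‖g' (app x t) - g (app x t)‖^2 ≤ 2*(‖g' (app x t)‖^2 + ‖g (app x t)‖^2) := by
          have := norm_nonneg (g' (app x t) - g (app x t))
          nlinarith [sq_nonneg (‖g' (app x t)‖ - ‖g (app x t)‖)]
        calc _ ≤ (‖x‖^2+t^2)^s * (2*(‖g' (app x t)‖^2 + ‖g (app x t)‖^2)) := mul_le_mul_of_nonneg_left h2 hp
          _ = _ := by ring
    · intro χ hχ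
      have : ∫ t, Th (2-2*s) p ℓ χ (x, t) (g' (app x t) - g (app x t)) = 0 := by
        simp only [Th_sub]
        rw [integral_sub (Th_int _ p ℓ hχ x _ hi') (Th_int _ p ℓ hχ x _ hi), hT χ hχ, hT' χ hχ, sub_zero]
      exact this
    · have e1 : ∀ v : Lam n, iotC (ee ℓ) (epsC (ee ℓ) v) = incC (projC v) := fun v => (incL_projL ℓ hℓ v).symm
      simp only [e1, map_sub]
      have j1 : Integrable (fun t => projC (g (app x t))) := projC.integrable_comp hi
      have j2 : Integrable (fun t => projC (g' (app x t))) := projC.integrable_comp hi'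
      rw [integral_sub (incC.integrable_comp j2) (incC.integrable_comp j1),
        incC.integral_comp_comm j1, incC.integral_comp_comm j2]
      unfold ftrace at hx
      have hc : ((2 * Real.pi) ^ (-(1:ℝ)/2) : ℝ) ≠ 0 := (Real.rpow_pos_of_pos (by positivity) _).ne'
      have := smul_right_injective _ hc hx
      simp only [projC_apply, this, sub_self]
  filter_upwards [key] with ξ h
  exact sub_eq_zero.1 h


/-- the explicit solution on a fiber -/
def Gs (s κ r c₁ c₂ : ℝ) (F₁ F₂ z : Lam n) (t : ℝ) : Lam n :=
  (c₁ * (r^2+t^2)^(-s)) • F₁ +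
  ((c₂ * ((κ/2-s)*t^2+(κ/2+s)*r^2) * ((r^2+t^2)^(-s) * (r^2+t^2)⁻¹)) • F₂ +
  (c₂ * (2*s*r^2*t) * ((r^2+t^2)^(-s) * (r^2+t^2)⁻¹)) • z)

lemma fib_alg {e i E I : Lam n →L[ℂ] Lam n} {r : ℝ} (hC : Cliff e i E I r) (F : Lam n) (hF : i F = 0) :
    (i (E (I (E F))) + e (I (I (E F))) = 0) ∧
    (i (E (E (I F))) + e (I (E (I F))) = (r^2) • e (I F)) ∧
    (i (E (e (I F))) + e (I (e (I F))) = -(E (I F))) ∧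
    (e (i (I (E F))) = 0) ∧ (e (i (E (I F))) = 0) ∧ (e (i (e (I F))) = e (I F)) := by
  have h1 : i (E F) = 0 := by
    have := hC.Ei F
    rw [hF, map_zero] at this
    exact neg_eq_zero.1 this.symm
  have h2 : i (I F) = 0 := by
    have := hC.Ii F
    rw [hF, map_zero] at this
    exact neg_eq_zero.1 this.symm
  have h3 : i (E (I F)) = 0 := by
    have := hC.Ei (I F)
    rw [h2, map_zero] at this
    exact neg_eq_zero.1 this.symm
  have h4 : i (I (E F)) = 0 := by
    have := hC.Ii (E F)
    rw [h1, map_zero] at this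
    exact neg_eq_zero.1 this.symm
  refine ⟨?_, ?_, ?_, ?_, ?_, ?_⟩
  · rw [hC.II, hC.IE, map_sub, hC.EE, map_smul, map_sub, map_smul, h1]; simp
  · rw [hC.EE, hC.IE, hC.II, map_zero, map_zero, zero_add, sub_zero, map_smul, Complex.coe_smul]
  · rw [hC.Ie, hC.II, hC.Ee, map_neg, hC.ie, h3]; simp
  · rw [h4, map_zero]
  · rw [h3, map_zero]
  · rw [hC.ie, h2]; simp

lemma Gs_der1 (s κ r c₁ c₂ : ℝ) (hr : 0 < r) (F₁ F₂ z : Lam n) (t : ℝ) :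
    HasDerivAt (fun t => (r^2+t^2) • Gs s κ r c₁ c₂ F₁ F₂ z t)
      ((-(c₂ * κ * r^2 * (r^2+t^2)^(-s))) • z + (((2-2*s)*t) • Gs s κ r c₁ c₂ F₁ F₂ z t +
        (2:ℝ) • ((c₂ * ((κ/2-s)*t^2+(κ/2+s)*r^2) * ((r^2+t^2)^(-s) * (r^2+t^2)⁻¹)) • ((r^2) • z) +
          (c₂ * (2*s*r^2*t) * ((r^2+t^2)^(-s) * (r^2+t^2)⁻¹)) • (-F₂)))) t := by
  have hp := hasDerivAt_Rpow r (-s) t hr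
  have hsq : HasDerivAt (fun t : ℝ => t^2) (2*t) t := by simpa using hasDerivAt_pow 2 t
  have e : (fun t => (r^2+t^2) • Gs s κ r c₁ c₂ F₁ F₂ z t) = fun t =>
      (c₁ * ((r^2+t^2) * (r^2+t^2)^(-s))) • F₁ +
      ((c₂ * (((κ/2-s)*t^2+(κ/2+s)*r^2) * (r^2+t^2)^(-s))) • F₂ +
      (c₂ * (2*s*r^2) * (t * (r^2+t^2)^(-s))) • z) := by
    funext t
    have hR : r^2+t^2 ≠ 0 := by positivity
    simp only [Gs, smul_add, smul_smul]
    generalize (r^2+t^2)^(-s) = P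
    match_scalars <;> field_simp
  rw [e]
  have d1 := (((hsq.const_add (r^2)).mul hp).const_mul c₁).smul_const F₁
  have d2 := (((hsq.const_mul (κ/2-s)).add_const ((κ/2+s)*r^2)).mul hp |>.const_mul c₂).smul_const F₂
  have d3 := (((hasDerivAt_id' t).mul hp).const_mul (c₂*(2*s*r^2))).smul_const z
  refine (d1.add (d2.add d3)).congr_deriv ?_
  have hR : r^2+t^2 ≠ 0 := by positivity
  simp only [Gs, smul_add, smul_smul, smul_neg, ← neg_smul]
  generalize (r^2+t^2)^(-s) = P
  match_scalars <;> field_simp <;> ring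

lemma Gs_der2 (s κ r c₁ c₂ : ℝ) (hr : 0 < r) (z : Lam n) (t : ℝ) :
    HasDerivAt (fun t => (-(c₂ * κ * r^2 * (r^2+t^2)^(-s))) • z)
      (κ • (c₂ * (2*s*r^2*t) * ((r^2+t^2)^(-s) * (r^2+t^2)⁻¹)) • z) t := by
  have hp := hasDerivAt_Rpow r (-s) t hr
  refine (((hp.const_mul (c₂*κ*r^2)).neg).smul_const z).congr_deriv ?_
  rw [smul_smul]
  congr 1; ring


lemma blin_der {u w : ℝ → Lam n} {u' w' : Lam n} {t : ℝ} (hu : HasDerivAt u u' t) (hw : HasDerivAt w w' t) :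
    HasDerivAt (fun t => blin (u t) (w t)) (blin u' (w t) + blin (u t) w') t := by
  unfold blin
  rw [← Finset.sum_add_distrib]
  exact HasDerivAt.fun_sum fun S _ => (coord_hasDeriv S hu).mul (coord_hasDeriv S hw)

lemma blin_norm (v w : Lam n) : ‖blin v w‖ ≤ ‖(blinC : Lam n →L[ℂ] Lam n →L[ℂ] ℂ)‖ * ‖v‖ * ‖w‖ := by
  rw [← blinC_apply]
  exact blinC.le_opNorm₂ v w

lemma schw_line (ℓ : Fin n) (hℓ : (ℓ : ℕ) = n - 1) (ψ : 𝓢(Rn n, Lam n)) (x : Rn (n-1)) (hx : x ≠ 0) :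
    ∃ C, 0 < C ∧ ∀ t : ℝ, ‖ψ (app x t)‖ ≤ C * ((‖x‖^2+t^2)⁻¹)^2 := by
  obtain ⟨C, hC0, hC⟩ := ψ.decay 4 0
  refine ⟨C, hC0, fun t => ?_⟩
  have h := hC (app x t)
  rw [norm_iteratedFDeriv_zero, show ‖app x t‖^4 = (‖app x t‖^2)^2 by ring, app_sq ℓ hℓ] at h
  have : 0 < ‖x‖ := norm_pos_iff.2 hx
  rw [inv_pow, ← div_eq_mul_inv, le_div_iff₀ (by positivity)]
  linarith

lemma rho_neg_le (s r t : ℝ) (hs : 0 ≤ s) (hr : 0 < r) : (r^2+t^2)^(-s) ≤ (r^2)^(-s) :=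
  Real.rpow_le_rpow_of_nonpos (by positivity) (by nlinarith [sq_nonneg t]) (by linarith)

/-- scalar bounds for the coefficients of the solution -/
lemma coef_bound (s κ r t : ℝ) (hs : 1/2 < s) (hκ : 2*s < κ) (hr : 0 < r) :
    |((κ/2-s)*t^2+(κ/2+s)*r^2) * ((r^2+t^2)^(-s) * (r^2+t^2)⁻¹)| ≤ κ * (r^2+t^2)^(-s) ∧
    |(2*s*r^2*t) * ((r^2+t^2)^(-s) * (r^2+t^2)⁻¹)| ≤ (κ * r) * (r^2+t^2)^(-s) := by
  have hP : 0 < (r^2+t^2)^(-s) := Real.rpow_pos_of_pos (by positivity) _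
  have hR : 0 < r^2+t^2 := by positivity
  generalize (r^2+t^2)^(-s) = P at *
  have h1 : 0 < κ/2-s := by linarith
  constructor
  · rw [abs_of_nonneg (mul_nonneg (add_nonneg (mul_nonneg h1.le (sq_nonneg t))
      (mul_nonneg (by linarith) (sq_nonneg r))) (by positivity)), show ((κ/2-s)*t^2+(κ/2+s)*r^2) * (P * (r^2+t^2)⁻¹) =
      (((κ/2-s)*t^2+(κ/2+s)*r^2) / (r^2+t^2)) * P by field_simp]
    refine mul_le_mul_of_nonneg_right ?_ hP.le
    rw [div_le_iff₀ hR]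
    nlinarith [sq_nonneg t, sq_nonneg r]
  · rw [show (2*s*r^2*t) * (P * (r^2+t^2)⁻¹) = (2*s*r^2*t / (r^2+t^2)) * P by field_simp, abs_mul, abs_of_pos hP]
    refine mul_le_mul_of_nonneg_right ?_ hP.le
    rw [abs_div, abs_of_pos hR, div_le_iff₀ hR, abs_mul, abs_of_pos (by positivity : 0 < 2*s*r^2)]
    have h2 : 2*(r*|t|) ≤ r^2+t^2 := by nlinarith [sq_nonneg (r-|t|), sq_abs t]
    have h3 : 0 ≤ r * |t| := by positivity
    have h4 : 2*s*(r*|t|) ≤ κ * (r^2+t^2) := by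
      calc 2*s*(r*|t|) ≤ κ*(r*|t|) := by nlinarith
        _ ≤ κ * (r^2+t^2) := by
          apply mul_le_mul_of_nonneg_left _ (by linarith); linarith
    nlinarith

lemma Gs_bound (s κ r c₁ c₂ : ℝ) (hs : 1/2 < s) (hκ : 2*s < κ) (hr : 0 < r) (F₁ F₂ z : Lam n) (t : ℝ) :
    ‖Gs s κ r c₁ c₂ F₁ F₂ z t‖ ≤ (|c₁| * ‖F₁‖ + |c₂| * κ * ‖F₂‖ + |c₂| * (κ * r) * ‖z‖) * (r^2+t^2)^(-s) := by
  obtain ⟨h1, h2⟩ := coef_bound s κ r t hs hκ hr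
  have hP : 0 < (r^2+t^2)^(-s) := Real.rpow_pos_of_pos (by positivity) _
  unfold Gs
  rw [mul_assoc c₂, mul_assoc c₂]
  refine (norm_add_le _ _).trans ?_
  have := norm_add_le ((c₂ * (((κ/2-s)*t^2+(κ/2+s)*r^2) * ((r^2+t^2)^(-s) * (r^2+t^2)⁻¹))) • F₂)
    ((c₂ * ((2*s*r^2*t) * ((r^2+t^2)^(-s) * (r^2+t^2)⁻¹))) • z)
  simp only [norm_smul, Real.norm_eq_abs, abs_mul c₂] at this ⊢
  rw [abs_mul c₁, abs_of_pos hP]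
  have k1 := mul_le_mul_of_nonneg_right (mul_le_mul_of_nonneg_left h1 (abs_nonneg c₂)) (norm_nonneg F₂)
  have k2 := mul_le_mul_of_nonneg_right (mul_le_mul_of_nonneg_left h2 (abs_nonneg c₂)) (norm_nonneg z)
  linarith

lemma fib_sol_zero (ℓ : Fin n) (hℓ : (ℓ : ℕ) = n - 1) (s : ℝ) (hs : 1/2 < s) (p : ℕ)
    (hκ : 2*s < (n:ℝ)-2*p) (x : Rn (n-1)) (hx : x ≠ 0) (c₁ c₂ : ℝ) (F : Lam n) (hF : iotC (ee ℓ) F = 0)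
    (ψ : 𝓢(Rn n, Lam n)) :
    ∫ t, blin (Gs s ((n:ℝ)-2*p) ‖x‖ c₁ c₂ (iotC (rc (app x 0)) (epsC (rc (app x 0)) F))
      (epsC (rc (app x 0)) (iotC (rc (app x 0)) F)) (epsC (ee ℓ) (iotC (rc (app x 0)) F)) t)
      (Lst (2-2*s) p ℓ (fun y => ψ y) (app x t)) = 0 := by
  have hr : 0 < ‖x‖ := norm_pos_iff.2 hx
  obtain ⟨m1, m2, m3, n1, n2, n3⟩ := fib_alg (cliff ℓ hℓ x) F hF
  set κ := (n:ℝ)-2*p with hκd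
  set r := ‖x‖ with hrd
  set e := (epsC (ee ℓ) : Lam n →L[ℂ] Lam n)
  set i := (iotC (ee ℓ) : Lam n →L[ℂ] Lam n)
  set E := (epsC (rc (app x 0)) : Lam n →L[ℂ] Lam n)
  set I := (iotC (rc (app x 0)) : Lam n →L[ℂ] Lam n)
  set G := Gs s κ r c₁ c₂ (I (E F)) (E (I F)) (e (I F)) with hG
  set z := e (I F)
  set Φ : ℝ → ℂ := fun t => blin ((r^2+t^2) • G t) (pd ℓ (fun y => ψ y) (app x t)) -
    blin ((-(c₂ * κ * r^2 * (r^2+t^2)^(-s))) • z) (ψ (app x t)) with hΦ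
  have hNG : ∀ t, e (i (G t)) = (c₂ * (2*s*r^2*t) * ((r^2+t^2)^(-s) * (r^2+t^2)⁻¹)) • z := by
    intro t
    simp only [hG, Gs, map_add, rsm, n1, n2, n3, smul_zero, zero_add]
  have hMG : ∀ t, i (E (G t)) + e (I (G t)) =
      (c₂ * ((κ/2-s)*t^2+(κ/2+s)*r^2) * ((r^2+t^2)^(-s) * (r^2+t^2)⁻¹)) • ((r^2) • z) +
          (c₂ * (2*s*r^2*t) * ((r^2+t^2)^(-s) * (r^2+t^2)⁻¹)) • (-(E (I F))) := by
    intro t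
    rw [← m2, ← m3]
    have m1' : ∀ c : ℝ, c • i (E (I (E F))) + c • e (I (I (E F))) = 0 := by
      intro c; rw [← smul_add, m1, smul_zero]
    have := m1' (c₁ * (r^2+t^2)^(-s))
    simp only [hG, Gs, map_add, rsm, smul_add]
    rw [add_add_add_comm, this, zero_add]
    abel
  have hder : ∀ t, HasDerivAt Φ (blin (G t) (Lst (2-2*s) p ℓ (fun y => ψ y) (app x t))) t := by
    intro t
    have hp0 := pd_line ℓ hℓ (fun y => ψ y) x t ψ.differentiableAt
    have hp1 : HasDerivAt (fun t => pd ℓ (fun y => ψ y) (app x t)) (pd ℓ (pd ℓ (fun y => ψ y)) (app x t)) t := by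
      have : pd ℓ (fun y => ψ y) = fun y => sD ℓ ψ y := by funext y; rw [sD_apply]
      rw [this]
      exact pd_line ℓ hℓ (fun y => sD ℓ ψ y) x t (sD ℓ ψ).differentiableAt
    refine ((blin_der (Gs_der1 s κ r c₁ c₂ hr (I (E F)) (E (I F)) z t) hp1).sub
      (blin_der (Gs_der2 s κ r c₁ c₂ hr z t) hp0)).congr_deriv ?_
    rw [Lst_app _ p ℓ hℓ]
    show _ = blin ((r^2+t^2) • G t) _ + blin (((2-2*s)*t) • G t + (2:ℝ) • (i (E (G t)) + e (I (G t)))) _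
      + blin ((-κ) • e (i (G t))) _
    rw [hMG, hNG, ← hG]
    generalize (c₂ * ((κ/2-s)*t^2+(κ/2+s)*r^2) * ((r^2+t^2)^(-s) * (r^2+t^2)⁻¹)) • ((r^2) • z) +
          (c₂ * (2*s*r^2*t) * ((r^2+t^2)^(-s) * (r^2+t^2)⁻¹)) • (-(E (I F))) = X
    generalize (c₂ * (2*s*r^2*t) * ((r^2+t^2)^(-s) * (r^2+t^2)⁻¹)) • z = Y
    simp only [blin_add_left, blin_rsmul_left]
    push_cast
    ring
  by_cases hInt : Integrable (fun t => blin (G t) (Lst (2-2*s) p ℓ (fun y => ψ y) (app x t)))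
  swap
  · exact integral_undef hInt
  refine integral_eq_zero_of_hasDerivAt_of_integrable hder hInt ?_
  obtain ⟨C0, hC0, h0⟩ := schw_line ℓ hℓ ψ x hx
  obtain ⟨C1, hC1, h1⟩ := schw_line ℓ hℓ (sD ℓ ψ) x hx
  simp only [sD_apply] at h1
  set b := ‖(blinC : Lam n →L[ℂ] Lam n →L[ℂ] ℂ)‖ with hb
  set D1 := (|c₁| * ‖I (E F)‖ + |c₂| * κ * ‖E (I F)‖ + |c₂| * (κ * r) * ‖z‖) * (r^2)^(-s) with hD1
  set D2 := |c₂ * κ| * (r^2)^(-s) * ‖z‖ with hD2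
  have hκ0 : 0 < κ := by linarith
  have hc : Continuous Φ := continuous_iff_continuousAt.2 fun t => (hder t).continuousAt
  refine ((int_rpow 1 r (by norm_num) hr).const_mul (b * D1 * C1 + b * D2 * C0)).mono' hc.aestronglyMeasurable
    (Filter.Eventually.of_forall fun t => ?_)
  have hR : 0 < r^2+t^2 := by positivity
  rw [Real.rpow_neg_one]
  have hPle := rho_neg_le s r t (by linarith) hr
  have hP : 0 < (r^2+t^2)^(-s) := Real.rpow_pos_of_pos (by positivity) _
  have g1 : ‖(r^2+t^2) • G t‖ ≤ (r^2+t^2) * D1 := by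
    rw [norm_smul, Real.norm_of_nonneg hR.le]
    refine mul_le_mul_of_nonneg_left ((Gs_bound s κ r c₁ c₂ hs hκ hr _ _ _ t).trans ?_) hR.le
    exact mul_le_mul_of_nonneg_left hPle (by positivity)
  have g2 : ‖(-(c₂ * κ * r^2 * (r^2+t^2)^(-s))) • z‖ ≤ (r^2+t^2) * D2 := by
    rw [norm_smul, norm_neg, Real.norm_eq_abs, abs_mul, abs_mul, abs_of_pos hP, abs_of_pos (by positivity : 0 < r^2), hD2]
    have : r^2 * (r^2+t^2)^(-s) ≤ (r^2+t^2) * (r^2)^(-s) :=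
      mul_le_mul (by nlinarith [sq_nonneg t]) hPle hP.le hR.le
    calc _ = |c₂*κ| * (r^2 * (r^2+t^2)^(-s)) * ‖z‖ := by ring
      _ ≤ |c₂*κ| * ((r^2+t^2) * (r^2)^(-s)) * ‖z‖ := by gcongr
      _ = _ := by ring
  have hD1p : 0 ≤ D1 := by positivity
  have hD2p : 0 ≤ D2 := by positivity
  have hbp : 0 ≤ b := norm_nonneg (blinC : Lam n →L[ℂ] Lam n →L[ℂ] ℂ)
  calc ‖Φ t‖ ≤ b * ((r^2+t^2) * D1) * (C1 * ((r^2+t^2)⁻¹)^2) + b * ((r^2+t^2) * D2) * (C0 * ((r^2+t^2)⁻¹)^2) := by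
        refine (norm_sub_le _ _).trans (add_le_add ?_ ?_)
        · refine (blin_norm _ _).trans ?_
          exact mul_le_mul (mul_le_mul_of_nonneg_left g1 hbp) (h1 t) (norm_nonneg _) (by positivity)
        · refine (blin_norm _ _).trans ?_
          exact mul_le_mul (mul_le_mul_of_nonneg_left g2 hbp) (h0 t) (norm_nonneg _) (by positivity)
    _ = (b * D1 * C1 + b * D2 * C0) * (r^2+t^2)⁻¹ := by field_simp


/-- second radial profile -/
def k2 (s κ r t : ℝ) : ℝ := ((κ/2-s)*t^2+(κ/2+s)*r^2) * ((r^2+t^2)^(-s) * (r^2+t^2)⁻¹)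

def cc0 (s : ℝ) : ℝ := ∫ t : ℝ, (1^2+t^2)^(-s)
def cc2 (s κ : ℝ) : ℝ := ∫ t : ℝ, k2 s κ 1 t

lemma rho_scale (s r t : ℝ) (hr : 0 < r) : (r^2+t^2)^(-s) = r^(-(2*s)) * (1^2+(t/r)^2)^(-s) := by
  rw [show -(2*s) = 2 * (-s) by ring, Real.rpow_mul hr.le, ← Real.mul_rpow (by positivity) (by positivity)]
  congr 1
  norm_num
  field_simp

lemma int0_scale (s r : ℝ) (hr : 0 < r) : ∫ t : ℝ, (r^2+t^2)^(-s) = r^(1-2*s) * cc0 s := by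
  simp only [rho_scale s r _ hr]
  rw [integral_const_mul, Measure.integral_comp_div (fun t : ℝ => (1^2+t^2)^(-s)) r, smul_eq_mul, abs_of_pos hr,
    sub_eq_add_neg, Real.rpow_add hr, Real.rpow_one]
  unfold cc0
  ring

lemma k2_scale (s κ r t : ℝ) (hr : 0 < r) : k2 s κ r t = r^(-(2*s)) * k2 s κ 1 (t/r) := by
  unfold k2
  rw [rho_scale s r t hr]
  generalize (1^2+(t/r)^2)^(-s) = P
  have h : 0 < r^2+t^2 := by positivity
  have h1 : 0 < 1^2+(t/r)^2 := by positivity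
  have : (1^2+(t/r)^2)⁻¹ = r^2 * (r^2+t^2)⁻¹ := by
    field_simp
  rw [this]
  field_simp

lemma int2_scale (s κ r : ℝ) (hr : 0 < r) : ∫ t : ℝ, k2 s κ r t = r^(1-2*s) * cc2 s κ := by
  simp only [k2_scale s κ r _ hr]
  rw [integral_const_mul, Measure.integral_comp_div (fun t : ℝ => k2 s κ 1 t) r, smul_eq_mul, abs_of_pos hr,
    sub_eq_add_neg, Real.rpow_add hr, Real.rpow_one]
  unfold cc2
  ring

lemma k2_cont (s κ r : ℝ) (hr : 0 < r) : Continuous (k2 s κ r) := by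
  unfold k2
  have h : ∀ t : ℝ, r^2+t^2 ≠ 0 := fun t => by positivity
  have h1 : Continuous (fun t : ℝ => (r^2+t^2)^(-s)) := Continuous.rpow_const (by fun_prop) fun t => Or.inl (h t)
  have h2 : Continuous (fun t : ℝ => (r^2+t^2)⁻¹) := Continuous.inv₀ (by fun_prop) h
  fun_prop

lemma k2_int (s κ r : ℝ) (hs : 1/2 < s) (hκ : 2*s < κ) (hr : 0 < r) : Integrable (k2 s κ r) := by
  refine ((int_rpow s r hs hr).const_mul κ).mono' (k2_cont s κ r hr).aestronglyMeasurable
    (Filter.Eventually.of_forall fun t => ?_)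
  exact (coef_bound s κ r t hs hκ hr).1

lemma cc0_pos (s : ℝ) (hs : 1/2 < s) : 0 < cc0 s := by
  have hp : ∀ t : ℝ, 0 < ((1:ℝ)^2+t^2)^(-s) := fun t => by positivity
  refine (integral_pos_iff_support_of_nonneg (fun t => (hp t).le) (int_rpow s 1 hs one_pos)).2 ?_
  rw [show Function.support (fun t : ℝ => ((1:ℝ)^2+t^2)^(-s)) = Set.univ from
    Set.eq_univ_of_forall fun t => (hp t).ne']
  simp

lemma cc2_pos (s κ : ℝ) (hs : 1/2 < s) (hκ : 2*s < κ) : 0 < cc2 s κ := by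
  have hp : ∀ t : ℝ, 0 < k2 s κ 1 t := fun t => by
    have h1 : 0 ≤ (κ/2-s)*t^2 := mul_nonneg (by linarith) (sq_nonneg t)
    have h2 : 0 < (κ/2+s)*1^2 := by linarith
    unfold k2
    have : 0 < (1:ℝ)^2+t^2 := by positivity
    exact mul_pos (by linarith) (by positivity)
  refine (integral_pos_iff_support_of_nonneg (fun t => (hp t).le) (k2_int s κ 1 hs hκ one_pos)).2 ?_
  rw [show Function.support (k2 s κ 1) = Set.univ from
    Set.eq_univ_of_forall fun t => (hp t).ne']
  simp

/-- the solution in split coordinates -/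
def SolQ (s κ c₁ c₂ : ℝ) (ℓ : Fin n) (q : Rn (n-1) × ℝ) (v : Lam (n-1)) : Lam n :=
  Gs s κ ‖q.1‖ (c₁ * ‖q.1‖^(2*s-3)) (c₂ * ‖q.1‖^(2*s-3))
    (iotC (rc (app q.1 0)) (epsC (rc (app q.1 0)) (incC v)))
    (epsC (rc (app q.1 0)) (iotC (rc (app q.1 0)) (incC v)))
    (epsC (ee ℓ) (iotC (rc (app q.1 0)) (incC v))) q.2

lemma SolQ_form (s κ c₁ c₂ : ℝ) (ℓ : Fin n) (q : Rn (n-1) × ℝ) (v : Lam (n-1)) {p : ℕ} (h : IsForm p v) :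
    IsForm p (SolQ s κ c₁ c₂ ℓ q v) := by
  have hF := inc_form (n := n) h
  exact ((iot_eps_form _ _ hF).rsmul _).add (((eps_iot_form _ _ hF).rsmul _).add ((eps_iot_form _ _ hF).rsmul _))

lemma SolQ_meas (s κ c₁ c₂ : ℝ) (ℓ : Fin n) (f : Rn (n-1) → Lam (n-1)) (hf : AEStronglyMeasurable f volume) :
    AEStronglyMeasurable (fun q : Rn (n-1) × ℝ => SolQ s κ c₁ c₂ ℓ q (f q.1)) (volume.prod volume) := by
  have h1 : AEStronglyMeasurable (fun q : Rn (n-1) × ℝ => f q.1) (volume.prod volume) := hf.comp_fst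
  have h2 : AEStronglyMeasurable (fun q : Rn (n-1) × ℝ => (incC (f q.1) : Lam n)) (volume.prod volume) :=
    incC.continuous.comp_aestronglyMeasurable h1
  have h3 : AEStronglyMeasurable (fun q : Rn (n-1) × ℝ => (app q.1 0 : Rn n)) (volume.prod volume) :=
    (app_cont.comp (by fun_prop : Continuous
      (fun z : Rn (n-1) × ℝ => (z.1, (0:ℝ))))).aestronglyMeasurable
  have hE : ∀ w : Rn (n-1) × ℝ → Lam n, AEStronglyMeasurable w (volume.prod volume) →
      AEStronglyMeasurable (fun q => epsC (rc (app q.1 0)) (w q)) (volume.prod volume) := by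
    intro w hw
    have h4 : AEStronglyMeasurable (fun q : Rn (n-1) × ℝ => ((app q.1 0 : Rn n), w q)) (volume.prod volume) :=
      h3.prodMk hw
    have h5 := Continuous.comp_aestronglyMeasurable (g := fun q : Rn n × Lam n => epsC (rc q.1) q.2) eps_cont h4
    exact h5
  have hI : ∀ w : Rn (n-1) × ℝ → Lam n, AEStronglyMeasurable w (volume.prod volume) →
      AEStronglyMeasurable (fun q => iotC (rc (app q.1 0)) (w q)) (volume.prod volume) := by
    intro w hw
    have h4 : AEStronglyMeasurable (fun q : Rn (n-1) × ℝ => ((app q.1 0 : Rn n), w q)) (volume.prod volume) :=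
      h3.prodMk hw
    have h5 := Continuous.comp_aestronglyMeasurable (g := fun q : Rn n × Lam n => iotC (rc q.1) q.2) iot_cont h4
    exact h5
  have he := (epsC (ee ℓ) : Lam n →L[ℂ] Lam n).continuous.comp_aestronglyMeasurable (hI _ h2)
  unfold SolQ Gs
  refine AEStronglyMeasurable.fun_add (AEStronglyMeasurable.fun_smul ?_ (hI _ (hE _ h2))) (AEStronglyMeasurable.fun_add
    (AEStronglyMeasurable.fun_smul ?_ (hE _ (hI _ h2))) (AEStronglyMeasurable.fun_smul ?_ he))
  · exact (by fun_prop : Measurable _).aestronglyMeasurable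
  · exact (by fun_prop : Measurable _).aestronglyMeasurable
  · exact (by fun_prop : Measurable _).aestronglyMeasurable

lemma SolQ_bound (s κ c₁ c₂ : ℝ) (hs : 1/2 < s) (hκ : 2*s < κ) (ℓ : Fin n) (hℓ : (ℓ : ℕ) = n - 1) :
    ∃ C : ℝ, 0 ≤ C ∧ ∀ (q : Rn (n-1) × ℝ) (v : Lam (n-1)), q.1 ≠ 0 →
      ‖SolQ s κ c₁ c₂ ℓ q v‖ ≤ C * ‖q.1‖^(2*s-1) * (‖q.1‖^2+q.2^2)^(-s) * ‖v‖ := by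
  obtain ⟨Ce, hCe0, hCe⟩ := eps_bound (n := n)
  obtain ⟨Ci, hCi0, hCi⟩ := iot_bound (n := n)
  set b := ‖(incC : Lam (n-1) →L[ℂ] Lam n)‖
  set d := ‖(epsC (ee ℓ) : Lam n →L[ℂ] Lam n)‖
  have hb : 0 ≤ b := norm_nonneg _
  have hd : 0 ≤ d := norm_nonneg _
  have hκ0 : 0 < κ := by linarith
  refine ⟨|c₁| * (Ci*Ce*b) + |c₂| * κ * (Ci*Ce*b) + |c₂| * κ * (d*Ci*b), by positivity, fun q v hq => ?_⟩
  have hr : 0 < ‖q.1‖ := norm_pos_iff.2 hq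
  have ha : ‖app (n := n) q.1 0‖ = ‖q.1‖ := by
    have := app_sq (n := n) ℓ hℓ q.1 0
    simp only [ne_eq, OfNat.ofNat_ne_zero, not_false_eq_true, zero_pow, add_zero] at this
    exact (pow_left_inj₀ (norm_nonneg _) (norm_nonneg _) two_ne_zero).1 this
  have hP : 0 < (‖q.1‖^2+q.2^2)^(-s) := Real.rpow_pos_of_pos (by positivity) _
  have hi := (incC : Lam (n-1) →L[ℂ] Lam n).le_opNorm v
  have hE : ∀ w : Lam n, ‖epsC (rc (app q.1 0)) w‖ ≤ Ce * ‖q.1‖ * ‖w‖ := fun w => by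
    have := hCe (app q.1 0) w; rwa [ha] at this
  have hI : ∀ w : Lam n, ‖iotC (rc (app q.1 0)) w‖ ≤ Ci * ‖q.1‖ * ‖w‖ := fun w => by
    have := hCi (app q.1 0) w; rwa [ha] at this
  have hr3 : 0 < ‖q.1‖^(2*s-3) := Real.rpow_pos_of_pos hr _
  have hrr : ‖q.1‖^(2*s-1) = ‖q.1‖^(2*s-3) * ‖q.1‖^2 := by
    rw [← Real.rpow_natCast ‖q.1‖ 2, ← Real.rpow_add hr]; congr 1; push_cast; ring
  set r := ‖q.1‖ with hrdef
  have z1 : ‖iotC (rc (app q.1 0)) (epsC (rc (app q.1 0)) (incC v))‖ ≤ Ci*r*(Ce*r*(b*‖v‖)) :=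
    (hI _).trans (mul_le_mul_of_nonneg_left ((hE _).trans (mul_le_mul_of_nonneg_left hi (by positivity))) (by positivity))
  have z2 : ‖epsC (rc (app q.1 0)) (iotC (rc (app q.1 0)) (incC v))‖ ≤ Ce*r*(Ci*r*(b*‖v‖)) :=
    (hE _).trans (mul_le_mul_of_nonneg_left ((hI _).trans (mul_le_mul_of_nonneg_left hi (by positivity))) (by positivity))
  have z3 : ‖epsC (ee ℓ) (iotC (rc (app q.1 0)) (incC v))‖ ≤ d*(Ci*r*(b*‖v‖)) :=
    ((epsC (ee ℓ) : Lam n →L[ℂ] Lam n).le_opNorm _).trans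
      (mul_le_mul_of_nonneg_left ((hI _).trans (mul_le_mul_of_nonneg_left hi (by positivity))) (by positivity))
  refine (Gs_bound s κ r _ _ hs hκ hr _ _ _ q.2).trans ?_
  rw [abs_mul, abs_mul, abs_of_pos hr3, hrr]
  generalize (r^2+q.2^2)^(-s) = P at *
  generalize r^(2*s-3) = R at *
  calc _ ≤ (|c₁| * R * (Ci*r*(Ce*r*(b*‖v‖))) + |c₂| * R * κ * (Ce*r*(Ci*r*(b*‖v‖)))
        + |c₂| * R * (κ*r) * (d*(Ci*r*(b*‖v‖)))) * P := by gcongr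
    _ = _ := by ring


lemma ae_ne0 (hn : 2 ≤ n) : ∀ᵐ x : Rn (n-1), x ≠ 0 := by
  have : NeZero (n-1) := ⟨by omega⟩
  have : Nontrivial (Rn (n-1)) := ⟨0, EuclideanSpace.single 0 1, fun h => by
    have := congrArg (fun v : Rn (n-1) => v 0) h
    simp at this⟩
  exact Measure.ae_ne volume 0

/-- the solution -/
def sol (s κ c₁ c₂ : ℝ) (ℓ : Fin n) (f : Rn (n-1) → Lam (n-1)) (ξ : Rn n) : Lam n :=
  SolQ s κ c₁ c₂ ℓ (restr ξ, ξ ℓ) (f (restr ξ))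

lemma sol_app (s κ c₁ c₂ : ℝ) (ℓ : Fin n) (hℓ : (ℓ : ℕ) = n - 1) (f : Rn (n-1) → Lam (n-1)) (x : Rn (n-1)) (t : ℝ) :
    sol s κ c₁ c₂ ℓ f (app x t) = SolQ s κ c₁ c₂ ℓ (x, t) (f x) := by
  unfold sol; rw [restr_app ℓ hℓ, app_apply_last ℓ hℓ]

lemma sol_hdot (s κ c₁ c₂ : ℝ) (hs : 1/2 < s) (hκ : 2*s < κ) (ℓ : Fin n) (hℓ : (ℓ : ℕ) = n - 1) (hn : 2 ≤ n)
    (p : ℕ) (f : Rn (n-1) → Lam (n-1)) (hf : f ∈ Hdot (n-1) (s - 1/2) p) :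
    sol s κ c₁ c₂ ℓ f ∈ Hdot n s p := by
  obtain ⟨hfm, hff, hfi⟩ := hf
  have hmq := SolQ_meas s κ c₁ c₂ ℓ f hfm
  refine ⟨?_, fun ξ => SolQ_form _ _ _ _ _ _ _ (hff _), ?_⟩
  · exact hmq.comp_measurePreserving (appE_mp ℓ hℓ).symm
  · rw [← (appE_mp ℓ hℓ).integrable_comp_emb (appE ℓ hℓ).measurableEmbedding]
    obtain ⟨C, hC0, hC⟩ := SolQ_bound s κ c₁ c₂ hs hκ ℓ hℓ
    have hdom : Integrable (fun q : Rn (n-1) × ℝ => ‖q.1‖^(4*s-2) * ‖f q.1‖^2 * (‖q.1‖^2+q.2^2)^(-s))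
        (volume.prod volume) := by
      have hm : AEStronglyMeasurable (fun q : Rn (n-1) × ℝ => ‖q.1‖^(4*s-2) * ‖f q.1‖^2 * (‖q.1‖^2+q.2^2)^(-s))
          (volume.prod volume) := by
        have h1 : AEStronglyMeasurable (fun q : Rn (n-1) × ℝ => f q.1) (volume.prod volume) := hfm.comp_fst
        refine AEStronglyMeasurable.fun_mul (AEStronglyMeasurable.fun_mul ?_ (h1.norm.pow 2)) ?_
        · exact (by fun_prop : Measurable _).aestronglyMeasurable
        · exact (by fun_prop : Measurable _).aestronglyMeasurable
      rw [integrable_prod_iff hm]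
      constructor
      · filter_upwards [ae_ne0 hn] with x hx
        exact (int_rpow s ‖x‖ hs (norm_pos_iff.2 hx)).const_mul _
      · refine (hfi.const_mul (cc0 s)).congr ?_
        filter_upwards [ae_ne0 hn] with x hx
        have hr : 0 < ‖x‖ := norm_pos_iff.2 hx
        have e : ∀ t : ℝ, ‖‖x‖^(4*s-2) * ‖f x‖^2 * (‖x‖^2+t^2)^(-s)‖ = ‖x‖^(4*s-2) * ‖f x‖^2 * (‖x‖^2+t^2)^(-s) :=
          fun t => Real.norm_of_nonneg (by positivity)
        simp only [e]
        rw [integral_const_mul, int0_scale s _ hr,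
          show ‖x‖^(2*(s-1/2)) = ‖x‖^(4*s-2) * ‖x‖^(1-2*s) by rw [← Real.rpow_add hr]; congr 1; ring]
        ring
    refine (hdom.const_mul (C^2)).mono' ?_ ?_
    · refine AEStronglyMeasurable.congr (f := fun q : Rn (n-1) × ℝ => (‖q.1‖^2+q.2^2)^s * ‖SolQ s κ c₁ c₂ ℓ q (f q.1)‖^2) ?_ ?_
      · exact ((by fun_prop : Measurable (fun q : Rn (n-1) × ℝ => (‖q.1‖^2+q.2^2)^s)).aestronglyMeasurable).fun_mul (hmq.norm.pow 2)
      · refine Filter.Eventually.of_forall fun q => ?_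
        simp only [Function.comp, appE_apply, norm_app q.1 (by omega : 1 ≤ n), sol_app s κ c₁ c₂ ℓ hℓ]
    · have hae : ∀ᵐ q : Rn (n-1) × ℝ ∂(volume.prod volume), q.1 ≠ 0 :=
        Measure.quasiMeasurePreserving_fst.ae (ae_ne0 hn)
      filter_upwards [hae] with q hq
      have hr : 0 < ‖q.1‖ := norm_pos_iff.2 hq
      simp only [Function.comp, appE_apply, norm_app q.1 (by omega : 1 ≤ n), sol_app s κ c₁ c₂ ℓ hℓ]
      rw [Real.norm_of_nonneg (by positivity)]
      have hb := hC q (f q.1) hq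
      have hP : 0 < (‖q.1‖^2+q.2^2)^s := Real.rpow_pos_of_pos (by positivity) _
      rw [show ‖q.1‖^(4*s-2) = (‖q.1‖^(2*s-1))^2 by
        rw [← Real.rpow_natCast (‖q.1‖^(2*s-1)) 2, ← Real.rpow_mul hr.le]; congr 1; push_cast; ring]
      rw [Real.rpow_neg (by positivity)] at hb ⊢
      calc _ ≤ (‖q.1‖^2+q.2^2)^s * (C * ‖q.1‖^(2*s-1) * ((‖q.1‖^2+q.2^2)^s)⁻¹ * ‖f q.1‖)^2 := by gcongr
        _ = _ := by field_simp

lemma sol_weak (s c₁ c₂ : ℝ) (hs : 1/2 < s) (p : ℕ) (hκ : 2*s < (n:ℝ)-2*p) (ℓ : Fin n) (hℓ : (ℓ : ℕ) = n - 1)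
    (hn : 2 ≤ n) (f : Rn (n-1) → Lam (n-1)) :
    WeakEig (2-2*s) p ℓ (sol s ((n:ℝ)-2*p) c₁ c₂ ℓ f) 0 := by
  rw [weak_iff]
  intro ψ
  rw [← (appE_mp ℓ hℓ).integral_comp']
  have key : ∀ H : Rn (n-1) × ℝ → ℂ, (∀ᵐ x : Rn (n-1), ∫ t, H (x, t) = 0) →
      ∫ q, H q ∂(volume.prod volume) = 0 := by
    intro H hH
    by_cases hInt : Integrable H (volume.prod volume)
    swap
    · exact integral_undef hInt
    rw [integral_prod _ hInt]
    exact integral_eq_zero_of_ae hH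
  apply key
  filter_upwards [ae_ne0 hn] with x hx
  simp only [appE_apply, sol_app s _ c₁ c₂ ℓ hℓ, SolQ]
  exact fib_sol_zero ℓ hℓ s hs p hκ x hx _ _ (incC (f x)) (iot_inc ℓ hℓ _) ψ

lemma sol_trace (s κ : ℝ) (hs : 1/2 < s) (hκ : 2*s < κ) (ℓ : Fin n) (hℓ : (ℓ : ℕ) = n - 1)
    (f : Rn (n-1) → Lam (n-1)) (x : Rn (n-1)) (hx : x ≠ 0) :
    ftrace (sol s κ (((2*Real.pi)^(-(1:ℝ)/2) * cc0 s)⁻¹) (((2*Real.pi)^(-(1:ℝ)/2) * cc2 s κ)⁻¹) ℓ f) x = f x := by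
  have hr : 0 < ‖x‖ := norm_pos_iff.2 hx
  unfold ftrace
  have h0 := cc0_pos s hs
  have h2 := cc2_pos s κ hs hκ
  set m : ℝ := (2*Real.pi)^(-(1:ℝ)/2) with hm
  have hmp : 0 < m := Real.rpow_pos_of_pos (by positivity) _
  set a₁ := (m * cc0 s)⁻¹
  set a₂ := (m * cc2 s κ)⁻¹
  set w1 : Lam (n-1) := projC (iotC (rc (app x 0)) (epsC (rc (app x 0)) (incC (f x))) : Lam n)
  set w2 : Lam (n-1) := projC (epsC (rc (app x 0)) (iotC (rc (app x 0)) (incC (f x))) : Lam n)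
  have hw : w1 + w2 = (‖x‖^2) • f x := by
    rw [← map_add, (cliff ℓ hℓ x).IE, sub_add_cancel, map_smul, Complex.coe_smul]
    congr 1
    exact projL_incL (f x)
  have e : ∀ t : ℝ, projL (sol s κ a₁ a₂ ℓ f (app x t)) =
      ((a₁ * ‖x‖^(2*s-3)) * (‖x‖^2+t^2)^(-s)) • w1 + ((a₂ * ‖x‖^(2*s-3)) * k2 s κ ‖x‖ t) • w2 := by
    intro t
    rw [sol_app s κ a₁ a₂ ℓ hℓ, ← projC_apply]
    simp only [SolQ, Gs, map_add, rsm, proj_eps ℓ hℓ, smul_zero, add_zero]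
    rw [mul_assoc (a₂ * ‖x‖^(2*s-3))]
    rfl
  simp only [e]
  rw [integral_add (((int_rpow s ‖x‖ hs hr).const_mul _).smul_const w1)
    (((k2_int s κ ‖x‖ hs hκ hr).const_mul _).smul_const w2), integral_smul_const, integral_smul_const,
    integral_const_mul, integral_const_mul, int0_scale s _ hr, int2_scale s κ _ hr]
  have hR : ‖x‖^(2*s-3) * ‖x‖^(1-2*s) * ‖x‖^2 = 1 := by
    rw [← Real.rpow_natCast ‖x‖ 2, ← Real.rpow_add hr, ← Real.rpow_add hr]
    rw [show 2*s-3+(1-2*s)+((2:ℕ):ℝ) = 0 by push_cast; ring, Real.rpow_zero]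
  have q1 : m * (a₁ * ‖x‖^(2*s-3) * (‖x‖^(1-2*s) * cc0 s)) = ‖x‖^(2*s-3) * ‖x‖^(1-2*s) := by
    simp only [a₁]; field_simp
  have q2 : m * (a₂ * ‖x‖^(2*s-3) * (‖x‖^(1-2*s) * cc2 s κ)) = ‖x‖^(2*s-3) * ‖x‖^(1-2*s) := by
    simp only [a₂]; field_simp
  rw [smul_add, smul_smul, smul_smul, q1, q2, ← smul_add, hw, smul_smul, hR, one_smul]

end Helpers

/-- well-posedness of the conformal Dirichlet problem. For every
f ∈ Ḣ^{(1-a)/2,p}(ℝ^{n-1}) there is a unique u ∈ Ḣ^{(2-a)/2,p}(ℝ^n) with Δ_{a,p}u = 0 in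
the sense of tempered distributions and u|_{ℝ^{n-1}} = f (Sobolev trace). Everything is
expressed on the Fourier transform side (g = û, f itself given by its Fourier transform),
and uniqueness is almost-everywhere uniqueness. -/
theorem stmt6 (n p : ℕ) (hn : 2 ≤ n) (hp : 2*p ≤ n)
    (a : ℝ) (ha1 : 2 - (n:ℝ) + 2*p < a) (ha2 : a < 1)
    (ℓ : Fin n) (hℓ : (ℓ : ℕ) = n - 1)
    (f : Rn (n-1) → Lam (n-1)) (hf : f ∈ Hdot (n-1) ((1-a)/2) p) :
    ∃ g ∈ Hdot n ((2-a)/2) p,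
      (WeakEig a p ℓ g 0 ∧ (∀ᵐ ξ' : Rn (n-1), ftrace g ξ' = f ξ')) ∧
      ∀ g' ∈ Hdot n ((2-a)/2) p,
        WeakEig a p ℓ g' 0 → (∀ᵐ ξ' : Rn (n-1), ftrace g' ξ' = f ξ') →
        ∀ᵐ ξ : Rn n, g' ξ = g ξ := by
  set s : ℝ := (2-a)/2 with hsd
  have has : a = 2 - 2*s := by rw [hsd]; ring
  have hs : 1/2 < s := by rw [hsd]; linarith
  have hκ : 2*s < (n:ℝ) - 2*p := by rw [hsd]; linarith
  have hf' : f ∈ Hdot (n-1) (s - 1/2) p := by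
    have : s - 1/2 = (1-a)/2 := by rw [hsd]; ring
    rw [this]; exact hf
  rw [has]
  obtain ⟨g, hg⟩ : ∃ g, g = sol s ((n:ℝ)-2*p) (((2*Real.pi)^(-(1:ℝ)/2) * cc0 s)⁻¹)
    (((2*Real.pi)^(-(1:ℝ)/2) * cc2 s ((n:ℝ)-2*p))⁻¹) ℓ f := ⟨_, rfl⟩
  have h1 : g ∈ Hdot n s p := by rw [hg]; exact sol_hdot s _ _ _ hs hκ ℓ hℓ hn p f hf'
  have h2 : WeakEig (2-2*s) p ℓ g 0 := by rw [hg]; exact sol_weak s _ _ hs p hκ ℓ hℓ hn f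
  have h3 : ∀ᵐ x : Rn (n-1), ftrace g x = f x := by
    filter_upwards [ae_ne0 hn] with x hx
    rw [hg]; exact sol_trace s _ hs hκ ℓ hℓ f x hx
  refine ⟨g, h1, ⟨h2, h3⟩, fun g' hg' hW' ht' => ?_⟩
  refine uniq ℓ hℓ hn s hs p hκ g g' h1 h2 hg' hW' ?_
  filter_upwards [h3, ht'] with x hx hx'
  rw [hx, hx']
end
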